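/- Let m : ℝ² × ℝ² → ℂ be twice continuously differentiable on (ℝ² ∖ {0}) × (ℝ² ∖ {0}) and suppose there is a constant C₀ > 0 such that for all multi-indices α, β ∈ ℕ² with |α| ≤ 2 and |β| ≤ 2 and all ξ, η ∈ ℝ² ∖ {0}, |∂_ξ^α ∂_η^β m(ξ, η)| ≤ C₀ (‖ξ‖ + ‖η‖)^{−(|α|+|β|)}. Let p, p₁, p₂ satisfy 1/p = 1/p₁ + 1/p₂ and assume either (1 < p ≤ 2 and 1 < p₁, p₂ ≤ ∞) or (2 ≤ p < ∞ and 2 ≤ p₁, p₂ < ∞). Then there exists a constant C > 0, depending only on p, p₁, p₂ and C₀, such that for all Schwartz functions f, g : ℝ² → ℂ, ‖T_m[f, g]‖_{L^p(ℝ²)} ≤ C ‖f‖_{L^{p₁}(ℝ²)} ‖g‖_{L^{p₂}(ℝ²)}, where T_m[f, g](x) := (2π)^{−2} ∫_{ℝ²} ∫_{ℝ²} e^{i x·(ξ+η)} m(ξ, η) f̂(ξ) ĝ(η) dξ dη. -/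

import Mathlib

open MeasureTheory Complex
open scoped RealInnerProductSpace ENNReal NNReal

noncomputable section

abbrev E2 : Type := EuclideanSpace ℝ (Fin 2)

/-- Rotation by 90 degrees: `η^⊥ = (-η₂, η₁)`. -/
def perp (η : E2) : E2 := (WithLp.equiv 2 (Fin 2 → ℝ)).symm ![-η 1, η 0]

/-- The first standard basis vector `e₁ = (1,0)`. -/
def e1 : E2 := EuclideanSpace.single 0 1

/-- The unit vector `a = (1/√2, 1/√2)`. -/
def aVec : E2 := (WithLp.equiv 2 (Fin 2 → ℝ)).symm ![1 / Real.sqrt 2, 1 / Real.sqrt 2]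

/-- Fourier transform `ĥ(ξ) = ∫ e^{-i x·ξ} h(x) dx`. -/
def FT (h : E2 → ℂ) (ξ : E2) : ℂ :=
  ∫ x : E2, Complex.exp (-(Complex.I * ((⟪x, ξ⟫ : ℝ) : ℂ))) * h x

/-- Partial derivative in the `i`-th coordinate of the first variable. -/
def dxi (i : Fin 2) (m : E2 → E2 → ℂ) : E2 → E2 → ℂ :=
  fun ξ η => fderiv ℝ (fun ζ => m ζ η) ξ (EuclideanSpace.single i 1)

/-- Partial derivative in the `i`-th coordinate of the second variable. -/
def deta (i : Fin 2) (m : E2 → E2 → ℂ) : E2 → E2 → ℂ :=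
  fun ξ η => fderiv ℝ (fun ζ => m ξ ζ) η (EuclideanSpace.single i 1)

/-- Mixed multi-index partial derivative `∂_ξ^α ∂_η^β m`. -/
def mderiv (α β : Fin 2 → ℕ) (m : E2 → E2 → ℂ) : E2 → E2 → ℂ :=
  (dxi 0)^[α 0] <| (dxi 1)^[α 1] <| (deta 0)^[β 0] <| (deta 1)^[β 1] m

/-- The bilinear Fourier multiplier operator
`T_m[f,g](x) = (2π)⁻² ∫∫ e^{ix·(ξ+η)} m(ξ,η) f̂(ξ) ĝ(η) dξ dη`. -/
def Tm (m : E2 → E2 → ℂ) (f g : E2 → ℂ) (x : E2) : ℂ :=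
  (((2 * Real.pi) ^ 2 : ℝ) : ℂ)⁻¹ *
    ∫ ξ : E2, ∫ η : E2,
      Complex.exp (Complex.I * ((⟪x, ξ + η⟫ : ℝ) : ℂ)) * m ξ η * FT f ξ * FT g η

/-- Side length of the dyadic cubes of generation `n`. -/
def sc (n : ℤ) : ℝ := (2 : ℝ) ^ (-n)

theorem sc_pos (n : ℤ) : 0 < sc n := by unfold sc; positivity

theorem sc_add (n m : ℤ) : sc (n + m) = sc n * sc m := by
  unfold sc; rw [← zpow_add₀ (by norm_num)]; congr 1; ring

theorem sc_anti {m n : ℤ} (h : m ≤ n) : sc n ≤ sc m := by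
  unfold sc; exact zpow_le_zpow_right₀ (by norm_num) (by omega)

/-- Integer index of the dyadic cube of generation `n` containing `x`. -/
def idx (n : ℤ) (x : E2) (i : Fin 2) : ℤ := ⌊x i / sc n⌋

/-- Lower corner of the dyadic cube of generation `n` containing `x`. -/
def corner (n : ℤ) (x : E2) : E2 := WithLp.toLp 2 (fun i => (idx n x i : ℝ) * sc n)

/-- Dyadic cube of generation `n` containing `x`. -/
def cube (n : ℤ) (x : E2) : Set E2 := {y | idx n y = idx n x}

theorem mem_cube {n : ℤ} {x y : E2} : y ∈ cube n x ↔ idx n y = idx n x := Iff.rfl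

theorem mem_cube_self (n : ℤ) (x : E2) : x ∈ cube n x := rfl

theorem cube_eq {n : ℤ} {x y : E2} (h : y ∈ cube n x) : cube n y = cube n x := by
  ext z; simp only [mem_cube] at *; rw [h]

theorem mem_cube_comm {n : ℤ} {x y : E2} : y ∈ cube n x ↔ x ∈ cube n y := by
  simp only [mem_cube]; exact eq_comm

theorem corner_eq {n : ℤ} {x y : E2} (h : y ∈ cube n x) : corner n y = corner n x := by
  unfold corner; rw [mem_cube.1 h]

theorem measurable_idx (n : ℤ) : Measurable (idx n) := by
  refine measurable_pi_lambda _ fun i => ?_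
  unfold idx
  exact Int.measurable_floor.comp (by fun_prop)

theorem measurableSet_cube (n : ℤ) (x : E2) : MeasurableSet (cube n x) :=
  measurable_idx n (measurableSet_singleton _)

theorem idx_mono_succ {n : ℤ} {x y : E2} (h : idx (n + 1) x = idx (n + 1) y) :
    idx n x = idx n y := by
  have key : ∀ z : E2, ∀ i, idx n z i = idx (n + 1) z i / 2 := by
    intro z i
    unfold idx
    have : z i / sc n = (z i / sc (n + 1)) / (2 : ℕ) := by
      rw [sc_add]; have := (sc_pos n).ne'
      have h1 : sc 1 = 1 / 2 := by norm_num [sc]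
      rw [h1]; field_simp; norm_num
    rw [this, Int.floor_div_natCast]; rfl
  funext i
  rw [key, key, h]

theorem idx_mono {m n : ℤ} (hmn : m ≤ n) {x y : E2} (h : idx n x = idx n y) :
    idx m x = idx m y := by
  obtain ⟨k, rfl⟩ := Int.le.dest hmn
  induction k with
  | zero => simpa using h
  | succ k ih =>
    apply ih (by omega)
    apply idx_mono_succ
    convert h using 2 <;> push_cast <;> ring

theorem cube_subset {m n : ℤ} (hmn : m ≤ n) (x : E2) : cube n x ⊆ cube m x :=
  fun _ hy => idx_mono hmn hy

theorem corner_apply (n : ℤ) (x : E2) (i : Fin 2) : corner n x i = (idx n x i : ℝ) * sc n := rfl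

theorem coord_sub_corner (n : ℤ) (x : E2) (i : Fin 2) :
    0 ≤ x i - corner n x i ∧ x i - corner n x i < sc n := by
  have hs := sc_pos n
  rw [corner_apply]; unfold idx
  have h1 := Int.floor_le (x i / sc n)
  have h2 := Int.lt_floor_add_one (x i / sc n)
  rw [le_div_iff₀ hs] at h1
  rw [div_lt_iff₀ hs] at h2
  constructor <;> nlinarith

theorem norm_le_of_coord {x : E2} {a : ℝ} (h : ∀ i, |x i| ≤ a) : ‖x‖ ≤ 3 / 2 * a := by
  have ha : 0 ≤ a := (abs_nonneg _).trans (h 0)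
  rw [EuclideanSpace.norm_eq]
  apply Real.sqrt_le_iff.2
  refine ⟨by positivity, ?_⟩
  simp only [Fin.sum_univ_two, Real.norm_eq_abs]
  have h0 := h 0
  have h1 := h 1
  nlinarith [abs_nonneg (x 0), abs_nonneg (x 1)]

theorem dist_corner (n : ℤ) (x : E2) : dist x (corner n x) ≤ 3 / 2 * sc n := by
  rw [dist_eq_norm]
  apply norm_le_of_coord
  intro i
  have := coord_sub_corner n x i
  rw [PiLp.sub_apply, abs_of_nonneg this.1]
  exact this.2.le

theorem dist_cube {n : ℤ} {x y : E2} (h : y ∈ cube n x) : dist y x ≤ 3 / 2 * sc n := by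
  rw [dist_eq_norm]
  apply norm_le_of_coord
  intro i
  have h1 := coord_sub_corner n x i
  have h2 := coord_sub_corner n y i
  rw [corner_eq h] at h2
  rw [PiLp.sub_apply, abs_le]
  constructor <;> linarith [h1.1, h1.2, h2.1, h2.2]

theorem cube_eq_preimage (n : ℤ) (x : E2) :
    cube n x = (WithLp.ofLp : E2 → Fin 2 → ℝ) ⁻¹'
      (Set.univ.pi fun i => Set.Ico (corner n x i) (corner n x i + sc n)) := by
  have hs := sc_pos n
  ext y
  simp only [mem_cube, Set.mem_preimage, Set.mem_pi, Set.mem_univ, true_imp_iff, Set.mem_Ico]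
  constructor
  · intro h i
    have := coord_sub_corner n y i
    rw [corner_eq (mem_cube.2 h)] at this
    constructor <;> linarith [this.1, this.2]
  · intro h
    funext i
    have := h i
    rw [corner_apply] at this
    change ⌊y i / sc n⌋ = _
    rw [Int.floor_eq_iff, le_div_iff₀ hs, div_lt_iff₀ hs]
    constructor
    · exact this.1
    · nlinarith [this.2]

theorem volume_cube (n : ℤ) (x : E2) : volume (cube n x) = ENNReal.ofReal (sc n ^ 2) := by
  have hs := sc_pos n
  rw [cube_eq_preimage, (PiLp.volume_preserving_ofLp (Fin 2)).measure_preimage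
    (MeasurableSet.univ_pi fun i => measurableSet_Ico).nullMeasurableSet, Real.volume_pi_Ico]
  simp [← ENNReal.ofReal_mul hs.le, sq]

theorem volume_closedBall_E2 (x : E2) {r : ℝ} (hr : 0 ≤ r) :
    volume (Metric.closedBall x r) = ENNReal.ofReal (Real.pi * r ^ 2) := by
  rw [EuclideanSpace.volume_closedBall_fin_two, ← ENNReal.ofReal_pow hr, mul_comm,
    ENNReal.ofReal_mul Real.pi_pos.le]

/-- Enlarged dyadic average of generation `n` at `x`. -/
def avg (n : ℤ) (f : E2 → ℝ≥0∞) (x : E2) : ℝ≥0∞ :=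
  ENNReal.ofReal ((sc n ^ 2)⁻¹) * ∫⁻ y in Metric.closedBall (corner n x) (6 * sc n), f y

/-- Dyadic-type maximal function. -/
def dmax (f : E2 → ℝ≥0∞) (x : E2) : ℝ≥0∞ := ⨆ n, avg n f x

theorem avg_congr {n : ℤ} {x y : E2} (h : y ∈ cube n x) (f : E2 → ℝ≥0∞) :
    avg n f y = avg n f x := by
  unfold avg; rw [corner_eq h]

theorem avg_le_dmax (n : ℤ) (f : E2 → ℝ≥0∞) (x : E2) : avg n f x ≤ dmax f x :=
  le_iSup (fun n => avg n f x) n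

theorem measurable_avg (n : ℤ) (f : E2 → ℝ≥0∞) : Measurable (avg n f) := by
  have : avg n f = (fun j : Fin 2 → ℤ => ENNReal.ofReal ((sc n ^ 2)⁻¹) *
      ∫⁻ y in Metric.closedBall (WithLp.toLp 2 (fun i => (j i : ℝ) * sc n) : E2) (6 * sc n), f y) ∘
      idx n := rfl
  rw [this]
  exact (measurable_of_countable _).comp (measurable_idx n)

theorem measurable_dmax (f : E2 → ℝ≥0∞) : Measurable (dmax f) :=
  Measurable.iSup fun n => measurable_avg n f

theorem avg_mono {f g : E2 → ℝ≥0∞} (h : ∀ x, f x ≤ g x) (n : ℤ) (x : E2) :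
    avg n f x ≤ avg n g x := by
  unfold avg; gcongr; exact h _

theorem avg_const (n : ℤ) (c : ℝ≥0∞) (x : E2) :
    avg n (fun _ => c) x = ENNReal.ofReal (36 * Real.pi) * c := by
  have hs := sc_pos n
  unfold avg
  rw [setLIntegral_const, volume_closedBall_E2 _ (by positivity), mul_comm c, ← mul_assoc,
    ← ENNReal.ofReal_mul (by positivity)]
  congr 2; field_simp; norm_num

theorem avg_add {f g : E2 → ℝ≥0∞} (hf : Measurable f) (n : ℤ) (x : E2) :
    avg n (fun y => f y + g y) x = avg n f x + avg n g x := by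
  unfold avg; rw [lintegral_add_left hf, mul_add]

theorem dmax_le_const {f : E2 → ℝ≥0∞} {c : ℝ≥0∞} (h : ∀ x, f x ≤ c) (x : E2) :
    dmax f x ≤ ENNReal.ofReal (36 * Real.pi) * c :=
  iSup_le fun n => (avg_mono h n x).trans (avg_const n c x).le

theorem avg_lt_iff {n : ℤ} {f : E2 → ℝ≥0∞} {x : E2} {l : ℝ≥0∞} :
    l < avg n f x ↔
      l * ENNReal.ofReal (sc n ^ 2) < ∫⁻ y in Metric.closedBall (corner n x) (6 * sc n), f y := by
  have hs := sc_pos n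
  unfold avg
  rw [ENNReal.ofReal_inv_of_pos (by positivity), mul_comm, ← div_eq_mul_inv,
    ENNReal.lt_div_iff_mul_lt (Or.inl (by simp [hs.ne'])) (Or.inl (by simp))]

/-- Weak type `(1,1)` bound for `dmax`. -/
theorem dmax_weak (f : E2 → ℝ≥0∞) (l : ℝ≥0∞) :
    l * volume {x | l < dmax f x} ≤ ENNReal.ofReal (900 * Real.pi) * ∫⁻ x, f x := by
  rcases eq_or_ne l 0 with rfl | hl0
  · simp
  rcases eq_or_ne l ⊤ with rfl | hl1
  · simp
  rcases eq_or_ne (∫⁻ x, f x) ⊤ with hI | hI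
  · rw [hI, ENNReal.mul_top]
    · exact le_top
    · simp [Real.pi_pos]
  set T : Set (ℤ × E2) := {a | l < avg a.1 f a.2} with hT
  have hint : ∀ a ∈ T, l * ENNReal.ofReal (sc a.1 ^ 2) ≤
      ∫⁻ y in Metric.closedBall (corner a.1 a.2) (6 * sc a.1), f y :=
    fun a ha => (avg_lt_iff.1 ha).le
  have hl : 0 < l.toReal := ENNReal.toReal_pos hl0 hl1
  have hR : ∀ a ∈ T, 6 * sc a.1 ≤ 6 * (1 + (∫⁻ x, f x).toReal / l.toReal) := by
    intro a ha
    have h1 := (hint a ha).trans (setLIntegral_le_lintegral _ _)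
    have h2 := ENNReal.toReal_mono hI h1
    rw [ENNReal.toReal_mul, ENNReal.toReal_ofReal (by positivity), mul_comm,
      ← le_div_iff₀ hl] at h2
    nlinarith [sq_nonneg (sc a.1 - 1)]
  obtain ⟨u, huT, hdis, hcov⟩ := Vitali.exists_disjoint_subfamily_covering_enlargement_closedBall T
    (fun a => corner a.1 a.2) (fun a => 6 * sc a.1) _ hR 5 (by norm_num)
  have hcount : u.Countable := hdis.countable_of_nonempty_interior fun a _ => by
    have hs := sc_pos a.1
    refine ⟨corner a.1 a.2, ?_⟩
    apply Metric.ball_subset_interior_closedBall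
    simpa using hs
  have hsub : {x | l < dmax f x} ⊆
      ⋃ a ∈ u, Metric.closedBall (corner a.1 a.2) (5 * (6 * sc a.1)) := by
    intro x hx
    obtain ⟨n, hn⟩ := lt_iSup_iff.1 (show l < ⨆ n, avg n f x from hx)
    obtain ⟨b, hb, hb'⟩ := hcov (n, x) hn
    refine Set.mem_biUnion hb (hb' ?_)
    have h1 := dist_corner n x
    have hs := sc_pos n
    simp only [Metric.mem_closedBall]
    linarith
  calc l * volume {x | l < dmax f x}
      ≤ l * ∑' a : u, volume (Metric.closedBall (corner a.1.1 a.1.2) (5 * (6 * sc a.1.1))) := by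
        gcongr
        exact (measure_mono hsub).trans (measure_biUnion_le _ hcount _)
    _ = ∑' a : u, ENNReal.ofReal (900 * Real.pi) * (l * ENNReal.ofReal (sc a.1.1 ^ 2)) := by
        rw [← ENNReal.tsum_mul_left]
        congr 1; funext a
        have hs := sc_pos a.1.1
        rw [volume_closedBall_E2 _ (by positivity),
          mul_left_comm (ENNReal.ofReal (900 * Real.pi)), ← ENNReal.ofReal_mul (by positivity)]
        congr 2; ring
    _ ≤ ∑' a : u, ENNReal.ofReal (900 * Real.pi) *
          ∫⁻ y in Metric.closedBall (corner a.1.1 a.1.2) (6 * sc a.1.1), f y := by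
        gcongr with a
        exact hint a.1 (huT a.2)
    _ = ENNReal.ofReal (900 * Real.pi) *
          ∫⁻ y in ⋃ a ∈ u, Metric.closedBall (corner a.1 a.2) (6 * sc a.1), f y := by
        rw [ENNReal.tsum_mul_left, lintegral_biUnion hcount
          (fun a _ => Metric.isClosed_closedBall.measurableSet) hdis]
    _ ≤ _ := by gcongr; exact Measure.restrict_le_self

/-- Strong type bound for `dmax` on bounded functions. -/
theorem dmax_strong {p : ℝ} (hp : 1 < p) : ∃ C : ℝ, 0 < C ∧ ∀ f : E2 → ℝ≥0∞, Measurable f →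
    (∃ B : ℝ≥0∞, B ≠ ⊤ ∧ ∀ x, f x ≤ B) →
    ∫⁻ x, dmax f x ^ p ≤ ENNReal.ofReal C * ∫⁻ x, f x ^ p := by
  set c : ℝ := 36 * Real.pi with hc
  have hc0 : 0 < c := by positivity
  set K : ℝ := 900 * Real.pi with hK
  have hK0 : 0 < K := by positivity
  refine ⟨p * (2 * K) * ((2 * c) ^ (p - 1) / (p - 1)), by
    have := sub_pos.2 hp; positivity, ?_⟩
  rintro f hf ⟨B, hB, hfB⟩
  have hM : ∀ x, dmax f x ≠ ⊤ := fun x =>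
    ne_top_of_le_ne_top (ENNReal.mul_ne_top ENNReal.ofReal_ne_top hB) (dmax_le_const hfB x)
  have hfin : ∀ x, f x ≠ ⊤ := fun x => ne_top_of_le_ne_top hB (hfB x)
  have hp0 : 0 < p := by linarith
  have h1 : ∫⁻ x, dmax f x ^ p = ∫⁻ x, ENNReal.ofReal ((dmax f x).toReal ^ p) := by
    congr 1; funext x
    rw [← ENNReal.ofReal_rpow_of_nonneg ENNReal.toReal_nonneg hp0.le, ENNReal.ofReal_toReal (hM x)]
  rw [h1, lintegral_rpow_eq_lintegral_meas_lt_mul _ (Filter.Eventually.of_forall fun x =>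
    ENNReal.toReal_nonneg) (measurable_dmax f).ennreal_toReal.aemeasurable hp0]
  have h2 : ∀ t ∈ Set.Ioi (0 : ℝ), volume {x | t < (dmax f x).toReal} *
      ENNReal.ofReal (t ^ (p - 1)) ≤ ENNReal.ofReal (2 * K) *
        ∫⁻ x, f x * (Set.Iio (2 * c * (f x).toReal)).indicator
          (fun t => ENNReal.ofReal (t ^ (p - 2))) t := by
    intro t ht
    have ht : 0 < t := ht
    set A : Set E2 := {x | t < 2 * c * (f x).toReal} with hA
    have hAm : MeasurableSet A := measurableSet_lt measurable_const
      (hf.ennreal_toReal.const_mul _)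
    have hsub : {x | t < (dmax f x).toReal} ⊆
        {x | ENNReal.ofReal (t / 2) < dmax (A.indicator f) x} := by
      intro x hx
      have hx : t < (dmax f x).toReal := hx
      have hx' : ENNReal.ofReal t < dmax f x :=
        (ENNReal.ofReal_lt_iff_lt_toReal ht.le (hM x)).2 hx
      have hb : ∀ n, avg n f x ≤ dmax (A.indicator f) x + ENNReal.ofReal (t / 2) := by
        intro n
        have hle : ∀ y, f y ≤ A.indicator f y + ENNReal.ofReal (t / (2 * c)) := by
          intro y
          by_cases hy : y ∈ A
          · simp [hy]
          · simp only [hy, not_false_eq_true, Set.indicator_of_notMem, zero_add]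
            rw [ENNReal.le_ofReal_iff_toReal_le (hfin y) (by positivity),
              le_div_iff₀ (by positivity), mul_comm]
            exact not_lt.1 hy
        refine (avg_mono hle n x).trans ?_
        rw [avg_add (hf.indicator hAm), avg_const, ← ENNReal.ofReal_mul hc0.le]
        gcongr
        · exact avg_le_dmax _ _ _
        · apply le_of_eq; field_simp
      have hb' : dmax f x ≤ _ := iSup_le hb
      have h3 := hx'.trans_le hb'
      have : ENNReal.ofReal t = ENNReal.ofReal (t / 2) + ENNReal.ofReal (t / 2) := by
        rw [← ENNReal.ofReal_add (by positivity) (by positivity)]; congr 1; ring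
      rw [this] at h3
      exact lt_of_add_lt_add_right h3
    have hw := (mul_le_mul_right (measure_mono hsub) (ENNReal.ofReal (t / 2))).trans
      (dmax_weak (A.indicator f) (ENNReal.ofReal (t / 2)))
    have e : ENNReal.ofReal (t ^ (p - 1)) =
        ENNReal.ofReal (t / 2) * (2 * ENNReal.ofReal (t ^ (p - 2))) := by
      rw [show (2 : ℝ≥0∞) = ENNReal.ofReal 2 by simp, ← ENNReal.ofReal_mul (by norm_num),
        ← ENNReal.ofReal_mul (by positivity)]
      congr 1
      rw [show p - 1 = 1 + (p - 2) by ring, Real.rpow_add ht, Real.rpow_one]; ring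
    calc volume {x | t < (dmax f x).toReal} * ENNReal.ofReal (t ^ (p - 1))
        = (ENNReal.ofReal (t / 2) * volume {x | t < (dmax f x).toReal}) *
            (2 * ENNReal.ofReal (t ^ (p - 2))) := by rw [e]; ring
      _ ≤ (ENNReal.ofReal K * ∫⁻ x, A.indicator f x) * (2 * ENNReal.ofReal (t ^ (p - 2))) := by
          gcongr
      _ = ENNReal.ofReal (2 * K) * ((∫⁻ x, A.indicator f x) * ENNReal.ofReal (t ^ (p - 2))) := by
          rw [ENNReal.ofReal_mul (p := 2) (q := K) (by norm_num), ENNReal.ofReal_ofNat]; ring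
      _ = _ := by
          rw [← lintegral_mul_const _ (hf.indicator hAm)]
          congr 2; funext x
          by_cases hx : x ∈ A
          · have : t ∈ Set.Iio (2 * c * (f x).toReal) := hx
            simp [hx, this]
          · have : t ∉ Set.Iio (2 * c * (f x).toReal) := hx
            simp only [hx, this, not_false_eq_true, Set.indicator_of_notMem, mul_zero, zero_mul]
  have hmeas : Measurable (fun q : ℝ × E2 => f q.2 * (Set.Iio (2 * c * (f q.2).toReal)).indicator
          (fun t => ENNReal.ofReal (t ^ (p - 2))) q.1) := by
    refine (hf.comp measurable_snd).mul ?_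
    have : (fun q : ℝ × E2 => (Set.Iio (2 * c * (f q.2).toReal)).indicator
          (fun t => ENNReal.ofReal (t ^ (p - 2))) q.1) =
        {q : ℝ × E2 | q.1 < 2 * c * (f q.2).toReal}.indicator
          (fun q => ENNReal.ofReal (q.1 ^ (p - 2))) := by
      funext q; simp only [Set.indicator, Set.mem_Iio, Set.mem_ofPred_eq]
    rw [this]
    refine Measurable.indicator (by fun_prop) ?_
    exact measurableSet_lt measurable_fst ((hf.comp measurable_snd).ennreal_toReal.const_mul _)
  calc ENNReal.ofReal p * ∫⁻ t in Set.Ioi (0 : ℝ), volume {x | t < (dmax f x).toReal} *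
      ENNReal.ofReal (t ^ (p - 1))
      ≤ ENNReal.ofReal p * ∫⁻ t in Set.Ioi (0 : ℝ), ENNReal.ofReal (2 * K) *
        ∫⁻ x, f x * (Set.Iio (2 * c * (f x).toReal)).indicator
          (fun t => ENNReal.ofReal (t ^ (p - 2))) t := by
        gcongr ENNReal.ofReal p * ?_
        exact setLIntegral_mono' measurableSet_Ioi h2
    _ = ENNReal.ofReal (p * (2 * K)) * ∫⁻ x, f x * ∫⁻ t in Set.Ioi (0 : ℝ),
          (Set.Iio (2 * c * (f x).toReal)).indicator (fun t => ENNReal.ofReal (t ^ (p - 2))) t := by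
        rw [lintegral_const_mul' _ _ ENNReal.ofReal_ne_top, ← mul_assoc, ← ENNReal.ofReal_mul hp0.le,
          lintegral_lintegral_swap hmeas.aemeasurable]
        congr 2; funext x
        rw [lintegral_const_mul' _ _ (hfin x)]
    _ ≤ ENNReal.ofReal (p * (2 * K)) * ∫⁻ x, ENNReal.ofReal ((2 * c) ^ (p - 1) / (p - 1)) *
          f x ^ p := by
        gcongr ENNReal.ofReal (p * (2 * K)) * ?_
        refine lintegral_mono fun x => ?_
        set F := (f x).toReal with hF
        have hF0 : 0 ≤ F := ENNReal.toReal_nonneg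
        have e1 : ∫⁻ t in Set.Ioi (0 : ℝ), (Set.Iio (2 * c * F)).indicator
            (fun t => ENNReal.ofReal (t ^ (p - 2))) t ≤
            ENNReal.ofReal ((2 * c * F) ^ (p - 1) / (p - 1)) := by
          rw [lintegral_indicator measurableSet_Iio, Measure.restrict_restrict measurableSet_Iio,
            Set.inter_comm, Set.Ioi_inter_Iio]
          have hii : IntervalIntegrable (fun t : ℝ => t ^ (p - 2)) volume 0 (2 * c * F) :=
            intervalIntegral.intervalIntegrable_rpow' (by linarith)
          have hio := (intervalIntegrable_iff_integrableOn_Ioc_of_le (by positivity)).1 hii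
          refine (lintegral_mono' (Measure.restrict_mono Set.Ioo_subset_Ioc_self le_rfl)
            le_rfl).trans ?_
          rw [← ofReal_integral_eq_lintegral_ofReal hio]
          · rw [← intervalIntegral.integral_of_le (by positivity), integral_rpow (Or.inl
              (by linarith)), Real.zero_rpow (by linarith), sub_zero,
              show p - 2 + 1 = p - 1 by ring]
          · filter_upwards [ae_restrict_mem measurableSet_Ioc] with t ht
            exact Real.rpow_nonneg ht.1.le _
        calc f x * _ ≤ ENNReal.ofReal F * ENNReal.ofReal ((2 * c * F) ^ (p - 1) / (p - 1)) := by
              rw [hF, ENNReal.ofReal_toReal (hfin x)]; exact mul_le_mul' le_rfl e1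
          _ = ENNReal.ofReal ((2 * c) ^ (p - 1) / (p - 1)) * ENNReal.ofReal (F ^ p) := by
              have := sub_pos.2 hp
              rw [← ENNReal.ofReal_mul hF0, ← ENNReal.ofReal_mul (by positivity)]
              congr 1
              rw [Real.mul_rpow (by positivity) hF0]
              rcases hF0.eq_or_lt with h0 | h0
              · rw [← h0, Real.zero_rpow hp0.ne']; ring
              · have : F ^ p = F * F ^ (p - 1) := by
                  rw [← Real.rpow_one_add' hF0 (by linarith)]; congr 1; ring
                rw [this]; ring
          _ = _ := by
              rw [← ENNReal.ofReal_rpow_of_nonneg hF0 hp0.le, hF, ENNReal.ofReal_toReal (hfin x)]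
    _ = _ := by
        rw [lintegral_const_mul' _ _ (by simp), ← mul_assoc, ← ENNReal.ofReal_mul (by positivity)]

theorem tendsto_sc : Filter.Tendsto sc Filter.atTop (nhdsWithin 0 (Set.Ioi 0)) := by
  rw [tendsto_nhdsWithin_iff]
  refine ⟨?_, Filter.Eventually.of_forall sc_pos⟩
  have h : Filter.Tendsto (fun n : ℕ => sc n) Filter.atTop (nhds 0) := by
    have : (fun n : ℕ => sc n) = fun n : ℕ => ((1 / 2 : ℝ)) ^ n := by
      funext n; unfold sc; simp [zpow_neg]
    rw [this]; exact tendsto_pow_atTop_nhds_zero_of_lt_one (by norm_num) (by norm_num)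
  rw [Metric.tendsto_atTop] at h ⊢
  intro ε hε
  obtain ⟨N, hN⟩ := h ε hε
  refine ⟨N, fun n hn => ?_⟩
  have := hN N le_rfl
  rw [Real.dist_eq, sub_zero, abs_of_pos (sc_pos _)] at *
  exact (sc_anti hn).trans_lt this

/-- A locally integrable function is dominated a.e. by its maximal function. -/
theorem ae_enorm_le_dmax {f : E2 → ℂ} (hf : LocallyIntegrable f) :
    ∀ᵐ x, ‖f x‖ₑ ≤ dmax (fun y => ‖f y‖ₑ) x := by
  filter_upwards [IsUnifLocDoublingMeasure.ae_tendsto_average volume (f := fun y => ‖f y‖)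
    (fun y => let ⟨s, hs, hi⟩ := hf y; ⟨s, hs, hi.norm⟩) 1] with x hx
  have hδ : Filter.Tendsto (fun n : ℤ => 6 * sc n) Filter.atTop (nhdsWithin 0 (Set.Ioi 0)) := by
    rw [tendsto_nhdsWithin_iff]
    refine ⟨?_, Filter.Eventually.of_forall fun n => by have := sc_pos n; simp [this]⟩
    simpa using (tendsto_nhdsWithin_iff.1 tendsto_sc).1.const_mul 6
  have h := hx (fun n => corner n x) _ hδ (Filter.Eventually.of_forall fun n => by
    have h1 := dist_corner n x
    have h2 := sc_pos n
    simp only [Metric.mem_closedBall]; linarith)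
  have h' := (ENNReal.continuous_ofReal.tendsto _).comp h
  rw [ofReal_norm] at h'
  refine le_of_tendsto h' (Filter.Eventually.of_forall fun n => ?_)
  refine le_trans ?_ (avg_le_dmax n _ x)
  have hs := sc_pos n
  have hint : IntegrableOn (fun y => ‖f y‖) (Metric.closedBall (corner n x) (6 * sc n)) :=
    (hf.integrableOn_isCompact (isCompact_closedBall _ _)).norm
  simp only [Function.comp, setAverage_eq, smul_eq_mul]
  rw [ENNReal.ofReal_mul (by positivity), ofReal_integral_eq_lintegral_ofReal hint
    (Filter.Eventually.of_forall fun y => norm_nonneg _)]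
  unfold avg
  simp only [ofReal_norm]
  gcongr
  rw [measureReal_def, volume_closedBall_E2 _ (by positivity), ENNReal.toReal_ofReal
    (by positivity)]
  nlinarith [Real.pi_gt_three, sq_nonneg (sc n)]

/-- The set of points whose generation `n` cube lies inside `Ω`. -/
def inner_part (n : ℤ) (Ω : Set E2) : Set E2 := {x | cube n x ⊆ Ω}

theorem measurableSet_inner_part (n : ℤ) (Ω : Set E2) : MeasurableSet (inner_part n Ω) := by
  have : inner_part n Ω = idx n ⁻¹' (idx n '' inner_part n Ω) := by
    ext x
    simp only [Set.mem_preimage, Set.mem_image]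
    constructor
    · intro h; exact ⟨x, h, rfl⟩
    · rintro ⟨y, hy, hyx⟩
      change cube n x ⊆ Ω
      rw [← cube_eq (mem_cube.2 hyx)]; exact hy
  rw [this]
  exact measurable_idx n (Set.to_countable _).measurableSet

/-- Bounds on all subcubes of one generation add up. -/
theorem lintegral_le_of_cubes (n : ℤ) (S : Set E2) (hS : MeasurableSet S) (F G : E2 → ℝ≥0∞)
    (hSn : ∀ x ∈ S, cube n x ⊆ S)
    (h : ∀ x ∈ S, ∫⁻ y in cube n x, F y ≤ ∫⁻ y in cube n x, G y) :
    ∫⁻ y in S, F y ≤ ∫⁻ y in S, G y := by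
  have hU : S = ⋃ j : Fin 2 → ℤ, (S ∩ idx n ⁻¹' {j}) := by
    ext x; simp
  have hm : ∀ j : Fin 2 → ℤ, MeasurableSet (S ∩ idx n ⁻¹' {j}) := fun j =>
    hS.inter (measurable_idx n (measurableSet_singleton _))
  have hd : Pairwise (Function.onFun Disjoint fun j : Fin 2 → ℤ => S ∩ idx n ⁻¹' {j}) := by
    intro i j hij
    refine Set.disjoint_left.2 fun x hx hx' => hij ?_
    rw [← (show idx n x = i from hx.2), ← (show idx n x = j from hx'.2)]
  rw [hU, lintegral_iUnion hm hd, lintegral_iUnion hm hd]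
  refine ENNReal.tsum_le_tsum fun j => ?_
  by_cases hj : ∃ x ∈ S, idx n x = j
  · obtain ⟨x, hx, rfl⟩ := hj
    have : S ∩ idx n ⁻¹' {idx n x} = cube n x := by
      ext y
      exact ⟨fun hy => hy.2, fun hy => ⟨hSn x hx hy, hy⟩⟩
    rw [this]; exact h x hx
  · have : S ∩ idx n ⁻¹' {j} = ∅ := by
      ext y
      simp only [Set.mem_inter_iff, Set.mem_preimage, Set.mem_singleton_iff, Set.mem_empty_iff_false,
        iff_false]
      exact fun hy => hj ⟨y, hy.1, hy.2⟩
    rw [this]; simp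

/-- Iterated stopping-time argument: local estimates off a stopping set of at most half the
measure yield a global estimate. -/
theorem stopping_recursion (τ : ℤ → E2 → ℝ≥0∞) (hτ : ∀ n, Measurable (τ n))
    (A : E2 → ℝ≥0∞) (C : ℝ≥0∞) (hC : C ≠ ⊤) (n1 : ℤ)
    (H : ∀ nS z, nS ≤ n1 → ∃ Ω : Set E2, MeasurableSet Ω ∧
      volume (cube nS z) ≤ 2 * volume (cube nS z \ Ω) ∧
      ∀ w ∈ cube nS z, ∫⁻ x in cube nS z, ∑ n ∈ Finset.Icc nS n1,
        (inner_part n Ω)ᶜ.indicator (τ n) x ≤ C * volume (cube nS z) * A w) (n0 : ℤ) :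
    ∫⁻ x, ∑ n ∈ Finset.Icc n0 n1, τ n x ≤ 2 * C * ∫⁻ x, A x := by
  have main : ∀ D : ℕ, ∀ nS : ℤ, nS + D = n1 + 1 → ∀ z,
      (∫⁻ x in cube nS z, ∑ n ∈ Finset.Icc nS n1, τ n x ≤ ∫⁻ x in cube nS z, 2 * C * A x) ∧
      ∀ Ω : Set E2, MeasurableSet Ω →
        ∫⁻ x in cube nS z, ∑ n ∈ Finset.Icc nS n1, (inner_part n Ω).indicator (τ n) x ≤
          ∫⁻ x in cube nS z, Ω.indicator (fun x => 2 * C * A x) x := by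
    intro D
    induction D with
    | zero =>
      intro nS hD z
      have : Finset.Icc nS n1 = ∅ := Finset.Icc_eq_empty (by push_cast at hD; omega)
      simp [this]
    | succ D ih =>
      intro nS hD z
      push_cast at hD
      have hle : nS ≤ n1 := by omega
      have hIcc : Finset.Icc nS n1 = insert nS (Finset.Icc (nS + 1) n1) := by
        ext k; simp only [Finset.mem_Icc, Finset.mem_insert]; omega
      have hnot : nS ∉ Finset.Icc (nS + 1) n1 := by simp
      have split : ∀ Ω : Set E2, MeasurableSet Ω → ¬ cube nS z ⊆ Ω →
          ∫⁻ x in cube nS z, ∑ n ∈ Finset.Icc nS n1, (inner_part n Ω).indicator (τ n) x ≤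
          ∫⁻ x in cube nS z, Ω.indicator (fun x => 2 * C * A x) x := by
        intro Ω hΩ hz
        have e : ∫⁻ x in cube nS z, ∑ n ∈ Finset.Icc nS n1, (inner_part n Ω).indicator (τ n) x =
            ∫⁻ x in cube nS z, ∑ n ∈ Finset.Icc (nS + 1) n1,
              (inner_part n Ω).indicator (τ n) x := by
          refine setLIntegral_congr_fun (measurableSet_cube _ _) fun x hx => ?_
          have : x ∉ inner_part nS Ω := fun h => hz ((cube_eq hx) ▸ h)
          simp only [hIcc, Finset.sum_insert hnot, Set.indicator_of_notMem this, zero_add]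
        rw [e]
        refine lintegral_le_of_cubes (nS + 1) _ (measurableSet_cube _ _) _ _ ?_ ?_
        · intro x hx
          rw [← cube_eq hx]
          exact cube_subset (by omega) x
        · intro x _
          exact (ih (nS + 1) (by omega) x).2 Ω hΩ
      have ha : ∫⁻ x in cube nS z, ∑ n ∈ Finset.Icc nS n1, τ n x ≤
          ∫⁻ x in cube nS z, 2 * C * A x := by
        obtain ⟨Ω, hΩ, hvol, hloc⟩ := H nS z hle
        have hns : ¬ cube nS z ⊆ Ω := by
          intro h
          rw [Set.sdiff_eq_empty.2 h, measure_empty, mul_zero, volume_cube] at hvol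
          have := sc_pos nS
          simp only [nonpos_iff_eq_zero, ENNReal.ofReal_eq_zero] at hvol
          nlinarith
        have hmeas : Measurable fun x => ∑ n ∈ Finset.Icc nS n1,
            (inner_part n Ω).indicator (τ n) x :=
          Finset.measurable_sum _ fun n _ => (hτ n).indicator (measurableSet_inner_part n Ω)
        have e : ∀ x, ∑ n ∈ Finset.Icc nS n1, τ n x =
            (∑ n ∈ Finset.Icc nS n1, (inner_part n Ω).indicator (τ n) x) +
            ∑ n ∈ Finset.Icc nS n1, (inner_part n Ω)ᶜ.indicator (τ n) x := by
          intro x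
          rw [← Finset.sum_add_distrib]
          refine Finset.sum_congr rfl fun n _ => ?_
          rw [← Pi.add_apply, Set.indicator_self_add_compl]
        simp_rw [e]
        rw [lintegral_add_left hmeas]
        have h2 : ∫⁻ x in cube nS z, ∑ n ∈ Finset.Icc nS n1,
            (inner_part n Ω)ᶜ.indicator (τ n) x ≤
            ∫⁻ x in cube nS z, Ωᶜ.indicator (fun x => 2 * C * A x) x := by
          rw [lintegral_indicator hΩ.compl, Measure.restrict_restrict hΩ.compl]
          set L := ∫⁻ x in cube nS z, ∑ n ∈ Finset.Icc nS n1,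
            (inner_part n Ω)ᶜ.indicator (τ n) x
          set S' := Ωᶜ ∩ cube nS z with hS'
          have hS'm : MeasurableSet S' := hΩ.compl.inter (measurableSet_cube _ _)
          have hv : volume (cube nS z) ≤ 2 * volume S' := by
            rw [hS', Set.inter_comm]; exact hvol
          have hv0 : volume (cube nS z) ≠ 0 := by
            rw [volume_cube]; have := sc_pos nS; simp [this.ne']
          have hvt : volume (cube nS z) ≠ ⊤ := by rw [volume_cube]; simp
          have hpt : ∀ w ∈ S', L * (volume (cube nS z))⁻¹ * 2 ≤ 2 * C * A w := by
            intro w hw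
            calc L * (volume (cube nS z))⁻¹ * 2
                ≤ C * volume (cube nS z) * A w * (volume (cube nS z))⁻¹ * 2 := by
                  gcongr; exact hloc w hw.2
              _ = 2 * C * A w * (volume (cube nS z) * (volume (cube nS z))⁻¹) := by ring
              _ = _ := by rw [ENNReal.mul_inv_cancel hv0 hvt, mul_one]
          calc L = L * (volume (cube nS z))⁻¹ * volume (cube nS z) := by
                rw [mul_assoc, ENNReal.inv_mul_cancel hv0 hvt, mul_one]
            _ ≤ L * (volume (cube nS z))⁻¹ * (2 * volume S') := by gcongr
            _ = ∫⁻ w in S', L * (volume (cube nS z))⁻¹ * 2 := by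
                rw [setLIntegral_const]; ring
            _ ≤ _ := setLIntegral_mono' hS'm hpt
        refine (add_le_add (split Ω hΩ hns) h2).trans ?_
        rw [lintegral_indicator hΩ, lintegral_indicator hΩ.compl,
          lintegral_add_compl _ hΩ]
      refine ⟨ha, fun Ω hΩ => ?_⟩
      by_cases hS : cube nS z ⊆ Ω
      · have h1 : ∫⁻ x in cube nS z, Ω.indicator (fun x => 2 * C * A x) x =
            ∫⁻ x in cube nS z, 2 * C * A x :=
          setLIntegral_congr_fun (measurableSet_cube _ _) fun x hx =>
            Set.indicator_of_mem (hS hx) _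
        rw [h1]
        refine le_trans (lintegral_mono fun x => ?_) ha
        exact Finset.sum_le_sum fun n _ => Set.indicator_le_self _ _ x
      · exact split Ω hΩ hS
  have hfin : ∀ x, ∫⁻ y in cube n0 x, ∑ n ∈ Finset.Icc n0 n1, τ n y ≤
      ∫⁻ y in cube n0 x, 2 * C * A y := by
    intro x
    by_cases h : n0 ≤ n1 + 1
    · obtain ⟨D, hD⟩ := Int.le.dest h
      exact (main D n0 hD x).1
    · have : Finset.Icc n0 n1 = ∅ := Finset.Icc_eq_empty (by omega)
      simp [this]
  have := lintegral_le_of_cubes n0 Set.univ MeasurableSet.univ _ _ (fun _ _ => Set.subset_univ _)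
    (fun x _ => hfin x)
  simp only [Measure.restrict_univ] at this
  rwa [lintegral_const_mul' _ _ (ENNReal.mul_ne_top (by simp) hC)] at this

theorem measurableSet_closedBall_prod (r : ℝ) :
    MeasurableSet {q : E2 × E2 | q.2 ∈ Metric.closedBall q.1 r} := by
  have : {q : E2 × E2 | q.2 ∈ Metric.closedBall q.1 r} = {q : E2 × E2 | dist q.2 q.1 ≤ r} := rfl
  rw [this]
  exact measurableSet_le (by fun_prop) measurable_const

theorem measurable_setLIntegral_closedBall {u : E2 → ℝ≥0∞} (hu : Measurable u) (r : ℝ) :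
    Measurable fun x => ∫⁻ y in Metric.closedBall x r, u y := by
  have : (fun x => ∫⁻ y in Metric.closedBall x r, u y) = fun x => ∫⁻ y,
      {q : E2 × E2 | q.2 ∈ Metric.closedBall q.1 r}.indicator (fun q => u q.2) (x, y) := by
    funext x
    rw [← lintegral_indicator Metric.isClosed_closedBall.measurableSet]
    rfl
  rw [this]
  exact Measurable.lintegral_prod_right
    ((hu.comp measurable_snd).indicator (measurableSet_closedBall_prod r))

theorem lintegral_setLIntegral_closedBall {u : E2 → ℝ≥0∞} (hu : Measurable u) {r : ℝ}
    (hr : 0 ≤ r) : ∫⁻ x, ∫⁻ y in Metric.closedBall x r, u y =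
      ENNReal.ofReal (Real.pi * r ^ 2) * ∫⁻ y, u y := by
  have : ∀ x, ∫⁻ y in Metric.closedBall x r, u y = ∫⁻ y,
      {q : E2 × E2 | q.2 ∈ Metric.closedBall q.1 r}.indicator (fun q => u q.2) (x, y) := by
    intro x
    rw [← lintegral_indicator Metric.isClosed_closedBall.measurableSet]
    rfl
  simp_rw [this]
  have hm : Measurable (Function.uncurry fun x y : E2 =>
      {q : E2 × E2 | q.2 ∈ Metric.closedBall q.1 r}.indicator (fun q => u q.2) (x, y)) :=
    (hu.comp measurable_snd).indicator (measurableSet_closedBall_prod r)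
  rw [lintegral_lintegral_swap hm.aemeasurable, ← lintegral_const_mul _ hu]
  congr 1; funext y
  have : ∀ x, {q : E2 × E2 | q.2 ∈ Metric.closedBall q.1 r}.indicator (fun q => u q.2) (x, y) =
      (Metric.closedBall y r).indicator (fun _ => u y) x := by
    intro x
    simp only [Set.indicator, Set.mem_ofPred_eq, Metric.mem_closedBall, dist_comm]
  simp_rw [this]
  rw [lintegral_indicator Metric.isClosed_closedBall.measurableSet, setLIntegral_const,
    volume_closedBall_E2 _ hr, mul_comm]

/-- Jensen-type inequality on a set. -/
theorem setLIntegral_rpow_le {u : E2 → ℝ≥0∞} (hu : Measurable u) (B : Set E2) {r : ℝ}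
    (hr : 1 ≤ r) : (∫⁻ y in B, u y) ^ r ≤ volume B ^ (r - 1) * ∫⁻ y in B, u y ^ r := by
  rcases hr.eq_or_lt with rfl | hr
  · simp
  have hr0 : 0 < r := by linarith
  have hc : r.HolderConjugate (r / (r - 1)) := Real.HolderConjugate.conjExponent hr
  have h := ENNReal.lintegral_mul_le_Lp_mul_Lq (volume.restrict B) hc hu.aemeasurable
    (aemeasurable_const (b := (1 : ℝ≥0∞)))
  simp only [Pi.mul_apply, mul_one, ENNReal.one_rpow, lintegral_const, one_mul,
    Measure.restrict_apply_univ] at h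
  have h2 := ENNReal.rpow_le_rpow h hr0.le
  rw [ENNReal.mul_rpow_of_nonneg _ _ hr0.le, ← ENNReal.rpow_mul, ← ENNReal.rpow_mul,
    one_div_mul_cancel hr0.ne', ENNReal.rpow_one] at h2
  refine h2.trans (le_of_eq ?_)
  rw [mul_comm]
  congr 2
  have := (sub_pos.2 hr).ne'
  field_simp

theorem dmax_rpow_le {u : E2 → ℝ≥0∞} (hu : Measurable u) {r : ℝ} (hr : 1 ≤ r) (x : E2) :
    dmax u x ^ r ≤ ENNReal.ofReal (36 * Real.pi) ^ (r - 1) * dmax (fun y => u y ^ r) x := by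
  have hr0 : 0 < r := by linarith
  rw [← ENNReal.le_rpow_inv_iff hr0]
  refine iSup_le fun n => ?_
  rw [ENNReal.le_rpow_inv_iff hr0]
  refine le_trans ?_ (mul_le_mul_right (avg_le_dmax n _ x) _)
  unfold avg
  have hs := sc_pos n
  rw [ENNReal.mul_rpow_of_nonneg _ _ hr0.le]
  refine (mul_le_mul_right (setLIntegral_rpow_le hu _ hr) _).trans (le_of_eq ?_)
  rw [volume_closedBall_E2 _ (by positivity), ← mul_assoc, ← mul_assoc]
  congr 1
  rw [ENNReal.ofReal_rpow_of_pos (by positivity), ENNReal.ofReal_rpow_of_pos (by positivity),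
    ENNReal.ofReal_rpow_of_pos (by positivity), ← ENNReal.ofReal_mul (by positivity),
    ← ENNReal.ofReal_mul (by positivity)]
  congr 1
  have : Real.pi * (6 * sc n) ^ 2 = 36 * Real.pi * sc n ^ 2 := by ring
  rw [this, Real.mul_rpow (by positivity) (by positivity), Real.inv_rpow (by positivity),
    Real.rpow_sub_one (by positivity) r, Real.rpow_sub_one (by positivity) r]
  have := (Real.rpow_pos_of_pos (show 0 < sc n ^ 2 by positivity) r).ne'
  field_simp

theorem dmax_weak_rpow {u : E2 → ℝ≥0∞} (hu : Measurable u) {r : ℝ} (hr : 1 ≤ r) (l : ℝ≥0∞) :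
    l ^ r * volume {x | l < dmax u x} ≤
      ENNReal.ofReal (36 * Real.pi) ^ (r - 1) * ENNReal.ofReal (900 * Real.pi) *
        ∫⁻ x, u x ^ r := by
  have hr0 : 0 < r := by linarith
  set K := ENNReal.ofReal (36 * Real.pi) ^ (r - 1) with hK
  have hpos : 0 < ENNReal.ofReal (36 * Real.pi) := by simp [Real.pi_pos]
  have hK0 : K ≠ 0 := (ENNReal.rpow_pos hpos ENNReal.ofReal_ne_top).ne'
  have hKt : K ≠ ⊤ := ENNReal.rpow_ne_top_of_nonneg (by linarith) ENNReal.ofReal_ne_top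
  have hsub : {x | l < dmax u x} ⊆ {x | l ^ r / K < dmax (fun y => u y ^ r) x} := by
    intro x hx
    have h1 : l ^ r < dmax u x ^ r := ENNReal.rpow_lt_rpow hx hr0
    have h2 := h1.trans_le (dmax_rpow_le hu hr x)
    exact (ENNReal.div_lt_iff (Or.inl hK0) (Or.inl hKt)).2 (by rwa [mul_comm])
  calc l ^ r * volume {x | l < dmax u x}
      = K * (l ^ r / K * volume {x | l < dmax u x}) := by
        rw [← mul_assoc, ENNReal.mul_div_cancel hK0 hKt]
    _ ≤ K * (l ^ r / K * volume {x | l ^ r / K < dmax (fun y => u y ^ r) x}) := by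
        gcongr
    _ ≤ _ := by
        rw [mul_assoc]
        exact mul_le_mul_right (dmax_weak _ _) K

/-- Local `L²` average at scale `sc n`. -/
def lav (n : ℤ) (u : E2 → ℝ≥0∞) (x : E2) : ℝ≥0∞ :=
  (ENNReal.ofReal ((sc n ^ 2)⁻¹) *
    ∫⁻ y in Metric.closedBall x (3 * sc n), u y ^ (2 : ℝ)) ^ (1 / 2 : ℝ)

theorem lav_sq (n : ℤ) (u : E2 → ℝ≥0∞) (x : E2) : lav n u x ^ (2 : ℝ) =
    ENNReal.ofReal ((sc n ^ 2)⁻¹) * ∫⁻ y in Metric.closedBall x (3 * sc n), u y ^ (2 : ℝ) := by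
  unfold lav; rw [← ENNReal.rpow_mul]; norm_num

theorem measurable_lav (n : ℤ) {u : E2 → ℝ≥0∞} (hu : Measurable u) : Measurable (lav n u) :=
  ((measurable_setLIntegral_closedBall (hu.pow_const _) _).const_mul _).pow_const _

theorem lav_mono_on {n : ℤ} {u v : E2 → ℝ≥0∞} {x : E2}
    (h : ∀ y ∈ Metric.closedBall x (3 * sc n), u y ≤ v y) : lav n u x ≤ lav n v x := by
  unfold lav
  gcongr ?_ ^ _
  gcongr _ * ?_
  refine setLIntegral_mono' Metric.isClosed_closedBall.measurableSet fun y hy => ?_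
  gcongr
  exact h y hy

theorem lav_add_le (n : ℤ) {u v : E2 → ℝ≥0∞} (hu : Measurable u) (hv : Measurable v) (x : E2) :
    lav n (fun y => u y + v y) x ≤ lav n u x + lav n v x := by
  unfold lav
  have h := ENNReal.lintegral_Lp_add_le (μ := volume.restrict (Metric.closedBall x (3 * sc n)))
    (p := 2) hu.aemeasurable hv.aemeasurable (by norm_num)
  simp only [ENNReal.mul_rpow_of_nonneg _ _ (show (0 : ℝ) ≤ 1 / 2 by norm_num), ← mul_add]
  gcongr
  exact h

theorem lintegral_lav_sq (n : ℤ) {u : E2 → ℝ≥0∞} (hu : Measurable u) :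
    ∫⁻ x, lav n u x ^ (2 : ℝ) = ENNReal.ofReal (9 * Real.pi) * ∫⁻ x, u x ^ (2 : ℝ) := by
  have hs := sc_pos n
  simp_rw [lav_sq]
  rw [lintegral_const_mul' _ _ ENNReal.ofReal_ne_top,
    lintegral_setLIntegral_closedBall (hu.pow_const _) (by positivity), ← mul_assoc,
    ← ENNReal.ofReal_mul (by positivity)]
  congr 2; field_simp; norm_num

/-- Measurable, integrable and bounded functions. -/
structure Nice (f : E2 → ℂ) : Prop where
  meas : Measurable f
  int : Integrable f
  bdd : ∃ B : ℝ, ∀ x, ‖f x‖ ≤ B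

/-- Lipschitz kernels supported in the unit ball. -/
structure IsKer (θ : E2 → ℂ) (L : ℝ) : Prop where
  bdd : ∀ x, ‖θ x‖ ≤ L
  lip : ∀ x y, ‖θ x - θ y‖ ≤ L * ‖x - y‖
  supp : ∀ x, 1 < ‖x‖ → θ x = 0

theorem IsKer.nonneg {θ : E2 → ℂ} {L : ℝ} (h : IsKer θ L) : 0 ≤ L :=
  (norm_nonneg _).trans (h.bdd 0)

theorem IsKer.continuous {θ : E2 → ℂ} {L : ℝ} (h : IsKer θ L) : Continuous θ := by
  have : LipschitzWith ⟨L, h.nonneg⟩ θ := LipschitzWith.of_dist_le_mul fun x y => by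
    rw [dist_eq_norm, dist_eq_norm]; exact h.lip x y
  exact this.continuous

/-- `L¹`-normalised dilate of `θ` at scale `sc k`. -/
def ker (θ : E2 → ℂ) (k : ℤ) (x : E2) : ℂ := (((sc k ^ 2)⁻¹ : ℝ) : ℂ) * θ ((sc k)⁻¹ • x)

/-- Convolution with a dilated kernel. -/
def cv (θ : E2 → ℂ) (k : ℤ) (f : E2 → ℂ) : E2 → ℂ :=
  convolution f (ker θ k) (ContinuousLinearMap.mul ℂ ℂ) volume

theorem cv_apply (θ : E2 → ℂ) (k : ℤ) (f : E2 → ℂ) (y : E2) :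
    cv θ k f y = ∫ w, f w * ker θ k (y - w) := rfl

theorem IsKer.continuous_ker {θ : E2 → ℂ} {L : ℝ} (h : IsKer θ L) (k : ℤ) :
    Continuous (ker θ k) := by
  have := h.continuous
  unfold ker; fun_prop

theorem IsKer.ker_supp {θ : E2 → ℂ} {L : ℝ} (h : IsKer θ L) (k : ℤ) {x : E2} (hx : sc k < ‖x‖) :
    ker θ k x = 0 := by
  have hs := sc_pos k
  unfold ker
  rw [h.supp, mul_zero]
  rw [norm_smul, Real.norm_of_nonneg (by positivity), ← div_eq_inv_mul, one_lt_div hs]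
  exact hx

theorem IsKer.norm_ker_le {θ : E2 → ℂ} {L : ℝ} (h : IsKer θ L) (k : ℤ) (x : E2) :
    ‖ker θ k x‖ ≤ (sc k ^ 2)⁻¹ * L := by
  unfold ker
  rw [norm_mul, Complex.norm_real, Real.norm_of_nonneg (by positivity)]
  gcongr
  exact h.bdd _

theorem IsKer.norm_ker_sub_le {θ : E2 → ℂ} {L : ℝ} (h : IsKer θ L) (k : ℤ) (x y : E2) :
    ‖ker θ k x - ker θ k y‖ ≤ (sc k ^ 2)⁻¹ * (L * ((sc k)⁻¹ * ‖x - y‖)) := by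
  have hs := sc_pos k
  unfold ker
  rw [← mul_sub, norm_mul, Complex.norm_real, Real.norm_of_nonneg (by positivity)]
  gcongr
  refine (h.lip _ _).trans (le_of_eq ?_)
  rw [← smul_sub, norm_smul, Real.norm_of_nonneg (by positivity)]

theorem IsKer.integrable_ker {θ : E2 → ℂ} {L : ℝ} (h : IsKer θ L) (k : ℤ) :
    Integrable (ker θ k) := by
  refine (h.continuous_ker k).integrable_of_hasCompactSupport ?_
  refine HasCompactSupport.of_support_subset_isCompact (isCompact_closedBall (0 : E2) (sc k)) ?_
  intro x hx
  by_contra hx'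
  exact hx (h.ker_supp k (by simpa using hx'))

theorem IsKer.integrable_mul_ker {θ : E2 → ℂ} {L : ℝ} (h : IsKer θ L) (k : ℤ) {f : E2 → ℂ}
    (hf : Nice f) (y : E2) : Integrable fun w => f w * ker θ k (y - w) :=
  hf.int.mul_bdd (((h.continuous_ker k).comp (by fun_prop : Continuous fun w => y - w)).aestronglyMeasurable)
    (Filter.Eventually.of_forall fun _ => h.norm_ker_le k _)

theorem Nice.cv {θ : E2 → ℂ} {L : ℝ} (h : IsKer θ L) (k : ℤ) {f : E2 → ℂ} (hf : Nice f) :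
    Nice (cv θ k f) := by
  refine ⟨?_, ?_, ?_⟩
  · have : StronglyMeasurable fun y => ∫ w, f w * ker θ k (y - w) := by
      refine StronglyMeasurable.integral_prod_right (f := fun y w => f w * ker θ k (y - w)) ?_
      have := (h.continuous_ker k).measurable
      have := hf.meas
      exact Measurable.stronglyMeasurable (by fun_prop)
    exact this.measurable
  · exact hf.int.integrable_convolution _ (h.integrable_ker k)
  · refine ⟨∫ w, ‖f w‖ * ((sc k ^ 2)⁻¹ * L), fun y => ?_⟩
    rw [cv_apply]
    refine norm_integral_le_of_norm_le (hf.int.norm.mul_const _)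
      (Filter.Eventually.of_forall fun w => ?_)
    rw [norm_mul]
    gcongr
    exact h.norm_ker_le k _

theorem IsKer.enorm_cv_le {θ : E2 → ℂ} {L : ℝ} (h : IsKer θ L) (k : ℤ) (f : E2 → ℂ) (y : E2) :
    ‖cv θ k f y‖ₑ ≤ ENNReal.ofReal ((sc k ^ 2)⁻¹ * L) *
      ∫⁻ w in Metric.closedBall y (sc k), ‖f w‖ₑ := by
  rw [cv_apply]
  refine (enorm_integral_le_lintegral_enorm _).trans ?_
  rw [← lintegral_const_mul' _ _ ENNReal.ofReal_ne_top,
    ← lintegral_indicator Metric.isClosed_closedBall.measurableSet]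
  refine lintegral_mono fun w => ?_
  by_cases hw : w ∈ Metric.closedBall y (sc k)
  · rw [Set.indicator_of_mem hw, enorm_mul, mul_comm]
    gcongr
    rw [← ofReal_norm]
    exact ENNReal.ofReal_le_ofReal (h.norm_ker_le k _)
  · rw [h.ker_supp k]
    · simp
    · rw [Metric.mem_closedBall, dist_comm, dist_eq_norm] at hw; exact not_le.1 hw

/-- Local `L²` averages of a mollified function are controlled by local `L^r` averages, with a
Bernstein-type loss. -/
theorem IsKer.lav_cv_le {θ : E2 → ℂ} {L : ℝ} (h : IsKer θ L) {r : ℝ} (hr1 : 1 ≤ r) (hr2 : r ≤ 2)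
    (n : ℤ) (j : ℕ) {f : E2 → ℂ} (hf : Measurable f) (x : E2) :
    lav n (fun y => ‖cv θ (n + j) f y‖ₑ) x ≤ ENNReal.ofReal (4 * L * 2 ^ (j * (2 / r - 1))) *
      (ENNReal.ofReal ((sc n ^ 2)⁻¹) *
        ∫⁻ y in Metric.closedBall x (4 * sc n), ‖f y‖ₑ ^ r) ^ (1 / r) := by
  have hs := sc_pos n
  set t := sc (n + j) with ht
  have ht0 : 0 < t := sc_pos _
  have hts : t ≤ sc n := sc_anti (by omega)
  have hst : (t ^ 2)⁻¹ = (sc n ^ 2)⁻¹ * 4 ^ j := by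
    rw [ht, sc_add]
    have : sc (j : ℤ) = (2 ^ j)⁻¹ := by unfold sc; simp
    rw [this, show (4 : ℝ) = 2 ^ 2 by norm_num, ← pow_mul, mul_comm 2 j, pow_mul]
    field_simp
  have hr0 : 0 < r := by linarith
  have hL := h.nonneg
  have he : 0 ≤ 2 / r - 1 := by rw [sub_nonneg, le_div_iff₀ hr0]; linarith
  set u : E2 → ℝ≥0∞ := (Metric.closedBall x (4 * sc n)).indicator fun y => ‖f y‖ₑ ^ r with hu
  have hum : Measurable u :=
    (hf.enorm.pow_const _).indicator Metric.isClosed_closedBall.measurableSet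
  set I := ∫⁻ y, u y with hI
  have hI' : ∫⁻ y in Metric.closedBall x (4 * sc n), ‖f y‖ₑ ^ r = I :=
    (lintegral_indicator Metric.isClosed_closedBall.measurableSet _).symm
  rw [hI']
  set T := ENNReal.ofReal ((t ^ 2)⁻¹) with hT
  set W : E2 → ℝ≥0∞ := fun y => T * ∫⁻ w in Metric.closedBall y t, u w with hW
  have hWm : Measurable W := (measurable_setLIntegral_closedBall hum t).const_mul _
  have hWI : ∀ y, W y ≤ T * I := fun y => by
    simp only [hW]; gcongr; exact setLIntegral_le_lintegral _ _
  have hintW : ∫⁻ y, W y = ENNReal.ofReal Real.pi * I := by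
    simp only [hW]
    rw [lintegral_const_mul' _ _ ENNReal.ofReal_ne_top, lintegral_setLIntegral_closedBall hum ht0.le,
      ← mul_assoc, ← ENNReal.ofReal_mul (by positivity)]
    congr 2; field_simp
  have hpt : ∀ y ∈ Metric.closedBall x (3 * sc n), ‖cv θ (n + j) f y‖ₑ ^ (2 : ℝ) ≤
      ENNReal.ofReal (L ^ 2 * Real.pi ^ (2 - 2 / r)) * ((T * I) ^ (2 / r - 1) * W y) := by
    intro y hy
    have h1 := h.enorm_cv_le (n + j) f y
    have h2 : (∫⁻ w in Metric.closedBall y t, ‖f w‖ₑ) ^ r ≤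
        ENNReal.ofReal (Real.pi * t ^ 2) ^ (r - 1) * ∫⁻ w in Metric.closedBall y t, u w := by
      refine (setLIntegral_rpow_le hf.enorm _ hr1).trans (le_of_eq ?_)
      rw [volume_closedBall_E2 _ ht0.le]
      congr 1
      refine setLIntegral_congr_fun Metric.isClosed_closedBall.measurableSet fun w hw => ?_
      rw [hu]
      rw [Set.indicator_of_mem]
      rw [Metric.mem_closedBall] at *
      linarith [dist_triangle w y x]
    have h3 : (T * ∫⁻ w in Metric.closedBall y t, ‖f w‖ₑ) ^ r ≤
        ENNReal.ofReal (Real.pi ^ (r - 1)) * W y := by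
      rw [ENNReal.mul_rpow_of_nonneg _ _ hr0.le]
      refine (mul_le_mul_right h2 _).trans (le_of_eq ?_)
      simp only [hW]
      rw [← mul_assoc, ← mul_assoc]
      congr 1
      rw [hT, ENNReal.ofReal_rpow_of_pos (by positivity), ENNReal.ofReal_rpow_of_pos
        (by positivity), ← ENNReal.ofReal_mul (by positivity), ← ENNReal.ofReal_mul (by positivity)]
      congr 1
      rw [Real.mul_rpow (by positivity) (by positivity), Real.inv_rpow (by positivity),
        Real.rpow_sub_one (show t ^ 2 ≠ 0 by positivity) r]
      have := (Real.rpow_pos_of_pos (show 0 < t ^ 2 by positivity) r).ne'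
      field_simp
    have h4 : (T * ∫⁻ w in Metric.closedBall y t, ‖f w‖ₑ) ^ (2 : ℝ) ≤
        ENNReal.ofReal (Real.pi ^ (2 - 2 / r)) * ((T * I) ^ (2 / r - 1) * W y) := by
      calc (T * ∫⁻ w in Metric.closedBall y t, ‖f w‖ₑ) ^ (2 : ℝ)
          = ((T * ∫⁻ w in Metric.closedBall y t, ‖f w‖ₑ) ^ r) ^ (2 / r) := by
            rw [← ENNReal.rpow_mul]; congr 1; field_simp
        _ ≤ (ENNReal.ofReal (Real.pi ^ (r - 1)) * W y) ^ (2 / r) := by gcongr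
        _ = ENNReal.ofReal (Real.pi ^ (2 - 2 / r)) * W y ^ (2 / r) := by
            rw [ENNReal.mul_rpow_of_nonneg _ _ (by positivity), ENNReal.ofReal_rpow_of_pos
              (by positivity), ← Real.rpow_mul Real.pi_pos.le]
            congr 3; field_simp
        _ = ENNReal.ofReal (Real.pi ^ (2 - 2 / r)) * (W y ^ (2 / r - 1) * W y) := by
            congr 1
            nth_rewrite 3 [← ENNReal.rpow_one (W y)]
            rw [← ENNReal.rpow_add_of_nonneg _ _ he zero_le_one]
            congr 1; ring
        _ ≤ _ := by gcongr; exact hWI y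
    calc ‖cv θ (n + j) f y‖ₑ ^ (2 : ℝ)
        ≤ (ENNReal.ofReal L * (T * ∫⁻ w in Metric.closedBall y t, ‖f w‖ₑ)) ^ (2 : ℝ) := by
          gcongr
          rw [← mul_assoc, hT, ← ENNReal.ofReal_mul hL, mul_comm L]
          exact h1
      _ = ENNReal.ofReal (L ^ 2) * (T * ∫⁻ w in Metric.closedBall y t, ‖f w‖ₑ) ^ (2 : ℝ) := by
          rw [ENNReal.mul_rpow_of_nonneg _ _ (by norm_num), ENNReal.rpow_two,
            ENNReal.ofReal_pow hL]
      _ ≤ _ := by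
          rw [ENNReal.ofReal_mul (by positivity), mul_assoc]; gcongr
  have hsq : lav n (fun y => ‖cv θ (n + j) f y‖ₑ) x ^ (2 : ℝ) ≤
      (ENNReal.ofReal (4 * L * 2 ^ (j * (2 / r - 1))) *
      (ENNReal.ofReal ((sc n ^ 2)⁻¹) * I) ^ (1 / r)) ^ (2 : ℝ) := by
    rw [lav_sq]
    calc _ ≤ ENNReal.ofReal ((sc n ^ 2)⁻¹) * ∫⁻ y in Metric.closedBall x (3 * sc n),
            ENNReal.ofReal (L ^ 2 * Real.pi ^ (2 - 2 / r)) * ((T * I) ^ (2 / r - 1) * W y) := by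
          refine mul_le_mul_right ?_ _
          exact setLIntegral_mono' Metric.isClosed_closedBall.measurableSet hpt
      _ ≤ ENNReal.ofReal ((sc n ^ 2)⁻¹) * (ENNReal.ofReal (L ^ 2 * Real.pi ^ (2 - 2 / r)) *
            ((T * I) ^ (2 / r - 1) * (ENNReal.ofReal Real.pi * I))) := by
          refine mul_le_mul_right ?_ _
          rw [lintegral_const_mul' _ _ ENNReal.ofReal_ne_top, lintegral_const_mul _ hWm, ← hintW]
          gcongr
          exact Measure.restrict_le_self
      _ = ENNReal.ofReal ((sc n ^ 2)⁻¹ * (L ^ 2 * Real.pi ^ (2 - 2 / r)) * Real.pi) *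
            T ^ (2 / r - 1) * I ^ (2 / r) := by
          rw [ENNReal.ofReal_mul (q := Real.pi) (by positivity),
            ENNReal.ofReal_mul (p := (sc n ^ 2)⁻¹) (by positivity),
            ENNReal.mul_rpow_of_nonneg _ _ he]
          have : I ^ (2 / r) = I ^ (2 / r - 1) * I := by
            nth_rewrite 3 [← ENNReal.rpow_one I]
            rw [← ENNReal.rpow_add_of_nonneg _ _ he zero_le_one]
            congr 1; ring
          rw [this]; ring
      _ ≤ ENNReal.ofReal ((4 * L * 2 ^ (j * (2 / r - 1))) ^ 2 * ((sc n ^ 2)⁻¹) ^ (2 / r)) *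
            I ^ (2 / r) := by
          gcongr ?_ * _
          rw [hT, ENNReal.ofReal_rpow_of_pos (by positivity), ← ENNReal.ofReal_mul (by positivity)]
          apply ENNReal.ofReal_le_ofReal
          rw [hst, Real.mul_rpow (by positivity) (by positivity),
            Real.rpow_sub_one (by positivity) (2 / r)]
          have e1 : ((4 : ℝ) ^ j) ^ (2 / r - 1) = (2 ^ (j * (2 / r - 1))) ^ 2 := by
            rw [← Real.rpow_natCast 4 j, ← Real.rpow_mul (by norm_num), ← Real.rpow_natCast _ 2,
              ← Real.rpow_mul (by norm_num), show (4 : ℝ) = 2 ^ (2 : ℝ) by norm_num,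
              ← Real.rpow_mul (by norm_num)]
            congr 1; push_cast; ring
          rw [e1]
          have e2 : Real.pi ^ (2 - 2 / r) * Real.pi ≤ 16 := by
            have h1 : Real.pi ^ (2 - 2 / r) ≤ Real.pi ^ (1 : ℝ) :=
              Real.rpow_le_rpow_of_exponent_le (by linarith [Real.pi_gt_three]) (by linarith)
            rw [Real.rpow_one] at h1
            nlinarith [Real.pi_pos, Real.pi_le_four]
          have e3 : (sc n ^ 2)⁻¹ * (L ^ 2 * Real.pi ^ (2 - 2 / r)) * Real.pi *
              (((sc n ^ 2)⁻¹) ^ (2 / r) / (sc n ^ 2)⁻¹ * (2 ^ (j * (2 / r - 1))) ^ 2) =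
              (Real.pi ^ (2 - 2 / r) * Real.pi) * (L ^ 2 * ((sc n ^ 2)⁻¹) ^ (2 / r) *
                (2 ^ (j * (2 / r - 1))) ^ 2) := by
            field_simp
          rw [e3]
          calc _ ≤ 16 * (L ^ 2 * ((sc n ^ 2)⁻¹) ^ (2 / r) * (2 ^ (j * (2 / r - 1))) ^ 2) := by
                gcongr
            _ = _ := by ring
      _ = _ := by
          rw [ENNReal.mul_rpow_of_nonneg _ _ (by norm_num), ← ENNReal.rpow_mul,
            ENNReal.mul_rpow_of_nonneg _ _ (by positivity), ENNReal.ofReal_mul (by positivity),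
            ENNReal.rpow_two, ENNReal.ofReal_pow (by positivity),
            ENNReal.ofReal_rpow_of_pos (by positivity), show 1 / r * 2 = 2 / r by ring, mul_assoc]
  exact (ENNReal.rpow_le_rpow_iff (by norm_num : (0 : ℝ) < 2)).1 hsq

section

theorem avg_le_four_mul (n : ℤ) (u : E2 → ℝ≥0∞) (x : E2) :
    avg n u x ≤ 4 * avg (n - 1) u x := by
  have hs := sc_pos n
  have h1 : sc (n - 1) = 2 * sc n := by
    have h2 : sc (-1) = 2 := by norm_num [sc]
    rw [sub_eq_add_neg, sc_add, h2]; ring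
  unfold avg
  rw [h1, show (4 : ℝ≥0∞) = ENNReal.ofReal 4 by simp, ← mul_assoc,
    ← ENNReal.ofReal_mul (by norm_num), show 4 * ((2 * sc n) ^ 2)⁻¹ = (sc n ^ 2)⁻¹ by
      field_simp; norm_num]
  gcongr
  have h2 := dist_corner n x
  have h3 := dist_corner (n - 1) x
  apply Metric.closedBall_subset_closedBall'
  rw [h1] at h3
  have := dist_triangle_left (corner n x) (corner (n - 1) x) x
  linarith

theorem avg_le_sixteen_mul {m n : ℤ} (hmn : m ≤ n) (u : E2 → ℝ≥0∞) {w w' x z : E2}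
    (hw : w' ∈ cube m w) (hx : dist w' x ≤ 4 * sc n) (hz : z ∈ cube n x) :
    avg m u w ≤ 16 * avg (m - 2) u z := by
  have hs := sc_pos m
  have hnm := sc_anti hmn
  have h1 : sc (m - 2) = 4 * sc m := by
    have h2 : sc (-2) = 4 := by norm_num [sc]
    rw [sub_eq_add_neg, sc_add, h2]; ring
  unfold avg
  rw [h1, show (16 : ℝ≥0∞) = ENNReal.ofReal 16 by simp, ← mul_assoc,
    ← ENNReal.ofReal_mul (by norm_num), show 16 * ((4 * sc m) ^ 2)⁻¹ = (sc m ^ 2)⁻¹ by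
      field_simp; norm_num]
  gcongr
  have h2 := dist_corner m w'
  have h3 := dist_corner (m - 2) z
  have h4 := dist_cube hz
  rw [corner_eq hw] at h2
  apply Metric.closedBall_subset_closedBall'
  rw [h1] at h3
  have := dist_triangle_left (corner m w) (corner (m - 2) z) w'
  have := dist_triangle w' z (corner (m - 2) z)
  have := dist_triangle_right w' z x
  linarith

section Stopping

variable (u : E2 → ℝ≥0∞) (α : ℝ≥0∞)

/-- Generation of the maximal dyadic cube around `w` with average exceeding `α`. -/
def stopGen (w : E2) : ℤ := sInf {n | α < avg n u w}

variable {u α}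

theorem exists_avg_le (hu : ∫⁻ x, u x ≠ ⊤) (hα : α ≠ 0) : ∃ N : ℤ, ∀ w, ∀ n ≤ N, avg n u w ≤ α := by
  rcases eq_or_ne α ⊤ with rfl | hα'
  · exact ⟨0, fun _ _ _ => le_top⟩
  have ha : 0 < α.toReal := ENNReal.toReal_pos hα hα'
  obtain ⟨m, hm⟩ := pow_unbounded_of_one_lt ((∫⁻ x, u x).toReal / α.toReal)
    (show (1 : ℝ) < 4 by norm_num)
  refine ⟨-m, fun w n hn => ?_⟩
  by_contra hlt
  have h1 := (avg_lt_iff.1 (not_le.1 hlt)).le.trans (setLIntegral_le_lintegral _ _)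
  have h2 := ENNReal.toReal_mono hu h1
  rw [ENNReal.toReal_mul, ENNReal.toReal_ofReal (by positivity), mul_comm,
    ← le_div_iff₀ ha] at h2
  have h3 := sc_anti hn
  have h4 : sc (-m) ^ 2 = 4 ^ m := by
    unfold sc; rw [neg_neg, zpow_natCast, ← pow_mul, mul_comm, pow_mul]; norm_num
  have := sc_pos (-m)
  have h5 : sc (-m) ^ 2 ≤ sc n ^ 2 := by gcongr
  linarith

theorem stopGen_mem (hu : ∫⁻ x, u x ≠ ⊤) (hα : α ≠ 0) {w : E2} (hw : α < dmax u w) :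
    α < avg (stopGen u α w) u w := by
  obtain ⟨N, hN⟩ := exists_avg_le hu hα
  have hne : {n | α < avg n u w}.Nonempty := lt_iSup_iff.1 hw
  have hbd : BddBelow {n | α < avg n u w} := ⟨N, fun n hn => by
    by_contra h
    exact absurd (hN w n (by omega)) (not_le.2 hn)⟩
  exact Int.csInf_mem hne hbd

theorem stopGen_le (hu : ∫⁻ x, u x ≠ ⊤) (hα : α ≠ 0) {w : E2} {n : ℤ} (hn : α < avg n u w) :
    stopGen u α w ≤ n := by
  obtain ⟨N, hN⟩ := exists_avg_le hu hα
  exact csInf_le ⟨N, fun n hn => by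
    by_contra h
    exact absurd (hN w n (by omega)) (not_le.2 hn)⟩ hn

theorem avg_le_of_lt_stopGen (hu : ∫⁻ x, u x ≠ ⊤) (hα : α ≠ 0) {w : E2} {n : ℤ}
    (hn : n < stopGen u α w) : avg n u w ≤ α := by
  by_contra h
  have := stopGen_le hu hα (not_le.1 h)
  omega

theorem stopGen_congr (hu : ∫⁻ x, u x ≠ ⊤) (hα : α ≠ 0) {w w' : E2} (hw : α < dmax u w)
    (h : w' ∈ cube (stopGen u α w) w) : α < dmax u w' ∧ stopGen u α w' = stopGen u α w := by
  have h1 := stopGen_mem hu hα hw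
  rw [← avg_congr h] at h1
  have hw' : α < dmax u w' := h1.trans_le (avg_le_dmax _ _ _)
  refine ⟨hw', ?_⟩
  have h2 := stopGen_le hu hα h1
  have h3 := stopGen_mem hu hα hw'
  have h4 : w ∈ cube (stopGen u α w') w' := cube_subset h2 _ (mem_cube_comm.1 h)
  rw [← avg_congr h4] at h3
  exact le_antisymm h2 (stopGen_le hu hα h3)

theorem measurable_stopGen (hu : ∫⁻ x, u x ≠ ⊤) (hα : α ≠ 0) : Measurable (stopGen u α) := by
  have hE : MeasurableSet {w | α < dmax u w} := measurableSet_lt measurable_const (measurable_dmax u)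
  refine measurable_to_countable' fun n => ?_
  have : stopGen u α ⁻¹' {n} = ({w | α < avg n u w} ∩ ⋂ m : ℤ, {w | m < n → avg m u w ≤ α}) ∪
      ({w | α < dmax u w}ᶜ ∩ {_w : E2 | n = 0}) := by
    ext w
    simp only [Set.mem_preimage, Set.mem_singleton_iff, Set.mem_union, Set.mem_inter_iff,
      Set.mem_ofPred_eq, Set.mem_iInter, Set.mem_compl_iff]
    constructor
    · rintro rfl
      by_cases hw : α < dmax u w
      · exact Or.inl ⟨stopGen_mem hu hα hw, fun m hm => avg_le_of_lt_stopGen hu hα hm⟩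
      · refine Or.inr ⟨hw, ?_⟩
        have : {n | α < avg n u w} = ∅ := by
          ext n
          simp only [Set.mem_ofPred_eq, Set.mem_empty_iff_false, iff_false]
          exact fun h => hw (h.trans_le (avg_le_dmax _ _ _))
        unfold stopGen; rw [this, Int.csInf_empty]
    · rintro (⟨h1, h2⟩ | ⟨h1, rfl⟩)
      · refine le_antisymm (stopGen_le hu hα h1) ?_
        by_contra h
        exact absurd (h2 _ (not_le.1 h)) (not_le.2 (stopGen_mem hu hα
          (h1.trans_le (avg_le_dmax _ _ _))))
      · have : {n | α < avg n u w} = ∅ := by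
          ext n
          simp only [Set.mem_ofPred_eq, Set.mem_empty_iff_false, iff_false]
          exact fun h => h1 (h.trans_le (avg_le_dmax _ _ _))
        unfold stopGen; rw [this, Int.csInf_empty]
  rw [this]
  refine MeasurableSet.union (MeasurableSet.inter (measurableSet_lt measurable_const
    (measurable_avg n u)) (MeasurableSet.iInter fun m => ?_)) (hE.compl.inter (MeasurableSet.const _))
  by_cases hm : m < n
  · simp only [hm, true_imp_iff]; exact measurableSet_le (measurable_avg m u) measurable_const
  · simp [hm]

open Classical in
/-- Averaging kernel over the stopping cubes. -/
def kst (u : E2 → ℝ≥0∞) (α : ℝ≥0∞) (w w' : E2) : ℝ :=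
  if α < dmax u w ∧ w' ∈ cube (stopGen u α w) w then (sc (stopGen u α w) ^ 2)⁻¹ else 0

theorem kst_nonneg (w w' : E2) : 0 ≤ kst u α w w' := by
  unfold kst; split_ifs <;> positivity

theorem kst_comm (hu : ∫⁻ x, u x ≠ ⊤) (hα : α ≠ 0) (w w' : E2) :
    kst u α w w' = kst u α w' w := by
  have key : ∀ w w' : E2, (α < dmax u w ∧ w' ∈ cube (stopGen u α w) w) →
      kst u α w w' = kst u α w' w := by
    intro w w' h
    obtain ⟨h1, h2⟩ := stopGen_congr hu hα h.1 h.2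
    unfold kst
    rw [if_pos h, if_pos ⟨h1, by rw [h2]; exact mem_cube_comm.1 h.2⟩, h2]
  by_cases h : α < dmax u w ∧ w' ∈ cube (stopGen u α w) w
  · exact key w w' h
  by_cases h' : α < dmax u w' ∧ w ∈ cube (stopGen u α w') w'
  · exact (key w' w h').symm
  unfold kst; rw [if_neg h, if_neg h']

theorem measurable_kst (hu : ∫⁻ x, u x ≠ ⊤) (hα : α ≠ 0) :
    Measurable fun q : E2 × E2 => kst u α q.1 q.2 := by
  have hν := measurable_stopGen hu hα
  have h1 : MeasurableSet {q : E2 × E2 | α < dmax u q.1} :=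
    measurableSet_lt measurable_const ((measurable_dmax u).comp measurable_fst)
  have h2 : MeasurableSet {q : E2 × E2 | q.2 ∈ cube (stopGen u α q.1) q.1} := by
    have hi : Measurable fun q : ℤ × E2 => idx q.1 q.2 :=
      measurable_from_prod_countable_right fun n => measurable_idx n
    have e : {q : E2 × E2 | q.2 ∈ cube (stopGen u α q.1) q.1} =
        {q : E2 × E2 | idx (stopGen u α q.1) q.2 = idx (stopGen u α q.1) q.1} := rfl
    rw [e]
    exact measurableSet_eq_fun
      (hi.comp ((hν.comp measurable_fst).prodMk measurable_snd))
      (hi.comp ((hν.comp measurable_fst).prodMk measurable_fst))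
  unfold kst
  refine Measurable.ite (h1.inter h2) ?_ measurable_const
  exact (measurable_of_countable (fun n : ℤ => (sc n ^ 2)⁻¹)).comp (hν.comp measurable_fst)

theorem lintegral_kst_mul (w : E2) (v : E2 → ℝ≥0∞) (hw : α < dmax u w) :
    ∫⁻ w', ENNReal.ofReal (kst u α w w') * v w' =
      ENNReal.ofReal ((sc (stopGen u α w) ^ 2)⁻¹) * ∫⁻ w' in cube (stopGen u α w) w, v w' := by
  rw [← lintegral_const_mul' _ _ ENNReal.ofReal_ne_top,
    ← lintegral_indicator (measurableSet_cube _ _)]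
  congr 1; funext w'
  unfold kst
  by_cases h : w' ∈ cube (stopGen u α w) w
  · rw [if_pos ⟨hw, h⟩, Set.indicator_of_mem h]
  · rw [if_neg (fun h' => h h'.2), Set.indicator_of_notMem h]; simp

theorem kst_eq_zero {w : E2} (hw : ¬ α < dmax u w) (w' : E2) : kst u α w w' = 0 := by
  unfold kst; rw [if_neg (fun h => hw h.1)]

theorem lintegral_kst (w : E2) : ∫⁻ w', ENNReal.ofReal (kst u α w w') =
    {w | α < dmax u w}.indicator (fun _ => 1) w := by
  by_cases hw : α < dmax u w
  · have := lintegral_kst_mul w (fun _ => 1) hw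
    simp only [mul_one] at this
    rw [this, Set.indicator_of_mem (s := {w | α < dmax u w}) (by exact hw), setLIntegral_const, volume_cube, one_mul,
      ← ENNReal.ofReal_mul (by have := sc_pos (stopGen u α w); positivity), inv_mul_cancel₀
        (by have := sc_pos (stopGen u α w); positivity)]
    simp
  · rw [Set.indicator_of_notMem (by exact hw)]
    simp [kst_eq_zero hw]

end Stopping

end

section

section Good

variable {u : E2 → ℝ≥0∞} {α : ℝ≥0∞}

theorem lintegral_kst_le_one (w : E2) : ∫⁻ w', ENNReal.ofReal (kst u α w w') ≤ 1 := by
  rw [lintegral_kst]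
  exact Set.indicator_le_self' (fun _ _ => zero_le) w

theorem lintegral_kst_mul_le (hu : ∫⁻ x, u x ≠ ⊤) (hα : α ≠ 0) (w : E2) :
    ∫⁻ w', ENNReal.ofReal (kst u α w w') * u w' ≤ 4 * α := by
  by_cases hw : α < dmax u w
  · rw [lintegral_kst_mul w u hw]
    calc _ ≤ avg (stopGen u α w) u w := by
          unfold avg
          refine mul_le_mul_right ?_ _
          refine lintegral_mono_set fun y hy => ?_
          rw [Metric.mem_closedBall, ← corner_eq hy]
          have := dist_corner (stopGen u α w) y
          have := sc_pos (stopGen u α w)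
          linarith
      _ ≤ 4 * avg (stopGen u α w - 1) u w := avg_le_four_mul _ _ _
      _ ≤ _ := by gcongr; exact avg_le_of_lt_stopGen hu hα (by omega)
  · simp [kst_eq_zero hw]

open Classical in
/-- The bounded part of the Calderón–Zygmund decomposition of `f`. -/
def gd (u : E2 → ℝ≥0∞) (α : ℝ≥0∞) (f : E2 → ℂ) (w' : E2) : ℂ :=
  (if α < dmax u w' then 0 else f w') + ∫ w, (kst u α w w' : ℂ) * f w

variable {f : E2 → ℂ}

theorem integrable_kst_mul (hu : ∫⁻ x, u x ≠ ⊤) (hα : α ≠ 0) (hf : Nice f) :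
    Integrable (fun q : E2 × E2 => (kst u α q.1 q.2 : ℂ) * f q.1) := by
  have hm := measurable_kst hu hα
  have hfm := hf.meas
  refine ⟨Measurable.aestronglyMeasurable (by fun_prop), ?_⟩
  rw [HasFiniteIntegral, Measure.volume_eq_prod, lintegral_prod _ (by fun_prop)]
  calc _ ≤ ∫⁻ w, ‖f w‖ₑ := by
        refine lintegral_mono fun w => ?_
        simp only [enorm_mul]
        rw [lintegral_mul_const _ (by fun_prop)]
        have : ∀ w', ‖(kst u α w w' : ℂ)‖ₑ = ENNReal.ofReal (kst u α w w') := fun w' => by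
          rw [← ofReal_norm, Complex.norm_real, Real.norm_of_nonneg (kst_nonneg _ _)]
        simp only [this]
        exact (mul_le_mul_left (lintegral_kst_le_one w) _).trans (by rw [one_mul])
    _ < ⊤ := hf.int.2

theorem enorm_integral_kst_mul_le (hu : ∫⁻ x, u x ≠ ⊤) (hα : α ≠ 0) (w' : E2) :
    ‖∫ w, (kst u α w w' : ℂ) * f w‖ₑ ≤ ∫⁻ w, ENNReal.ofReal (kst u α w' w) * ‖f w‖ₑ := by
  refine (enorm_integral_le_lintegral_enorm _).trans (le_of_eq ?_)
  congr 1; funext w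
  rw [enorm_mul, ← ofReal_norm, Complex.norm_real, Real.norm_of_nonneg (kst_nonneg _ _),
    kst_comm hu hα]

theorem nice_gd (hu : ∫⁻ x, u x ≠ ⊤) (hα : α ≠ 0) (hf : Nice f) : Nice (gd u α f) := by
  have hE : MeasurableSet {w | α < dmax u w} := measurableSet_lt measurable_const (measurable_dmax u)
  have hI := integrable_kst_mul hu hα hf
  have hm := measurable_kst hu hα
  have hfm := hf.meas
  have e : (fun w' : E2 => if α < dmax u w' then 0 else f w') = {w | α < dmax u w}ᶜ.indicator f := by
    funext w'
    by_cases h : α < dmax u w'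
    · rw [if_pos h, Set.indicator_of_notMem (by simpa using h)]
    · rw [if_neg h, Set.indicator_of_mem (by simpa using h)]
  refine ⟨?_, ?_, ?_⟩
  · unfold gd
    refine Measurable.add (Measurable.ite hE measurable_const hfm) ?_
    have : StronglyMeasurable fun w' : E2 => ∫ w, (kst u α w w' : ℂ) * f w := by
      refine StronglyMeasurable.integral_prod_left' (f := fun q : E2 × E2 =>
        (kst u α q.1 q.2 : ℂ) * f q.1) ?_
      exact Measurable.stronglyMeasurable (by fun_prop)
    exact this.measurable
  · refine Integrable.add ?_ ?_
    · exact (hf.int.indicator hE.compl).congr (by rw [← e])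
    · exact hI.integral_prod_right
  · obtain ⟨B, hB⟩ := hf.bdd
    have hB0 : 0 ≤ B := (norm_nonneg _).trans (hB 0)
    refine ⟨B + B, fun w' => (norm_add_le _ _).trans (add_le_add ?_ ?_)⟩
    · split_ifs
      · simpa
      · exact hB _
    · have h := enorm_integral_kst_mul_le (f := f) hu hα w'
      rw [← ofReal_norm] at h
      have h2 : ∫⁻ w, ENNReal.ofReal (kst u α w' w) * ‖f w‖ₑ ≤ ENNReal.ofReal B := by
        calc _ ≤ ∫⁻ w, ENNReal.ofReal (kst u α w' w) * ENNReal.ofReal B := by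
              gcongr with w
              rw [← ofReal_norm]; exact ENNReal.ofReal_le_ofReal (hB w)
          _ ≤ 1 * ENNReal.ofReal B := by
              rw [lintegral_mul_const' _ _ ENNReal.ofReal_ne_top]
              exact mul_le_mul_left (lintegral_kst_le_one w') _
          _ = _ := one_mul _
      exact (ENNReal.ofReal_le_ofReal_iff hB0).1 (h.trans h2)

theorem enorm_gd_le (hα : α ≠ 0) (hf : Nice f) :
    ∀ᵐ w, ‖gd (fun x => ‖f x‖ₑ) α f w‖ₑ ≤ 4 * α := by
  have hu : ∫⁻ x, ‖f x‖ₑ ≠ ⊤ := hf.int.2.ne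
  filter_upwards [ae_enorm_le_dmax hf.int.locallyIntegrable] with w hw
  unfold gd
  by_cases h : α < dmax (fun x => ‖f x‖ₑ) w
  · rw [if_pos h, zero_add]
    exact (enorm_integral_kst_mul_le hu hα w).trans (lintegral_kst_mul_le hu hα w)
  · rw [if_neg h]
    have : ∀ w', kst (fun x => ‖f x‖ₑ) α w' w = 0 := fun w' => by
      rw [kst_comm hu hα, kst_eq_zero h]
    simp only [this, Complex.ofReal_zero, zero_mul, integral_zero, add_zero]
    refine hw.trans ((not_lt.1 h).trans ?_)
    exact le_mul_of_one_le_left (zero_le) (by norm_num)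

theorem lintegral_kst_mul_rpow_le {v : E2 → ℝ≥0∞} (hv : Measurable v) {r : ℝ} (hr : 1 ≤ r)
    (w : E2) : (∫⁻ w', ENNReal.ofReal (kst u α w w') * v w') ^ r ≤
      ∫⁻ w', ENNReal.ofReal (kst u α w w') * v w' ^ r := by
  have hr0 : 0 < r := by linarith
  by_cases hw : α < dmax u w
  · have hs := sc_pos (stopGen u α w)
    rw [lintegral_kst_mul w v hw, lintegral_kst_mul w (fun w' => v w' ^ r) hw,
      ENNReal.mul_rpow_of_nonneg _ _ hr0.le]
    refine (mul_le_mul_right (setLIntegral_rpow_le hv _ hr) _).trans (le_of_eq ?_)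
    rw [← mul_assoc, volume_cube, ENNReal.ofReal_rpow_of_pos (by positivity),
      ENNReal.ofReal_rpow_of_pos (by positivity), ← ENNReal.ofReal_mul (by positivity)]
    congr 2
    rw [Real.rpow_sub_one (by positivity), Real.inv_rpow (by positivity)]
    have := (Real.rpow_pos_of_pos (show 0 < sc (stopGen u α w) ^ 2 by positivity) r).ne'
    field_simp
  · simp [kst_eq_zero hw, hr0]

theorem lintegral_enorm_gd_rpow_le (hu : ∫⁻ x, u x ≠ ⊤) (hα : α ≠ 0) (hf : Nice f) {r : ℝ}
    (hr : 1 ≤ r) : ∫⁻ w, ‖gd u α f w‖ₑ ^ r ≤ ∫⁻ w, ‖f w‖ₑ ^ r := by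
  have hm := measurable_kst hu hα
  have hfm := hf.meas
  have hr0 : 0 < r := by linarith
  have hE : MeasurableSet {w | α < dmax u w} := measurableSet_lt measurable_const (measurable_dmax u)
  calc _ ≤ ∫⁻ w', ({w | α < dmax u w}ᶜ.indicator (fun w => ‖f w‖ₑ ^ r) w' +
            ∫⁻ w, ENNReal.ofReal (kst u α w w') * ‖f w‖ₑ ^ r) := by
        refine lintegral_mono fun w' => ?_
        unfold gd
        by_cases h : α < dmax u w'
        · rw [if_pos h, zero_add, Set.indicator_of_notMem (by simpa using h), zero_add]
          refine (ENNReal.rpow_le_rpow (enorm_integral_kst_mul_le hu hα w') hr0.le).trans ?_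
          refine (lintegral_kst_mul_rpow_le hfm.enorm hr w').trans (le_of_eq ?_)
          simp only [kst_comm hu hα w']
        · have : ∀ w, kst u α w w' = 0 := fun w => by
            rw [kst_comm hu hα, kst_eq_zero h]
          rw [if_neg h, Set.indicator_of_mem (by simpa using h)]
          simp [this]
    _ = (∫⁻ w', {w | α < dmax u w}ᶜ.indicator (fun w => ‖f w‖ₑ ^ r) w') +
          ∫⁻ w', {w | α < dmax u w}.indicator (fun w => ‖f w‖ₑ ^ r) w' := by
        rw [lintegral_add_left ((hfm.enorm.pow_const r).indicator hE.compl),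
          lintegral_lintegral_swap (by fun_prop)]
        congr 2; funext w
        rw [lintegral_mul_const _ (by fun_prop), lintegral_kst]
        by_cases h : w ∈ {w | α < dmax u w} <;> simp [h]
    _ = _ := by
        rw [lintegral_indicator hE.compl, lintegral_indicator hE, add_comm,
          lintegral_add_compl _ hE]

theorem lintegral_sq_gd_le (hα : α ≠ 0) (hf : Nice f) {r : ℝ} (hr : 1 ≤ r) (hr2 : r ≤ 2) :
    ∫⁻ w, ‖gd (fun x => ‖f x‖ₑ) α f w‖ₑ ^ (2 : ℝ) ≤ (4 * α) ^ (2 - r) * ∫⁻ w, ‖f w‖ₑ ^ r := by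
  calc _ ≤ ∫⁻ w, (4 * α) ^ (2 - r) * ‖gd (fun x => ‖f x‖ₑ) α f w‖ₑ ^ r := by
        refine lintegral_mono_ae ?_
        filter_upwards [enorm_gd_le hα hf] with w hw
        rw [show (2 : ℝ) = (2 - r) + r by ring, ENNReal.rpow_add_of_nonneg _ _ (by linarith)
          (by linarith), show 2 - r + r - r = 2 - r by ring]
        gcongr
    _ = _ * ∫⁻ w, ‖gd (fun x => ‖f x‖ₑ) α f w‖ₑ ^ r :=
        lintegral_const_mul _ ((nice_gd hf.int.2.ne hα hf).meas.enorm.pow_const _)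
    _ ≤ _ := mul_le_mul_right (lintegral_enorm_gd_rpow_le hf.int.2.ne hα hf hr) _

end Good

end

section

section Bad

variable {u : E2 → ℝ≥0∞} {α : ℝ≥0∞} {f θ : E2 → ℂ} {L : ℝ}

/-- Majorant of a mollification of the bad part of the Calderón–Zygmund decomposition. -/
def kbad (u : E2 → ℝ≥0∞) (α : ℝ≥0∞) (θ : E2 → ℂ) (k : ℤ) (f : E2 → ℂ) (y : E2) : ℝ≥0∞ :=
  ∫⁻ w, ‖f w‖ₑ * ∫⁻ w', ENNReal.ofReal (kst u α w w') * ‖ker θ k (y - w) - ker θ k (y - w')‖ₑ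

theorem integral_kst (hu : ∫⁻ x, u x ≠ ⊤) (hα : α ≠ 0) (w : E2) :
    Integrable (fun w' => (kst u α w w' : ℂ)) ∧
      ∫ w', (kst u α w w' : ℂ) = {w | α < dmax u w}.indicator (fun _ => 1) w := by
  have hm : Measurable (kst u α w) := Measurable.of_uncurry_left (measurable_kst hu hα)
  have h1 : Integrable (fun w' => kst u α w w') := by
    refine ⟨hm.aestronglyMeasurable, ?_⟩
    rw [hasFiniteIntegral_iff_ofReal (Filter.Eventually.of_forall fun _ => kst_nonneg _ _)]
    exact (lintegral_kst_le_one w).trans_lt ENNReal.one_lt_top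
  refine ⟨h1.ofReal, ?_⟩
  have h2 : ∫ w', (kst u α w w' : ℂ) = ((∫ w', kst u α w w' : ℝ) : ℂ) := integral_ofReal
  rw [h2, integral_eq_lintegral_of_nonneg_ae
    (Filter.Eventually.of_forall fun _ => kst_nonneg _ _) hm.aestronglyMeasurable, lintegral_kst]
  by_cases h : w ∈ {w | α < dmax u w} <;> simp [h]

theorem enorm_cv_le_add (h : IsKer θ L) (k : ℤ) (hu : ∫⁻ x, u x ≠ ⊤) (hα : α ≠ 0) (hf : Nice f)
    (y : E2) : ‖cv θ k f y‖ₑ ≤ ‖cv θ k (gd u α f) y‖ₑ + kbad u α θ k f y := by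
  have hE : MeasurableSet {w | α < dmax u w} := measurableSet_lt measurable_const (measurable_dmax u)
  have hm := measurable_kst hu hα
  have hfm := hf.meas
  have hkm : Measurable (ker θ k) := (h.continuous_ker k).measurable
  set F : E2 → E2 → ℂ := fun w w' => (kst u α w w' : ℂ) * f w * ker θ k (y - w') with hF
  have hFi : Integrable (Function.uncurry F) :=
    (integrable_kst_mul hu hα hf).mul_bdd (c := (sc k ^ 2)⁻¹ * L)
      (Measurable.aestronglyMeasurable (by fun_prop))
      (Filter.Eventually.of_forall fun _ => h.norm_ker_le k _)
  have hfk := h.integrable_mul_ker k hf y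
  have h1 : cv θ k (gd u α f) y = (∫ w, (if α < dmax u w then 0 else f w) * ker θ k (y - w)) +
      ∫ w, ∫ w', F w w' := by
    rw [integral_integral_swap hFi, cv_apply, ← integral_add]
    · congr 1; funext w'
      unfold gd
      rw [add_mul, ← integral_mul_const]
    · refine (hfk.indicator hE.compl).congr (Filter.Eventually.of_forall fun w => ?_)
      by_cases hw : α < dmax u w <;> simp [hw, Set.indicator]
    · exact hFi.integral_prod_right
  have h2 : cv θ k f y - cv θ k (gd u α f) y =
      ∫ w, f w * ∫ w', (kst u α w w' : ℂ) * (ker θ k (y - w) - ker θ k (y - w')) := by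
    have i1 : Integrable fun w => (if α < dmax u w then 0 else f w) * ker θ k (y - w) := by
      refine (hfk.indicator hE.compl).congr (Filter.Eventually.of_forall fun w => ?_)
      by_cases hw : α < dmax u w <;> simp [hw, Set.indicator]
    rw [h1, cv_apply, ← sub_sub, ← integral_sub hfk i1]
    refine (integral_sub (hfk.sub i1) hFi.integral_prod_left).symm.trans ?_
    congr 1; funext w
    simp only [Pi.sub_apply, Function.uncurry_apply_pair]
    obtain ⟨i2, i3⟩ := integral_kst hu hα w
    have i4 : Integrable fun w' => (kst u α w w' : ℂ) * ker θ k (y - w') :=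
      i2.mul_bdd (c := (sc k ^ 2)⁻¹ * L) (Measurable.aestronglyMeasurable (by fun_prop))
        (Filter.Eventually.of_forall fun _ => h.norm_ker_le k _)
    simp only [mul_sub]
    rw [integral_sub (i2.mul_const _) i4, integral_mul_const, i3]
    have i5 : ∫ w', F w w' = f w * ∫ w', (kst u α w w' : ℂ) * ker θ k (y - w') := by
      rw [← integral_const_mul]; congr 1; funext w'; simp only [hF]; ring
    simp only [i5]
    by_cases hw : w ∈ {w | α < dmax u w}
    · have hw' : α < dmax u w := hw
      simp [hw']
      ring
    · have hw' : ¬ α < dmax u w := hw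
      simp [kst_eq_zero hw', hw']
  calc ‖cv θ k f y‖ₑ = ‖cv θ k (gd u α f) y + (cv θ k f y - cv θ k (gd u α f) y)‖ₑ := by ring_nf
    _ ≤ ‖cv θ k (gd u α f) y‖ₑ + ‖cv θ k f y - cv θ k (gd u α f) y‖ₑ := enorm_add_le _ _
    _ ≤ _ := by
        gcongr
        rw [h2]
        refine (enorm_integral_le_lintegral_enorm _).trans (lintegral_mono fun w => ?_)
        rw [enorm_mul]
        refine mul_le_mul_right ((enorm_integral_le_lintegral_enorm _).trans (le_of_eq ?_)) _
        congr 1; funext w'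
        rw [enorm_mul, ← ofReal_norm, Complex.norm_real, Real.norm_of_nonneg (kst_nonneg _ _)]

/-- Weight of a bad point at generation `n`, mollification parameter `k`. -/
def bwt (u : E2 → ℝ≥0∞) (α : ℝ≥0∞) (n k : ℤ) (w : E2) : ℝ≥0∞ :=
  {w | α < dmax u w ∧ n < stopGen u α w}.indicator
    (fun w => ENNReal.ofReal (min 1 (sc (stopGen u α w) / sc k))) w

theorem measurable_bwt (hu : ∫⁻ x, u x ≠ ⊤) (hα : α ≠ 0) (n k : ℤ) : Measurable (bwt u α n k) := by
  have hν := measurable_stopGen hu hα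
  have h1 : MeasurableSet {w | α < dmax u w ∧ n < stopGen u α w} :=
    (measurableSet_lt measurable_const (measurable_dmax u)).inter
      (measurableSet_lt measurable_const hν)
  unfold bwt
  refine Measurable.indicator ?_ h1
  exact (measurable_of_countable
    (fun m : ℤ => ENNReal.ofReal (min 1 (sc m / sc k)))).comp hν

theorem ker_diff_le (h : IsKer θ L) (hu : ∫⁻ x, u x ≠ ⊤) (hα : α ≠ 0) {n k : ℤ} (hnk : n ≤ k)
    {x y w w' z : E2} (hz : z ∈ cube n x) (hzα : 16 * dmax u z ≤ α)
    (hy : y ∈ Metric.closedBall x (3 * sc n)) (hk : kst u α w w' ≠ 0) :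
    ‖ker θ k (y - w) - ker θ k (y - w')‖ₑ ≤ ENNReal.ofReal (2 * L * (sc k ^ 2)⁻¹) *
        (Metric.closedBall x (6 * sc n)).indicator (bwt u α n k) w ∧
    (ker θ k (y - w) - ker θ k (y - w') ≠ 0 →
      y ∈ Metric.closedBall w (sc k) ∨ y ∈ Metric.closedBall w' (sc k)) := by
  have hL := h.nonneg
  have ht := sc_pos k
  have hs := sc_pos n
  have hts : sc k ≤ sc n := sc_anti hnk
  have key : ker θ k (y - w) - ker θ k (y - w') ≠ 0 →
      y ∈ Metric.closedBall w (sc k) ∨ y ∈ Metric.closedBall w' (sc k) := by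
    intro hne
    by_contra hcon
    rw [not_or, Metric.mem_closedBall, Metric.mem_closedBall, not_le, not_le, dist_eq_norm,
      dist_eq_norm] at hcon
    exact hne (by rw [h.ker_supp k hcon.1, h.ker_supp k hcon.2, sub_zero])
  refine ⟨?_, key⟩
  by_cases hne : ker θ k (y - w) - ker θ k (y - w') = 0
  · rw [hne]; simp
  have hw : α < dmax u w ∧ w' ∈ cube (stopGen u α w) w := by
    by_contra hcon
    exact hk (by unfold kst; rw [if_neg hcon])
  set ν := stopGen u α w with hν
  have hν0 := sc_pos ν
  rw [Metric.mem_closedBall] at hy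
  have hw'' : ∃ w'' ∈ cube ν w, dist w'' x ≤ 4 * sc n := by
    rcases key hne with h1 | h1
    · refine ⟨w, mem_cube_self _ _, ?_⟩
      rw [Metric.mem_closedBall] at h1
      linarith [dist_triangle_left w x y]
    · refine ⟨w', hw.2, ?_⟩
      rw [Metric.mem_closedBall] at h1
      linarith [dist_triangle_left w' x y]
  obtain ⟨w'', h1, h2⟩ := hw''
  have hnν : n < ν := by
    by_contra hcon
    have h3 := avg_le_sixteen_mul (not_lt.1 hcon) u h1 h2 hz
    have h4 : 16 * avg (ν - 2) u z ≤ α := (mul_le_mul_right (avg_le_dmax _ _ _) _).trans hzα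
    exact absurd (stopGen_mem hu hα hw.1) (not_lt.2 (h3.trans h4))
  have hsν : sc ν ≤ sc n := sc_anti hnν.le
  have hwx : w ∈ Metric.closedBall x (6 * sc n) := by
    rw [Metric.mem_closedBall]
    have := dist_cube h1
    linarith [dist_triangle_left w x w'']
  have hww' := dist_cube hw.2
  rw [Set.indicator_of_mem hwx]
  unfold bwt
  rw [Set.indicator_of_mem (by exact ⟨hw.1, hnν⟩), ← ENNReal.ofReal_mul (by positivity), ← hν,
    ← ofReal_norm]
  apply ENNReal.ofReal_le_ofReal
  rw [mul_min_of_nonneg _ _ (by positivity)]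
  refine le_min ?_ ?_
  · refine (norm_sub_le _ _).trans ?_
    linarith [h.norm_ker_le k (y - w), h.norm_ker_le k (y - w')]
  · refine (h.norm_ker_sub_le k _ _).trans ?_
    rw [sub_sub_sub_cancel_left, ← dist_eq_norm]
    calc (sc k ^ 2)⁻¹ * (L * ((sc k)⁻¹ * dist w' w)) ≤
          (sc k ^ 2)⁻¹ * (L * ((sc k)⁻¹ * (2 * sc ν))) := by
          gcongr; linarith
      _ = _ := by ring

/-- Local `L²` averages of the bad part at points which have not been stopped. -/
theorem lav_kbad_le (h : IsKer θ L) (hu : ∫⁻ x, u x ≠ ⊤) (hα : α ≠ 0) (hf : Nice f)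
    (n : ℤ) (j : ℕ) {x z : E2} (hz : z ∈ cube n x) (hzα : 16 * dmax u z ≤ α) :
    lav n (kbad u α θ (n + j) f) x ≤ ENNReal.ofReal (6 * L * 2 ^ j * (sc n ^ 2)⁻¹) *
      ∫⁻ w in Metric.closedBall x (6 * sc n), ‖f w‖ₑ * bwt u α n (n + j) w := by
  have hL := h.nonneg
  set k := n + j with hk
  have hnk : n ≤ k := by omega
  have ht := sc_pos k
  have hs := sc_pos n
  have hkm : Measurable (ker θ k) := (h.continuous_ker k).measurable
  have hm := measurable_kst hu hα
  have hfm := hf.meas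
  set B := Metric.closedBall x (3 * sc n) with hB
  set N : E2 → ℝ≥0∞ := fun w => ENNReal.ofReal (2 * L * (sc k ^ 2)⁻¹) *
        (Metric.closedBall x (6 * sc n)).indicator (bwt u α n k) w with hN
  set D := ∫⁻ w, ‖f w‖ₑ * N w with hD
  have hpt : ∀ y ∈ B, kbad u α θ k f y ≤ D := by
    intro y hy
    refine lintegral_mono fun w => mul_le_mul_right ?_ _
    calc _ ≤ ∫⁻ w', ENNReal.ofReal (kst u α w w') * N w := by
          refine lintegral_mono fun w' => ?_
          by_cases hk0 : kst u α w w' = 0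
          · simp [hk0]
          · exact mul_le_mul_right (ker_diff_le h hu hα hnk hz hzα hy hk0).1 _
      _ ≤ 1 * N w := by
          rw [lintegral_mul_const _ (by fun_prop)]
          exact mul_le_mul_left (lintegral_kst_le_one w) _
      _ = _ := one_mul _
  have hint : ∫⁻ y in B, kbad u α θ k f y ≤ ENNReal.ofReal (2 * Real.pi * sc k ^ 2) * D := by
    unfold kbad
    rw [lintegral_lintegral_swap (by fun_prop), hD, ← lintegral_const_mul' _ _
      ENNReal.ofReal_ne_top]
    refine lintegral_mono fun w => ?_
    rw [lintegral_const_mul _ (by fun_prop), mul_left_comm]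
    refine mul_le_mul_right ?_ _
    rw [lintegral_lintegral_swap (by fun_prop)]
    calc _ ≤ ∫⁻ w', ENNReal.ofReal (kst u α w w') *
            (ENNReal.ofReal (2 * Real.pi * sc k ^ 2) * N w) := by
          refine lintegral_mono fun w' => ?_
          rw [lintegral_const_mul _ (by fun_prop)]
          by_cases hk0 : kst u α w w' = 0
          · simp [hk0]
          refine mul_le_mul_right ?_ _
          calc _ ≤ ∫⁻ y in B, N w * ((Metric.closedBall w (sc k)).indicator (fun _ => 1) y +
                  (Metric.closedBall w' (sc k)).indicator (fun _ => 1) y) := by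
                refine setLIntegral_mono' Metric.isClosed_closedBall.measurableSet fun y hy => ?_
                obtain ⟨h1, h2⟩ := ker_diff_le h hu hα hnk hz hzα hy hk0
                by_cases hne : ker θ k (y - w) - ker θ k (y - w') = 0
                · rw [hne]; simp
                refine h1.trans (le_mul_of_one_le_right zero_le ?_)
                rcases h2 hne with h3 | h3
                · rw [Set.indicator_of_mem h3]; exact le_self_add
                · rw [Set.indicator_of_mem h3]; exact le_add_self
            _ ≤ ∫⁻ y, N w * ((Metric.closedBall w (sc k)).indicator (fun _ => 1) y +
                  (Metric.closedBall w' (sc k)).indicator (fun _ => 1) y) :=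
                setLIntegral_le_lintegral _ _
            _ = _ := by
                have hmm : ∀ v : E2, Measurable
                    ((Metric.closedBall v (sc k)).indicator (fun _ => (1 : ℝ≥0∞))) := fun v =>
                  measurable_const.indicator Metric.isClosed_closedBall.measurableSet
                rw [lintegral_const_mul (N w) (f := fun y => (Metric.closedBall w (sc k)).indicator (fun _ => 1) y +
                  (Metric.closedBall w' (sc k)).indicator (fun _ => 1) y) ((hmm w).add (hmm w')), lintegral_add_left (hmm w),
                  lintegral_indicator_const Metric.isClosed_closedBall.measurableSet,
                  lintegral_indicator_const Metric.isClosed_closedBall.measurableSet,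
                  one_mul, one_mul, volume_closedBall_E2 _ ht.le, volume_closedBall_E2 _ ht.le,
                  ← ENNReal.ofReal_add (by positivity) (by positivity), mul_comm]
                congr 2; ring
      _ ≤ _ := by
          rw [lintegral_mul_const _ (by fun_prop)]
          exact (mul_le_mul_left (lintegral_kst_le_one w) _).trans (by rw [one_mul])
  have hDe : D = ENNReal.ofReal (2 * L * (sc k ^ 2)⁻¹) *
      ∫⁻ w in Metric.closedBall x (6 * sc n), ‖f w‖ₑ * bwt u α n k w := by
    rw [hD, ← lintegral_const_mul' _ _ ENNReal.ofReal_ne_top,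
      ← lintegral_indicator Metric.isClosed_closedBall.measurableSet]
    congr 1; funext w
    simp only [hN]
    by_cases hw : w ∈ Metric.closedBall x (6 * sc n)
    · rw [Set.indicator_of_mem hw, Set.indicator_of_mem hw]; ring
    · rw [Set.indicator_of_notMem hw, Set.indicator_of_notMem hw]; simp
  rw [← ENNReal.rpow_le_rpow_iff (by norm_num : (0 : ℝ) < 2), lav_sq]
  calc _ ≤ ENNReal.ofReal ((sc n ^ 2)⁻¹) * ∫⁻ y in B, D * kbad u α θ k f y := by
        refine mul_le_mul_right ?_ _
        refine setLIntegral_mono' Metric.isClosed_closedBall.measurableSet fun y hy => ?_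
        rw [ENNReal.rpow_two, sq]
        gcongr
        exact hpt y hy
    _ = ENNReal.ofReal ((sc n ^ 2)⁻¹) * (D * ∫⁻ y in B, kbad u α θ k f y) := by
        rw [lintegral_const_mul]
        unfold kbad
        fun_prop
    _ ≤ ENNReal.ofReal ((sc n ^ 2)⁻¹) * (D * (ENNReal.ofReal (2 * Real.pi * sc k ^ 2) * D)) := by
        gcongr
    _ = ENNReal.ofReal ((sc n ^ 2)⁻¹ * (2 * Real.pi * sc k ^ 2) * (2 * L * (sc k ^ 2)⁻¹) ^ 2) *
          (∫⁻ w in Metric.closedBall x (6 * sc n), ‖f w‖ₑ * bwt u α n k w) ^ 2 := by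
        rw [hDe, ENNReal.ofReal_mul (q := (2 * L * (sc k ^ 2)⁻¹) ^ 2) (by positivity),
          ENNReal.ofReal_mul (p := (sc n ^ 2)⁻¹) (by positivity), ENNReal.ofReal_pow
          (by positivity)]
        ring
    _ ≤ _ := by
        rw [ENNReal.rpow_two, mul_pow (ENNReal.ofReal _), ← ENNReal.ofReal_pow (by positivity)]
        gcongr ENNReal.ofReal ?_ * _
        have e1 : sc k = sc n * (2 ^ j)⁻¹ := by
          rw [hk, sc_add]; congr 1; unfold sc; simp
        have e2 : (sc n ^ 2)⁻¹ * (2 * Real.pi * sc k ^ 2) * (2 * L * (sc k ^ 2)⁻¹) ^ 2 =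
          (8 * Real.pi) * (L * 2 ^ j * (sc n ^ 2)⁻¹) ^ 2 := by
          rw [e1]; field_simp; ring
        rw [e2]
        calc _ ≤ 36 * (L * 2 ^ j * (sc n ^ 2)⁻¹) ^ 2 := by
              gcongr; linarith [Real.pi_le_four]
          _ = _ := by ring

end Bad

end

section

theorem sum_two_zpow_le (s : Finset ℤ) (M : ℤ) (h : ∀ n ∈ s, n ≤ M) :
    ∑ n ∈ s, (2 : ℝ) ^ (n - M) ≤ 2 := by
  have hinj : Set.InjOn (fun n : ℤ => (M - n).toNat) s := by
    intro a ha b hb hab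
    have := h a ha
    have := h b hb
    simp only at hab
    omega
  calc ∑ n ∈ s, (2 : ℝ) ^ (n - M) = ∑ n ∈ s, (fun i : ℕ => (1 / 2 : ℝ) ^ i) (M - n).toNat := by
        refine Finset.sum_congr rfl fun n hn => ?_
        have := h n hn
        beta_reduce
        rw [one_div, inv_pow, ← zpow_natCast, ← zpow_neg, Int.toNat_of_nonneg (by omega)]
        congr 1; ring
    _ = ∑ i ∈ s.image (fun n : ℤ => (M - n).toNat), (1 / 2 : ℝ) ^ i := by
        rw [Finset.sum_image hinj]
    _ ≤ ∑' i : ℕ, (1 / 2 : ℝ) ^ i :=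
        summable_geometric_two.sum_le_tsum _ (fun _ _ => by positivity)
    _ = 2 := tsum_geometric_two

theorem sum_min_le (s : Finset ℤ) (ν : ℤ) (j : ℕ) :
    ∑ n ∈ s.filter (· < ν), min 1 (sc ν / sc (n + j)) ≤ j + 2 := by
  have e : ∀ n : ℤ, sc ν / sc (n + j) = 2 ^ (n - (ν - j)) := fun n => by
    unfold sc
    rw [← zpow_sub₀ (by norm_num)]
    congr 1; ring
  rw [← Finset.sum_filter_add_sum_filter_not _ (fun n => n ≤ ν - j)]
  have h1 : ∑ n ∈ (s.filter (· < ν)).filter (fun n => n ≤ ν - j), min 1 (sc ν / sc (n + j)) ≤ 2 := by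
    refine le_trans (Finset.sum_le_sum fun n _ => ?_)
      (sum_two_zpow_le ((s.filter (· < ν)).filter (fun n => n ≤ ν - j)) (ν - j)
        (fun n hn => (Finset.mem_filter.1 hn).2))
    rw [e]; exact min_le_right _ _
  have h2 : ∑ n ∈ (s.filter (· < ν)).filter (fun n => ¬ n ≤ ν - j), min 1 (sc ν / sc (n + j)) ≤ j := by
    calc _ ≤ ∑ n ∈ (s.filter (· < ν)).filter (fun n => ¬ n ≤ ν - j), (1 : ℝ) :=
          Finset.sum_le_sum fun _ _ => min_le_left _ _
      _ = (((s.filter (· < ν)).filter (fun n => ¬ n ≤ ν - j)).card : ℝ) := by simp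
      _ ≤ ((Finset.Ioo (ν - j) ν).card : ℝ) := by
          norm_cast
          refine Finset.card_le_card fun n hn => ?_
          simp only [Finset.mem_filter, Finset.mem_Ioo] at *
          omega
      _ ≤ j := by
          norm_cast
          rw [Int.card_Ioo]; omega
  linarith

section CZ

variable {u : E2 → ℝ≥0∞} {α : ℝ≥0∞}

theorem sum_bwt_le (s : Finset ℤ) (j : ℕ) (w : E2) :
    ∑ n ∈ s, bwt u α n (n + j) w ≤
      ENNReal.ofReal (j + 2) * {w | α < dmax u w}.indicator (fun _ => 1) w := by
  by_cases hw : α < dmax u w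
  · rw [Set.indicator_of_mem (s := {w | α < dmax u w}) (by exact hw), mul_one]
    refine le_trans (le_of_eq ?_) (ENNReal.ofReal_le_ofReal (sum_min_le s (stopGen u α w) j))
    rw [ENNReal.ofReal_sum_of_nonneg (fun n _ => le_min zero_le_one
      (div_nonneg (sc_pos _).le (sc_pos _).le)), Finset.sum_filter]
    refine Finset.sum_congr rfl fun n _ => ?_
    unfold bwt
    by_cases hn : n < stopGen u α w
    · rw [if_pos hn, Set.indicator_of_mem (by exact ⟨hw, hn⟩)]
    · rw [if_neg hn, Set.indicator_of_notMem (fun h => hn h.2)]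
  · rw [Finset.sum_eq_zero]
    · exact zero_le
    · intro n _
      unfold bwt
      rw [Set.indicator_of_notMem (fun h => hw h.1)]

theorem setLIntegral_dmax_le (hum : Measurable u) (hα : α ≠ 0) (hα' : α ≠ ⊤) {r : ℝ}
    (hr : 1 ≤ r) (hr2 : r ≤ 2) :
    ∫⁻ w in {w | α < dmax u w}, u w ≤
      ENNReal.ofReal (36 * Real.pi * (900 * Real.pi) + 1) * α ^ (1 - r) * ∫⁻ w, u w ^ r := by
  have hE : MeasurableSet {w | α < dmax u w} := measurableSet_lt measurable_const (measurable_dmax u)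
  have hpi := Real.pi_gt_three
  have h0 : α ^ (1 - r) * α ^ r = α := by
    rw [← ENNReal.rpow_add _ _ hα hα']; simp
  have h1 : ∀ x : ℝ≥0∞, x ≤ α + α ^ (1 - r) * x ^ r := by
    intro x
    rcases le_total x α with h | h
    · exact h.trans le_self_add
    · refine le_trans ?_ le_add_self
      rcases eq_or_ne x ⊤ with rfl | hx
      · rw [ENNReal.top_rpow_of_pos (by linarith), ENNReal.mul_top]
        exact (ENNReal.rpow_pos (pos_iff_ne_zero.2 hα) hα').ne'
      have hx0 : x ≠ 0 := fun h' => hα (le_antisymm (h' ▸ h) zero_le)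
      calc x = x ^ (1 - r) * x ^ r := by rw [← ENNReal.rpow_add _ _ hx0 hx]; simp
        _ ≤ α ^ (1 - r) * x ^ r := by
          refine mul_le_mul_left ?_ _
          rw [show 1 - r = -(r - 1) by ring, ENNReal.rpow_neg, ENNReal.rpow_neg]
          exact ENNReal.inv_le_inv.2 (ENNReal.rpow_le_rpow h (by linarith))
  have h2 : volume {w | α < dmax u w} * α ^ r ≤
      ENNReal.ofReal (36 * Real.pi * (900 * Real.pi)) * ∫⁻ w, u w ^ r := by
    rw [mul_comm]
    refine (dmax_weak_rpow hum hr α).trans ?_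
    gcongr
    rw [ENNReal.ofReal_mul (q := 900 * Real.pi) (by positivity)]
    gcongr
    rw [ENNReal.ofReal_rpow_of_pos (by positivity)]
    apply ENNReal.ofReal_le_ofReal
    calc (36 * Real.pi) ^ (r - 1) ≤ (36 * Real.pi) ^ (1 : ℝ) :=
          Real.rpow_le_rpow_of_exponent_le (by linarith) (by linarith)
      _ = _ := Real.rpow_one _
  calc _ ≤ ∫⁻ w in {w | α < dmax u w}, (α + α ^ (1 - r) * u w ^ r) := lintegral_mono fun w => h1 _
    _ = α * volume {w | α < dmax u w} + α ^ (1 - r) * ∫⁻ w in {w | α < dmax u w}, u w ^ r := by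
        rw [lintegral_add_left measurable_const, lintegral_const_mul _ (hum.pow_const r)]
        simp
    _ ≤ α ^ (1 - r) * (ENNReal.ofReal (36 * Real.pi * (900 * Real.pi)) * ∫⁻ w, u w ^ r) +
          α ^ (1 - r) * ∫⁻ w, u w ^ r := by
        refine add_le_add ?_ (mul_le_mul_right (setLIntegral_le_lintegral _ _) _)
        nth_rewrite 1 [← h0]
        rw [mul_assoc, mul_comm (α ^ r)]
        exact mul_le_mul_right h2 _
    _ = _ := by
        rw [ENNReal.ofReal_add (by positivity) zero_le_one, ENNReal.ofReal_one]; ring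

/-- Square function bound for the family of convolutions with dilates of `θ`. -/
def SqBdd (θ : E2 → ℂ) (C : ℝ) : Prop :=
  ∀ F : E2 → ℂ, Nice F → ∀ s : Finset ℤ,
    ∑ k ∈ s, ∫⁻ y, ‖cv θ k F y‖ₑ ^ (2 : ℝ) ≤ ENNReal.ofReal C * ∫⁻ y, ‖F y‖ₑ ^ (2 : ℝ)

theorem SqBdd.sum_lav_le {θ : E2 → ℂ} {L C : ℝ} (hθ : IsKer θ L) (h : SqBdd θ C) {F : E2 → ℂ}
    (hF : Nice F) (s : Finset ℤ) (j : ℕ) :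
    ∑ n ∈ s, ∫⁻ x, lav n (fun y => ‖cv θ (n + j) F y‖ₑ) x ^ (2 : ℝ) ≤
      ENNReal.ofReal (9 * Real.pi * C) * ∫⁻ y, ‖F y‖ₑ ^ (2 : ℝ) := by
  have hpi := Real.pi_pos
  calc _ = ENNReal.ofReal (9 * Real.pi) * ∑ n ∈ s, ∫⁻ y, ‖cv θ (n + j) F y‖ₑ ^ (2 : ℝ) := by
        rw [Finset.mul_sum]
        refine Finset.sum_congr rfl fun n _ => ?_
        rw [lintegral_lav_sq]
        exact (Nice.cv hθ _ hF).meas.enorm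
    _ = ENNReal.ofReal (9 * Real.pi) * ∑ n ∈ s.map (addRightEmbedding (j : ℤ)),
          ∫⁻ y, ‖cv θ n F y‖ₑ ^ (2 : ℝ) := by
        rw [Finset.sum_map]; rfl
    _ ≤ _ := by
        rw [ENNReal.ofReal_mul (q := C) (by positivity), mul_assoc]
        exact mul_le_mul_right (h F hF _) _

theorem sum_lintegral_mul_le {ι : Type*} (s : Finset ι) (a b : ι → E2 → ℝ≥0∞)
    (ha : ∀ i, Measurable (a i)) (hb : ∀ i, Measurable (b i)) :
    ∑ i ∈ s, ∫⁻ x, a i x * b i x ≤ (∑ i ∈ s, ∫⁻ x, a i x ^ (2 : ℝ)) ^ (1 / 2 : ℝ) *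
      (∑ i ∈ s, ∫⁻ x, b i x ^ (2 : ℝ)) ^ (1 / 2 : ℝ) := by
  have h2 : (2 : ℝ).HolderConjugate 2 := Real.HolderConjugate.two_two
  calc _ ≤ ∑ i ∈ s, (∫⁻ x, a i x ^ (2 : ℝ)) ^ (1 / 2 : ℝ) * (∫⁻ x, b i x ^ (2 : ℝ)) ^ (1 / 2 : ℝ) :=
        Finset.sum_le_sum fun i _ => ENNReal.lintegral_mul_le_Lp_mul_Lq volume h2
          (ha i).aemeasurable (hb i).aemeasurable
    _ ≤ _ := by
        refine (ENNReal.inner_le_Lp_mul_Lq s _ _ h2).trans (le_of_eq ?_)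
        have e : ∀ x : ℝ≥0∞, (x ^ (1 / 2 : ℝ)) ^ (2 : ℝ) = x := fun x => by
          rw [← ENNReal.rpow_mul]; norm_num
        simp only [e]

theorem cz_sum_le {ψ ψ' : E2 → ℂ} {L C : ℝ} (hψ : IsKer ψ L) (hψ' : IsKer ψ' L)
    (hsq : SqBdd ψ C) (hsq' : SqBdd ψ' C) {F G : E2 → ℂ} (hF : Nice F) (hG : Nice G)
    (hα : α ≠ 0) (hα' : α ≠ ⊤) {r : ℝ} (hr : 1 ≤ r) (hr2 : r ≤ 2) (s : Finset ℤ) (j : ℕ) :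
    ∑ n ∈ s, ∫⁻ x, lav n (fun y => ‖cv ψ (n + j) (gd (fun x => ‖F x‖ₑ) α F) y‖ₑ) x *
        lav n (fun y => ‖cv ψ' (n + j) G y‖ₑ) x ≤
      ENNReal.ofReal (9 * Real.pi * C) * ((4 * α) ^ (2 - r) * ∫⁻ w, ‖F w‖ₑ ^ r) ^ (1 / 2 : ℝ) *
        (∫⁻ y, ‖G y‖ₑ ^ (2 : ℝ)) ^ (1 / 2 : ℝ) ∧
    ∑ n ∈ s, ∫⁻ x, ENNReal.ofReal (6 * L * 2 ^ j * (sc n ^ 2)⁻¹) *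
        ∫⁻ w in Metric.closedBall x (6 * sc n),
          ‖F w‖ₑ * bwt (fun x => ‖F x‖ₑ) α n (n + j) w ≤
      ENNReal.ofReal (6 * L * 2 ^ j * (36 * Real.pi) * (j + 2) *
        (36 * Real.pi * (900 * Real.pi) + 1)) * (α ^ (1 - r) * ∫⁻ w, ‖F w‖ₑ ^ r) := by
  have hu : ∫⁻ x, ‖F x‖ₑ ≠ ⊤ := hF.int.2.ne
  have hgd := nice_gd hu hα hF
  have hL := hψ.nonneg
  have hFm := hF.meas
  have hE : MeasurableSet {w | α < dmax (fun x => ‖F x‖ₑ) w} :=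
    measurableSet_lt measurable_const (measurable_dmax _)
  have hpi := Real.pi_pos
  constructor
  · refine (sum_lintegral_mul_le s _ _
      (fun n => measurable_lav n (Nice.cv hψ _ hgd).meas.enorm)
      (fun n => measurable_lav n (Nice.cv hψ' _ hG).meas.enorm)).trans ?_
    have h1 := (hsq.sum_lav_le hψ hgd s j).trans (mul_le_mul_right (lintegral_sq_gd_le hα hF hr hr2) _)
    have h2 := hsq'.sum_lav_le hψ' hG s j
    calc _ ≤ (ENNReal.ofReal (9 * Real.pi * C) * ((4 * α) ^ (2 - r) * ∫⁻ w, ‖F w‖ₑ ^ r)) ^ (1 / 2 : ℝ) *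
          (ENNReal.ofReal (9 * Real.pi * C) * ∫⁻ y, ‖G y‖ₑ ^ (2 : ℝ)) ^ (1 / 2 : ℝ) := by
          gcongr
      _ = (ENNReal.ofReal (9 * Real.pi * C) ^ (1 / 2 : ℝ) * ENNReal.ofReal (9 * Real.pi * C) ^ (1 / 2 : ℝ)) *
          ((4 * α) ^ (2 - r) * ∫⁻ w, ‖F w‖ₑ ^ r) ^ (1 / 2 : ℝ) *
          (∫⁻ y, ‖G y‖ₑ ^ (2 : ℝ)) ^ (1 / 2 : ℝ) := by
          rw [ENNReal.mul_rpow_of_nonneg (ENNReal.ofReal (9 * Real.pi * C)) _ (by norm_num),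
            ENNReal.mul_rpow_of_nonneg (ENNReal.ofReal (9 * Real.pi * C)) _ (by norm_num)]
          ring
      _ = _ := by
          rw [← ENNReal.rpow_add_of_nonneg _ _ (by norm_num) (by norm_num)]
          norm_num
  · have hbm : ∀ n, Measurable fun w => ‖F w‖ₑ * bwt (fun x => ‖F x‖ₑ) α n (n + j) w := fun n =>
      hFm.enorm.mul (measurable_bwt hu hα n _)
    calc _ = ∑ n ∈ s, ENNReal.ofReal (6 * L * 2 ^ j * (36 * Real.pi)) *
          ∫⁻ w, ‖F w‖ₑ * bwt (fun x => ‖F x‖ₑ) α n (n + j) w := by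
          refine Finset.sum_congr rfl fun n _ => ?_
          have hs := sc_pos n
          rw [lintegral_const_mul' _ _ ENNReal.ofReal_ne_top,
            lintegral_setLIntegral_closedBall (hbm n) (by positivity), ← mul_assoc,
            ← ENNReal.ofReal_mul (by positivity)]
          congr 2; field_simp; ring
      _ = ENNReal.ofReal (6 * L * 2 ^ j * (36 * Real.pi)) *
          ∫⁻ w, ‖F w‖ₑ * ∑ n ∈ s, bwt (fun x => ‖F x‖ₑ) α n (n + j) w := by
          rw [← Finset.mul_sum, ← lintegral_finsetSum _ (fun n _ => hbm n)]
          simp only [Finset.mul_sum]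
      _ ≤ ENNReal.ofReal (6 * L * 2 ^ j * (36 * Real.pi)) *
          ∫⁻ w, ENNReal.ofReal (j + 2) * ({w | α < dmax (fun x => ‖F x‖ₑ) w}.indicator
            (fun w => ‖F w‖ₑ) w) := by
          refine mul_le_mul_right (lintegral_mono fun w => ?_) _
          refine (mul_le_mul_right (sum_bwt_le s j w) _).trans (le_of_eq ?_)
          by_cases hw : w ∈ {w | α < dmax (fun x => ‖F x‖ₑ) w}
          · rw [Set.indicator_of_mem hw, Set.indicator_of_mem hw]; ring
          · rw [Set.indicator_of_notMem hw, Set.indicator_of_notMem hw]; simp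
      _ ≤ ENNReal.ofReal (6 * L * 2 ^ j * (36 * Real.pi)) * (ENNReal.ofReal (j + 2) *
            (ENNReal.ofReal (36 * Real.pi * (900 * Real.pi) + 1) * α ^ (1 - r) *
              ∫⁻ w, ‖F w‖ₑ ^ r)) := by
          rw [lintegral_const_mul' _ _ ENNReal.ofReal_ne_top, lintegral_indicator hE]
          gcongr
          exact setLIntegral_dmax_le hFm.enorm hα hα' hr hr2
      _ = _ := by
          rw [ENNReal.ofReal_mul (q := 36 * Real.pi * (900 * Real.pi) + 1) (by positivity),
            ENNReal.ofReal_mul (q := (j : ℝ) + 2) (by positivity)]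
          ring

end CZ

end

/-- Exceptional set for the triple of maximal functions. -/
def stopSet (F G H : E2 → ℂ) (r : ℝ) (α b c : ℝ≥0∞) : Set E2 :=
  {x | α < 16 * dmax (fun x => ‖F x‖ₑ) x} ∪ ({x | b < dmax (fun x => ‖G x‖ₑ ^ (2 : ℝ)) x} ∪
    {x | c < dmax (fun x => ‖H x‖ₑ ^ r) x})

theorem measurableSet_stopSet (F G H : E2 → ℂ) (r : ℝ) (α b c : ℝ≥0∞) :
    MeasurableSet (stopSet F G H r α b c) := by
  have := fun v => measurable_dmax v
  refine MeasurableSet.union ?_ (MeasurableSet.union ?_ ?_) <;>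
    exact measurableSet_lt measurable_const (by fun_prop)

theorem volume_dmax_le {u : E2 → ℝ≥0∞} {V b : ℝ≥0∞} (hb : b ≠ 0) (hb' : b ≠ ⊤)
    (h : ∫⁻ x, u x ≤ V * b) :
    6 * volume {x | ENNReal.ofReal (5400 * Real.pi) * b < dmax u x} ≤ V := by
  have h1 := (dmax_weak u (ENNReal.ofReal (5400 * Real.pi) * b)).trans (mul_le_mul_right h _)
  have hpi := Real.pi_pos
  have e : ENNReal.ofReal (5400 * Real.pi) = ENNReal.ofReal (900 * Real.pi) * 6 := by
    rw [show (6 : ℝ≥0∞) = ENNReal.ofReal 6 by simp, ← ENNReal.ofReal_mul (by positivity)]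
    congr 1; ring
  have hk : ENNReal.ofReal (900 * Real.pi) ≠ 0 := by
    rw [Ne, ENNReal.ofReal_eq_zero, not_le]; positivity
  rw [← ENNReal.mul_le_mul_iff_right (a := ENNReal.ofReal (900 * Real.pi) * b)
    (mul_ne_zero hk hb) (ENNReal.mul_ne_top ENNReal.ofReal_ne_top hb')]
  generalize volume {x | ENNReal.ofReal (5400 * Real.pi) * b < dmax u x} = X at h1 ⊢
  calc _ = ENNReal.ofReal (5400 * Real.pi) * b * X := by rw [e]; ring
    _ ≤ _ := h1.trans (le_of_eq (by ring))

theorem volume_dmax_rpow_le {u : E2 → ℝ≥0∞} (hu : Measurable u) {V a : ℝ≥0∞} (ha : a ≠ 0)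
    (ha' : a ≠ ⊤) {r lam : ℝ} (hr : 1 ≤ r) (hr2 : r ≤ 2)
    (hlam : 96 * (36 * Real.pi * (900 * Real.pi)) ≤ lam) (h : ∫⁻ x, u x ^ r ≤ V * a) :
    6 * volume {x | ENNReal.ofReal lam * a ^ (1 / r) < 16 * dmax u x} ≤ V := by
  have hpi := Real.pi_gt_three
  have hr0 : 0 < r := by linarith
  have hlam0 : 0 < lam := lt_of_lt_of_le (by positivity) hlam
  set K0 := 36 * Real.pi * (900 * Real.pi) with hK0
  have hK : 1 ≤ K0 := by nlinarith
  have e1 : {x | ENNReal.ofReal lam * a ^ (1 / r) < 16 * dmax u x} =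
      {x | ENNReal.ofReal (lam / 16) * a ^ (1 / r) < dmax u x} := by
    ext x
    simp only [Set.mem_ofPred_eq]
    rw [show lam = 16 * (lam / 16) by ring, ENNReal.ofReal_mul (by norm_num),
      ENNReal.ofReal_ofNat, mul_assoc, ENNReal.mul_lt_mul_iff_right (by norm_num) (by norm_num)]
    congr! 3; ring
  rw [e1]
  have h1 := (dmax_weak_rpow hu hr (ENNReal.ofReal (lam / 16) * a ^ (1 / r))).trans
    (mul_le_mul_right h _)
  generalize volume {x | ENNReal.ofReal (lam / 16) * a ^ (1 / r) < dmax u x} = X at h1 ⊢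
  rw [ENNReal.mul_rpow_of_nonneg _ _ hr0.le, ← ENNReal.rpow_mul, one_div_mul_cancel hr0.ne',
    ENNReal.rpow_one, ENNReal.ofReal_rpow_of_pos (by positivity),
    ENNReal.ofReal_rpow_of_pos (by positivity), ← ENNReal.ofReal_mul (by positivity)] at h1
  have h2 : (36 * Real.pi) ^ (r - 1) * (900 * Real.pi) ≤ K0 := by
    rw [hK0]; gcongr
    calc (36 * Real.pi) ^ (r - 1) ≤ (36 * Real.pi) ^ (1 : ℝ) :=
          Real.rpow_le_rpow_of_exponent_le (by linarith) (by linarith)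
      _ = _ := Real.rpow_one _
  have h3 : 6 * K0 ≤ (lam / 16) ^ r := by
    have h4 : 6 * K0 ≤ lam / 16 := by linarith
    calc 6 * K0 ≤ (lam / 16) ^ (1 : ℝ) := by rw [Real.rpow_one]; exact h4
      _ ≤ _ := Real.rpow_le_rpow_of_exponent_le (by linarith) hr
  have hk : ENNReal.ofReal K0 ≠ 0 := by
    rw [Ne, ENNReal.ofReal_eq_zero, not_le]; positivity
  rw [← ENNReal.mul_le_mul_iff_right (a := ENNReal.ofReal K0 * a)
    (mul_ne_zero hk ha) (ENNReal.mul_ne_top ENNReal.ofReal_ne_top ha')]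
  calc _ = ENNReal.ofReal (6 * K0) * a * X := by
        rw [ENNReal.ofReal_mul (p := 6) (q := K0) (by norm_num), ENNReal.ofReal_ofNat]; ring
    _ ≤ ENNReal.ofReal ((lam / 16) ^ r) * a * X := by gcongr
    _ ≤ _ := h1
    _ ≤ ENNReal.ofReal K0 * (V * a) := by gcongr
    _ = _ := by ring

theorem volume_stopSet_le {F G H : E2 → ℂ} (hF : Measurable F) {r₁ r₃ lam : ℝ} (hr1 : 1 ≤ r₁)
    (hr2 : r₁ ≤ 2) (hlam : 96 * (36 * Real.pi * (900 * Real.pi)) ≤ lam) {V a b c : ℝ≥0∞}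
    (ha : a ≠ 0) (ha' : a ≠ ⊤) (hb : b ≠ 0) (hb' : b ≠ ⊤) (hc : c ≠ 0) (hc' : c ≠ ⊤)
    (hFa : ∫⁻ x, ‖F x‖ₑ ^ r₁ ≤ V * a) (hGb : ∫⁻ x, ‖G x‖ₑ ^ (2 : ℝ) ≤ V * b)
    (hHc : ∫⁻ x, ‖H x‖ₑ ^ r₃ ≤ V * c) :
    2 * volume (stopSet F G H r₃ (ENNReal.ofReal lam * a ^ (1 / r₁))
      (ENNReal.ofReal (5400 * Real.pi) * b) (ENNReal.ofReal (5400 * Real.pi) * c)) ≤ V := by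
  have h1 := volume_dmax_rpow_le hF.enorm ha ha' hr1 hr2 hlam hFa
  have h2 := volume_dmax_le hb hb' hGb
  have h3 := volume_dmax_le hc hc' hHc
  rw [← ENNReal.mul_le_mul_iff_right (a := 3) (by norm_num) (by norm_num)]
  calc _ ≤ 6 * (volume {x | ENNReal.ofReal lam * a ^ (1 / r₁) < 16 * dmax (fun x => ‖F x‖ₑ) x} +
        (volume {x | ENNReal.ofReal (5400 * Real.pi) * b < dmax (fun x => ‖G x‖ₑ ^ (2 : ℝ)) x} +
        volume {x | ENNReal.ofReal (5400 * Real.pi) * c < dmax (fun x => ‖H x‖ₑ ^ r₃) x})) := by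
        rw [← mul_assoc, show (3 : ℝ≥0∞) * 2 = 6 by norm_num]
        gcongr
        exact (measure_union_le _ _).trans (by gcongr; exact measure_union_le _ _)
    _ ≤ V + (V + V) := by rw [mul_add, mul_add]; gcongr
    _ = _ := by ring

theorem lav_cv_le_dmax {θ : E2 → ℂ} {L r : ℝ} (h : IsKer θ L) (hr1 : 1 ≤ r) (hr2 : r ≤ 2)
    (n : ℤ) (j : ℕ) {f : E2 → ℂ} (hf : Measurable f) {x z : E2} (hz : z ∈ cube n x) :
    lav n (fun y => ‖cv θ (n + j) f y‖ₑ) x ≤ ENNReal.ofReal (4 * L * 2 ^ (j * (2 / r - 1))) *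
      dmax (fun x => ‖f x‖ₑ ^ r) z ^ (1 / r) := by
  refine (h.lav_cv_le hr1 hr2 n j hf x).trans ?_
  gcongr
  refine le_trans ?_ (avg_le_dmax n _ z)
  unfold avg
  gcongr
  apply Metric.closedBall_subset_closedBall'
  have h1 := dist_corner n x
  rw [corner_eq hz]
  have := sc_pos n
  linarith

/-- Absolute constant in the local estimate. -/
def sparseConst : ℝ :=
  3456 * Real.pi * (5400 * Real.pi) ^ 2 * (36 * Real.pi * (900 * Real.pi) + 1)

theorem lav_cv_le_of_notMem {θ : E2 → ℂ} {L r : ℝ} (h : IsKer θ L) (hr1 : 1 ≤ r) (hr2 : r ≤ 2)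
    (n : ℤ) (j : ℕ) {f : E2 → ℂ} (hf : Measurable f) {x z : E2} (hz : z ∈ cube n x) {b : ℝ≥0∞}
    (hb : dmax (fun x => ‖f x‖ₑ ^ r) z ≤ ENNReal.ofReal (5400 * Real.pi) * b) :
    lav n (fun y => ‖cv θ (n + j) f y‖ₑ) x ≤
      ENNReal.ofReal (4 * L * 2 ^ (j * (2 / r - 1)) * (5400 * Real.pi)) * b ^ (1 / r) := by
  have hpi := Real.pi_gt_three
  have hL := h.nonneg
  refine (lav_cv_le_dmax h hr1 hr2 n j hf hz).trans ?_
  rw [ENNReal.ofReal_mul (p := 4 * L * 2 ^ (j * (2 / r - 1))) (by positivity),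
    mul_assoc (ENNReal.ofReal (4 * L * 2 ^ (j * (2 / r - 1))))]
  refine mul_le_mul' le_rfl ?_
  calc _ ≤ (ENNReal.ofReal (5400 * Real.pi) * b) ^ (1 / r) := by gcongr
    _ = ENNReal.ofReal (5400 * Real.pi) ^ (1 / r) * b ^ (1 / r) :=
      ENNReal.mul_rpow_of_nonneg _ _ (by positivity)
    _ ≤ _ := by
      gcongr
      calc _ ≤ ENNReal.ofReal (5400 * Real.pi) ^ (1 : ℝ) := by
            apply ENNReal.rpow_le_rpow_of_exponent_le
            · rw [ENNReal.one_le_ofReal]; linarith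
            · rw [div_le_one (by linarith)]; exact hr1
        _ = _ := ENNReal.rpow_one _

theorem sparse_pointwise {ψ ψ' φ : E2 → ℂ} {L : ℝ} (hψ : IsKer ψ L) (hψ' : IsKer ψ' L)
    (hφ : IsKer φ L) {F G H : E2 → ℂ} (hF : Nice F)
    (hG : Nice G) (hH : Nice H) {r₃ : ℝ} (hr3 : 1 ≤ r₃)
    (hr4 : r₃ ≤ 2) {α b c : ℝ≥0∞} (hα : α ≠ 0) (n : ℤ) (j : ℕ) (x : E2) :
    (inner_part n (stopSet F G H r₃ α
        (ENNReal.ofReal (5400 * Real.pi) * b) (ENNReal.ofReal (5400 * Real.pi) * c)))ᶜ.indicator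
        (fun x => lav n (fun y => ‖cv ψ (n + j) F y‖ₑ) x *
          lav n (fun y => ‖cv ψ' (n + j) G y‖ₑ) x * lav n (fun y => ‖cv φ (n + j) H y‖ₑ) x) x ≤
      ENNReal.ofReal (4 * L * 2 ^ (j * (2 / r₃ - 1)) * (5400 * Real.pi)) * c ^ (1 / r₃) *
        (lav n (fun y => ‖cv ψ (n + j) (gd (fun x => ‖F x‖ₑ) α F) y‖ₑ) x *
          lav n (fun y => ‖cv ψ' (n + j) G y‖ₑ) x +
        ENNReal.ofReal (4 * L * (5400 * Real.pi)) * b ^ (1 / 2 : ℝ) *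
          (ENNReal.ofReal (6 * L * 2 ^ j * (sc n ^ 2)⁻¹) *
        ∫⁻ w in Metric.closedBall x (6 * sc n),
          ‖F w‖ₑ * bwt (fun x => ‖F x‖ₑ) α n (n + j) w)) := by
  by_cases hx : x ∈ (inner_part n (stopSet F G H r₃ α
        (ENNReal.ofReal (5400 * Real.pi) * b) (ENNReal.ofReal (5400 * Real.pi) * c)))ᶜ
  swap
  · rw [Set.indicator_of_notMem hx]; exact zero_le
  rw [Set.indicator_of_mem hx]
  obtain ⟨z, hz, hzn⟩ := Set.not_subset.1 hx
  unfold stopSet at hzn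
  simp only [Set.mem_union, Set.mem_ofPred_eq, not_or, not_lt] at hzn
  obtain ⟨h1, h2, h3⟩ := hzn
  have hu : ∫⁻ x, ‖F x‖ₑ ≠ ⊤ := hF.int.2.ne
  have hgd := nice_gd hu hα hF
  have hh := lav_cv_le_of_notMem hφ hr3 hr4 n j hH.meas hz h3
  have hg := lav_cv_le_of_notMem hψ' (by norm_num) le_rfl n j hG.meas hz h2
  norm_num only [mul_zero, Real.rpow_zero, mul_one, div_self, sub_self] at hg
  have hb := lav_kbad_le hψ hu hα hF n j hz h1
  have hkbm : Measurable (kbad (fun x => ‖F x‖ₑ) α ψ (n + j) F) := by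
    have hkm : Measurable (ker ψ (n + j)) := (hψ.continuous_ker _).measurable
    have hm := measurable_kst hu hα
    have hfm := hF.meas
    unfold kbad; fun_prop
  have hf := (lav_mono_on (n := n) (x := x) fun y _ => enorm_cv_le_add hψ (n + j) hu hα hF y).trans
    (lav_add_le n (Nice.cv hψ _ hgd).meas.enorm hkbm x)
  calc _ ≤ (lav n (fun y => ‖cv ψ (n + j) (gd (fun x => ‖F x‖ₑ) α F) y‖ₑ) x + _) *
        lav n (fun y => ‖cv ψ' (n + j) G y‖ₑ) x * _ :=
        mul_le_mul' (mul_le_mul' (hf.trans (add_le_add_right hb _)) le_rfl) hh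
    _ = _ * (_ + lav n (fun y => ‖cv ψ' (n + j) G y‖ₑ) x * _) := by
        rw [mul_comm, add_mul, mul_comm (_ * ∫⁻ w in _, _)]
    _ ≤ _ := mul_le_mul_right (add_le_add_right (mul_le_mul_left (by simpa using hg) _) _) _

theorem sparse_core {ψ ψ' φ : E2 → ℂ} {L C : ℝ} (hψ : IsKer ψ L) (hψ' : IsKer ψ' L)
    (hφ : IsKer φ L) (hC : 0 ≤ C) (hsq : SqBdd ψ C) (hsq' : SqBdd ψ' C) {F G H : E2 → ℂ}
    (hF : Nice F)
    (hG : Nice G) (hH : Nice H) {r₁ r₃ lam : ℝ} (hr1 : 1 ≤ r₁) (hr2 : r₁ ≤ 2) (hr3 : 1 ≤ r₃)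
    (hr4 : r₃ ≤ 2) (hlam : 0 < lam) {V a b c : ℝ≥0∞}
    (ha : a ≠ 0) (ha' : a ≠ ⊤) (hFa : ∫⁻ x, ‖F x‖ₑ ^ r₁ ≤ V * a)
    (hGb : ∫⁻ x, ‖G x‖ₑ ^ (2 : ℝ) ≤ V * b) (s : Finset ℤ) (j : ℕ) :
    ∑ n ∈ s, ∫⁻ x, (inner_part n (stopSet F G H r₃ (ENNReal.ofReal lam * a ^ (1 / r₁))
        (ENNReal.ofReal (5400 * Real.pi) * b) (ENNReal.ofReal (5400 * Real.pi) * c)))ᶜ.indicator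
        (fun x => lav n (fun y => ‖cv ψ (n + j) F y‖ₑ) x *
          lav n (fun y => ‖cv ψ' (n + j) G y‖ₑ) x * lav n (fun y => ‖cv φ (n + j) H y‖ₑ) x) x ≤
      ENNReal.ofReal (sparseConst * (L * C + L ^ 3) * 2 ^ (j * (2 / r₃ - 1)) *
        (lam ^ (1 - r₁ / 2) + 2 ^ j * (j + 2) * lam ^ (1 - r₁))) * V *
        (a ^ (1 / r₁) * b ^ (1 / 2 : ℝ) * c ^ (1 / r₃)) := by
  have hpi := Real.pi_gt_three
  have hL := hψ.nonneg
  have hr0 : 0 < r₁ := by linarith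
  have hα : ENNReal.ofReal lam * a ^ (1 / r₁) ≠ 0 := by
    refine mul_ne_zero (by rw [Ne, ENNReal.ofReal_eq_zero, not_le]; exact hlam) ?_
    rw [Ne, ENNReal.rpow_eq_zero_iff]
    simp [ha, ha']
  have hα' : ENNReal.ofReal lam * a ^ (1 / r₁) ≠ ⊤ :=
    ENNReal.mul_ne_top ENNReal.ofReal_ne_top (ENNReal.rpow_ne_top_of_nonneg (by positivity) ha')
  obtain ⟨h1, h2⟩ := cz_sum_le hψ hψ' hsq hsq' hF hG hα hα' hr1 hr2 s j
  have hu : ∫⁻ x, ‖F x‖ₑ ≠ ⊤ := hF.int.2.ne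
  have hgd := nice_gd hu hα hF
  refine (Finset.sum_le_sum fun n _ => lintegral_mono fun x =>
    sparse_pointwise hψ hψ' hφ hF hG hH hr3 hr4 hα n j x).trans ?_
  set α := ENNReal.ofReal lam * a ^ (1 / r₁) with hαd
  have hpa1 : ((4 * α) ^ (2 - r₁) * (V * a)) ^ (1 / 2 : ℝ) * (V * b) ^ (1 / 2 : ℝ) ≤
      ENNReal.ofReal (2 * lam ^ (1 - r₁ / 2)) * V * (a ^ (1 / r₁) * b ^ (1 / 2 : ℝ)) := by
    have e1 : (4 * α) ^ (2 - r₁) ≤ 4 * (ENNReal.ofReal (lam ^ (2 - r₁)) * a ^ (2 / r₁ - 1)) := by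
      rw [ENNReal.mul_rpow_of_nonneg _ _ (by linarith), hαd,
        ENNReal.mul_rpow_of_nonneg _ _ (by linarith), ← ENNReal.rpow_mul,
        ENNReal.ofReal_rpow_of_pos hlam, show 1 / r₁ * (2 - r₁) = 2 / r₁ - 1 by field_simp]
      gcongr
      calc (4 : ℝ≥0∞) ^ (2 - r₁) ≤ 4 ^ (1 : ℝ) :=
            ENNReal.rpow_le_rpow_of_exponent_le (by norm_num) (by linarith)
        _ = 4 := ENNReal.rpow_one _
    have h12 : (0 : ℝ) ≤ 1 / 2 := by norm_num
    have h2r : 0 ≤ 2 / r₁ - 1 := by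
      rw [sub_nonneg, le_div_iff₀ hr0]; linarith
    calc _ ≤ ((4 * (ENNReal.ofReal (lam ^ (2 - r₁)) * a ^ (2 / r₁ - 1))) * (V * a)) ^ (1 / 2 : ℝ) *
          (V * b) ^ (1 / 2 : ℝ) := by gcongr
      _ = 4 ^ (1 / 2 : ℝ) * ENNReal.ofReal (lam ^ (2 - r₁)) ^ (1 / 2 : ℝ) *
          (V ^ (1 / 2 : ℝ) * V ^ (1 / 2 : ℝ)) *
          ((a ^ (2 / r₁ - 1) * a) ^ (1 / 2 : ℝ) * b ^ (1 / 2 : ℝ)) := by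
          simp only [ENNReal.mul_rpow_of_nonneg _ _ h12]; ring
      _ = _ := by
          rw [← ENNReal.rpow_add_of_nonneg _ _ h12 h12]
          have e3 : a ^ (2 / r₁ - 1) * a = a ^ (2 / r₁) := by
            nth_rewrite 2 [← ENNReal.rpow_one a]
            rw [← ENNReal.rpow_add_of_nonneg _ _ h2r zero_le_one]
            congr 1; ring
          have e4 : (4 : ℝ≥0∞) ^ (1 / 2 : ℝ) = 2 := by
            rw [show (4 : ℝ≥0∞) = 2 ^ (2 : ℝ) by norm_num, ← ENNReal.rpow_mul]; norm_num
          rw [e3, e4, ← ENNReal.rpow_mul, ENNReal.ofReal_rpow_of_pos (by positivity),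
            ← Real.rpow_mul hlam.le, show 2 / r₁ * (1 / 2) = 1 / r₁ by ring,
            show (2 - r₁) * (1 / 2) = 1 - r₁ / 2 by ring,
            ENNReal.ofReal_mul (p := 2) (by norm_num), ENNReal.ofReal_ofNat]
          norm_num
  have hpa2 : α ^ (1 - r₁) * (V * a) = ENNReal.ofReal (lam ^ (1 - r₁)) * V * a ^ (1 / r₁) := by
    have e1 : α ^ (1 - r₁) = ENNReal.ofReal (lam ^ (1 - r₁)) * a ^ (1 / r₁ - 1) := by
      rw [hαd, ENNReal.mul_rpow_of_ne_top ENNReal.ofReal_ne_top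
        (ENNReal.rpow_ne_top_of_nonneg (by positivity) ha'), ← ENNReal.rpow_mul,
        ENNReal.ofReal_rpow_of_pos hlam, show 1 / r₁ * (1 - r₁) = 1 / r₁ - 1 by field_simp]
    have e2 : a ^ (1 / r₁) = a ^ (1 / r₁ - 1) * a := by
      nth_rewrite 3 [← ENNReal.rpow_one a]
      rw [← ENNReal.rpow_add _ _ ha ha']
      congr 1; ring
    rw [e1, e2]; ring
  set X : ℤ → E2 → ℝ≥0∞ := fun n x =>
    lav n (fun y => ‖cv ψ (n + j) (gd (fun x => ‖F x‖ₑ) α F) y‖ₑ) x *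
          lav n (fun y => ‖cv ψ' (n + j) G y‖ₑ) x with hX
  set Y : ℤ → E2 → ℝ≥0∞ := fun n x => ENNReal.ofReal (6 * L * 2 ^ j * (sc n ^ 2)⁻¹) *
        ∫⁻ w in Metric.closedBall x (6 * sc n),
          ‖F w‖ₑ * bwt (fun x => ‖F x‖ₑ) α n (n + j) w with hY
  have hXm : ∀ n, Measurable (X n) := fun n =>
    (measurable_lav n (Nice.cv hψ _ hgd).meas.enorm).mul
      (measurable_lav n (Nice.cv hψ' _ hG).meas.enorm)
  have hYm : ∀ n, Measurable (Y n) := fun n =>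
    (measurable_setLIntegral_closedBall (hF.meas.enorm.mul (measurable_bwt hu hα n _)) _).const_mul _
  set Bh := ENNReal.ofReal (4 * L * 2 ^ (j * (2 / r₃ - 1)) * (5400 * Real.pi)) * c ^ (1 / r₃) with hBh
  set Bg := ENNReal.ofReal (4 * L * (5400 * Real.pi)) * b ^ (1 / 2 : ℝ) with hBg
  calc ∑ n ∈ s, ∫⁻ x, Bh * (X n x + Bg * Y n x)
      = Bh * (∑ n ∈ s, ∫⁻ x, X n x) + Bh * Bg * ∑ n ∈ s, ∫⁻ x, Y n x := by
        rw [Finset.mul_sum, Finset.mul_sum, ← Finset.sum_add_distrib]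
        refine Finset.sum_congr rfl fun n _ => ?_
        have hm := hXm n
        have hm' := hYm n
        rw [lintegral_const_mul _ (by fun_prop), lintegral_add_left hm,
          lintegral_const_mul _ hm']
        ring
    _ ≤ Bh * (ENNReal.ofReal (9 * Real.pi * C) * (ENNReal.ofReal (2 * lam ^ (1 - r₁ / 2)) * V *
          (a ^ (1 / r₁) * b ^ (1 / 2 : ℝ)))) + Bh * Bg * (ENNReal.ofReal (6 * L * 2 ^ j *
          (36 * Real.pi) * (j + 2) * (36 * Real.pi * (900 * Real.pi) + 1)) *
          (ENNReal.ofReal (lam ^ (1 - r₁)) * V * a ^ (1 / r₁))) := by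
        refine add_le_add (mul_le_mul_right (h1.trans ?_) _) (mul_le_mul_right (h2.trans ?_) _)
        · rw [mul_assoc]
          exact mul_le_mul_right (le_trans (by gcongr) hpa1) _
        · rw [← hpa2]; gcongr
    _ = ENNReal.ofReal ((4 * L * 2 ^ (j * (2 / r₃ - 1)) * (5400 * Real.pi)) *
          (9 * Real.pi * C) * (2 * lam ^ (1 - r₁ / 2)) +
          (4 * L * 2 ^ (j * (2 / r₃ - 1)) * (5400 * Real.pi)) * (4 * L * (5400 * Real.pi)) *
          (6 * L * 2 ^ j * (36 * Real.pi) * (j + 2) * (36 * Real.pi * (900 * Real.pi) + 1)) *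
          lam ^ (1 - r₁)) * V * (a ^ (1 / r₁) * b ^ (1 / 2 : ℝ) * c ^ (1 / r₃)) := by
        rw [ENNReal.ofReal_add (by positivity) (by positivity),
          ENNReal.ofReal_mul (q := 2 * lam ^ (1 - r₁ / 2)) (by positivity),
          ENNReal.ofReal_mul (q := 9 * Real.pi * C) (by positivity),
          ENNReal.ofReal_mul (q := lam ^ (1 - r₁)) (by positivity),
          ENNReal.ofReal_mul (q := 6 * L * 2 ^ j * (36 * Real.pi) * (j + 2) *
            (36 * Real.pi * (900 * Real.pi) + 1)) (by positivity),
          ENNReal.ofReal_mul (q := 4 * L * (5400 * Real.pi)) (by positivity), hBh, hBg]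
        ring
    _ ≤ _ := by
        gcongr
        unfold sparseConst
        set E := (2 : ℝ) ^ (j * (2 / r₃ - 1))
        set l1 := lam ^ (1 - r₁ / 2)
        set l2 := 2 ^ j * (j + 2) * lam ^ (1 - r₁)
        set P := 5400 * Real.pi
        have hP : 1 ≤ P := by simp only [P]; linarith
        set Q := 36 * Real.pi * (900 * Real.pi)
        have hQ : 0 ≤ Q := by positivity
        have hE : 0 ≤ E := by positivity
        have hl1 : 0 ≤ l1 := by positivity
        have hl2 : 0 ≤ l2 := by positivity
        have h3 : 0 ≤ L * C := by positivity
        have h4 : 0 ≤ L ^ 3 := by positivity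
        calc _ = 72 * Real.pi * P * (L * C) * (E * l1) +
              3456 * Real.pi * P ^ 2 * (Q + 1) * L ^ 3 * (E * l2) := by
              simp only [l2]; ring
          _ ≤ 3456 * Real.pi * P ^ 2 * (Q + 1) * (L * C + L ^ 3) * (E * l1) +
              3456 * Real.pi * P ^ 2 * (Q + 1) * (L * C + L ^ 3) * (E * l2) := by
              have h5 : 72 * Real.pi * P ≤ 3456 * Real.pi * P ^ 2 * (Q + 1) := by
                have h6 : P ≤ P ^ 2 := by nlinarith
                calc 72 * Real.pi * P ≤ 3456 * Real.pi * P ^ 2 := by gcongr; norm_num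
                  _ ≤ _ := le_mul_of_one_le_right (by positivity) (by linarith)
              gcongr
              · linarith
              · linarith
          _ = _ := by ring

theorem sc_add_nat_le (n : ℤ) (j : ℕ) : sc (n + j) ≤ sc n := sc_anti (by omega)

theorem lav_cv_congr {θ : E2 → ℂ} {L : ℝ} (h : IsKer θ L) {n : ℤ} {j : ℕ} {f g : E2 → ℂ} {x : E2}
    (hfg : ∀ w ∈ Metric.closedBall x (4 * sc n), f w = g w) :
    lav n (fun y => ‖cv θ (n + j) f y‖ₑ) x = lav n (fun y => ‖cv θ (n + j) g y‖ₑ) x := by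
  have key : ∀ y ∈ Metric.closedBall x (3 * sc n), cv θ (n + j) f y = cv θ (n + j) g y := by
    intro y hy
    rw [cv_apply, cv_apply]
    refine integral_congr_ae (Filter.Eventually.of_forall fun w => ?_)
    beta_reduce
    by_cases hw : sc (n + j) < ‖y - w‖
    · rw [h.ker_supp _ hw, mul_zero, mul_zero]
    · rw [hfg]
      have h1 := sc_add_nat_le n j
      rw [← dist_eq_norm, dist_comm] at hw
      rw [Metric.mem_closedBall] at hy ⊢
      linarith [dist_triangle w y x]
  exact le_antisymm (lav_mono_on fun y hy => by rw [key y hy])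
    (lav_mono_on fun y hy => by rw [key y hy])

theorem closedBall_subset_corner {n nS : ℤ} (hn : nS ≤ n) {x z : E2} (hx : x ∈ cube nS z) :
    Metric.closedBall x (4 * sc n) ⊆ Metric.closedBall (corner nS z) (6 * sc nS) := by
  apply Metric.closedBall_subset_closedBall'
  have h1 := dist_corner nS x
  rw [corner_eq hx] at h1
  have := sc_pos nS
  have := sc_anti hn
  linarith

theorem Nice.indicator {f : E2 → ℂ} (hf : Nice f) {D : Set E2} (hD : MeasurableSet D) :
    Nice (D.indicator f) := by
  refine ⟨hf.meas.indicator hD, hf.int.indicator hD, ?_⟩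
  obtain ⟨B, hB⟩ := hf.bdd
  refine ⟨B, fun x => (norm_indicator_le_norm_self f x).trans (hB x)⟩

theorem lintegral_indicator_rpow {f : E2 → ℂ} {r : ℝ} (hr : 0 < r) (n : ℤ) (z : E2) :
    ∫⁻ x, ‖(Metric.closedBall (corner n z) (6 * sc n)).indicator f x‖ₑ ^ r =
      ENNReal.ofReal (sc n ^ 2) * avg n (fun x => ‖f x‖ₑ ^ r) z := by
  have hs := sc_pos n
  unfold avg
  rw [← mul_assoc, ← ENNReal.ofReal_mul (by positivity), mul_inv_cancel₀ (by positivity),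
    ENNReal.ofReal_one, one_mul, ← lintegral_indicator Metric.isClosed_closedBall.measurableSet]
  refine lintegral_congr fun x => ?_
  by_cases hx : x ∈ Metric.closedBall (corner n z) (6 * sc n)
  · rw [Set.indicator_of_mem hx, Set.indicator_of_mem hx]
  · rw [Set.indicator_of_notMem hx, Set.indicator_of_notMem hx, enorm_zero,
      ENNReal.zero_rpow_of_pos hr]

theorem Nice.avg_ne_top {f : E2 → ℂ} (hf : Nice f) {r : ℝ} (hr : 0 ≤ r) (n : ℤ) (z : E2) :
    avg n (fun x => ‖f x‖ₑ ^ r) z ≠ ⊤ := by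
  obtain ⟨B, hB⟩ := hf.bdd
  refine ne_top_of_le_ne_top (b := avg n (fun _ => ENNReal.ofReal B ^ r) z) ?_ ?_
  · rw [avg_const]
    exact ENNReal.mul_ne_top ENNReal.ofReal_ne_top
      (ENNReal.rpow_ne_top_of_nonneg hr ENNReal.ofReal_ne_top)
  · refine avg_mono (fun x => ?_) _ _
    gcongr
    rw [← ofReal_norm]
    exact ENNReal.ofReal_le_ofReal (hB x)

theorem lav_cv_eq_zero {θ : E2 → ℂ} {L : ℝ} (h : IsKer θ L) {r : ℝ} (hr1 : 1 ≤ r) (hr2 : r ≤ 2)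
    {n nS : ℤ} (hn : nS ≤ n) (j : ℕ) {f : E2 → ℂ} (hf : Measurable f) {x z : E2}
    (hx : x ∈ cube nS z) (h0 : avg nS (fun x => ‖f x‖ₑ ^ r) z = 0) :
    lav n (fun y => ‖cv θ (n + j) f y‖ₑ) x = 0 := by
  have hs := sc_pos nS
  refine le_antisymm ((h.lav_cv_le hr1 hr2 n j hf x).trans (le_of_eq ?_)) zero_le
  unfold avg at h0
  have h2 : ¬ ((sc nS ^ 2)⁻¹ ≤ 0) := not_le.2 (by positivity)
  rw [mul_eq_zero, ENNReal.ofReal_eq_zero, or_iff_right h2] at h0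
  have h1 : ∫⁻ y in Metric.closedBall x (4 * sc n), ‖f y‖ₑ ^ r = 0 :=
    le_antisymm ((lintegral_mono_set (closedBall_subset_corner hn hx)).trans h0.le) zero_le
  rw [h1, mul_zero, ENNReal.zero_rpow_of_pos (by positivity), mul_zero]

theorem sparse_bound {ψ ψ' φ : E2 → ℂ} {L C : ℝ} (hψ : IsKer ψ L) (hψ' : IsKer ψ' L)
    (hφ : IsKer φ L) (hC : 0 ≤ C) (hsq : SqBdd ψ C) (hsq' : SqBdd ψ' C) {f g h : E2 → ℂ}
    (hf : Nice f) (hg : Nice g) (hh : Nice h) {r₁ r₃ lam : ℝ} (hr1 : 1 ≤ r₁) (hr2 : r₁ ≤ 2)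
    (hr3 : 1 ≤ r₃) (hr4 : r₃ ≤ 2) (hlam : 96 * (36 * Real.pi * (900 * Real.pi)) ≤ lam)
    (n0 n1 : ℤ) (j : ℕ) :
    ∑ n ∈ Finset.Icc n0 n1, ∫⁻ x, lav n (fun y => ‖cv ψ (n + j) f y‖ₑ) x *
          lav n (fun y => ‖cv ψ' (n + j) g y‖ₑ) x * lav n (fun y => ‖cv φ (n + j) h y‖ₑ) x ≤
      2 * ENNReal.ofReal (sparseConst * (L * C + L ^ 3) * 2 ^ (j * (2 / r₃ - 1)) *
        (lam ^ (1 - r₁ / 2) + 2 ^ j * (j + 2) * lam ^ (1 - r₁))) *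
        ∫⁻ x, dmax (fun x => ‖f x‖ₑ ^ r₁) x ^ (1 / r₁) *
          dmax (fun x => ‖g x‖ₑ ^ (2 : ℝ)) x ^ (1 / 2 : ℝ) *
          dmax (fun x => ‖h x‖ₑ ^ r₃) x ^ (1 / r₃) := by
  have hpi := Real.pi_pos
  have hlam0 : 0 < lam := lt_of_lt_of_le (by positivity) hlam
  set τ : ℤ → E2 → ℝ≥0∞ := fun n x => lav n (fun y => ‖cv ψ (n + j) f y‖ₑ) x *
    lav n (fun y => ‖cv ψ' (n + j) g y‖ₑ) x * lav n (fun y => ‖cv φ (n + j) h y‖ₑ) x with hτd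
  have hτ : ∀ n, Measurable (τ n) := fun n =>
    ((measurable_lav n (Nice.cv hψ _ hf).meas.enorm).mul
      (measurable_lav n (Nice.cv hψ' _ hg).meas.enorm)).mul
      (measurable_lav n (Nice.cv hφ _ hh).meas.enorm)
  rw [← lintegral_finsetSum _ (fun n _ => hτ n)]
  refine stopping_recursion τ hτ _ _ ENNReal.ofReal_ne_top n1 (fun nS z hnS => ?_) n0
  set a := avg nS (fun x => ‖f x‖ₑ ^ r₁) z with ha
  set b := avg nS (fun x => ‖g x‖ₑ ^ (2 : ℝ)) z with hb
  set c := avg nS (fun x => ‖h x‖ₑ ^ r₃) z with hc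
  by_cases h0 : a = 0 ∨ b = 0 ∨ c = 0
  · refine ⟨∅, MeasurableSet.empty, ?_, fun w hw => ?_⟩
    · rw [Set.sdiff_empty]
      exact le_mul_of_one_le_left zero_le (by norm_num)
    · rw [setLIntegral_congr_fun (g := fun _ => 0) (measurableSet_cube _ _)]
      · simp
      · intro x hx
        refine Finset.sum_eq_zero fun n hn => ?_
        have hn' := (Finset.mem_Icc.1 hn).1
        refine le_antisymm ((Set.indicator_le_self _ _ x).trans (le_of_eq ?_)) zero_le
        simp only [hτd]
        rcases h0 with h0 | h0 | h0
        · rw [lav_cv_eq_zero hψ hr1 hr2 hn' j hf.meas hx h0, zero_mul, zero_mul]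
        · rw [lav_cv_eq_zero hψ' (by norm_num) le_rfl hn' j hg.meas hx h0, mul_zero, zero_mul]
        · rw [lav_cv_eq_zero hφ hr3 hr4 hn' j hh.meas hx h0, mul_zero]
  push Not at h0
  obtain ⟨ha0, hb0, hc0⟩ := h0
  set D := Metric.closedBall (corner nS z) (6 * sc nS) with hD
  have hDm : MeasurableSet D := Metric.isClosed_closedBall.measurableSet
  have hF := hf.indicator hDm
  have hG := hg.indicator hDm
  have hH := hh.indicator hDm
  have hFa := lintegral_indicator_rpow (f := f) (r := r₁) (by linarith) nS z
  have hGb := lintegral_indicator_rpow (f := g) (r := 2) (by norm_num) nS z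
  have hHc := lintegral_indicator_rpow (f := h) (r := r₃) (by linarith) nS z
  rw [← volume_cube nS z] at hFa hGb hHc
  have hvol := volume_stopSet_le hF.meas hr1 hr2 hlam ha0 (hf.avg_ne_top (by linarith) _ _) hb0
    (hg.avg_ne_top (by norm_num) _ _) hc0 (hh.avg_ne_top (by linarith) _ _) hFa.le hGb.le hHc.le
  have hcore := sparse_core hψ hψ' hφ hC hsq hsq' hF hG hH hr1 hr2 hr3 hr4 hlam0 (c := c) ha0
    (hf.avg_ne_top (by linarith) _ _) hFa.le hGb.le (Finset.Icc nS n1) j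
  set Ω := stopSet (D.indicator f) (D.indicator g) (D.indicator h) r₃
    (ENNReal.ofReal lam * a ^ (1 / r₁))
    (ENNReal.ofReal (5400 * Real.pi) * b) (ENNReal.ofReal (5400 * Real.pi) * c) with hΩ
  have hΩm : MeasurableSet Ω := measurableSet_stopSet _ _ _ _ _ _ _
  have hVtop : volume (cube nS z) ≠ ⊤ := by rw [volume_cube]; exact ENNReal.ofReal_ne_top
  refine ⟨Ω, hΩm, ?_, fun w hw => ?_⟩
  · have h1 : volume (cube nS z) ≤ volume (cube nS z \ Ω) + volume Ω := by
      refine (measure_mono (t := cube nS z \ Ω ∪ Ω) ?_).trans (measure_union_le _ _)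
      rw [Set.sdiff_union_self]; exact Set.subset_union_left
    have h2 : volume (cube nS z) + volume (cube nS z) ≤
        2 * volume (cube nS z \ Ω) + volume (cube nS z) := by
      calc _ = 2 * volume (cube nS z) := (two_mul _).symm
        _ ≤ 2 * (volume (cube nS z \ Ω) + volume Ω) := mul_le_mul_right h1 _
        _ ≤ _ := by rw [mul_add]; gcongr
    exact (ENNReal.add_le_add_iff_right hVtop).1 h2
  · calc _ = ∫⁻ x in cube nS z, ∑ n ∈ Finset.Icc nS n1, (inner_part n Ω)ᶜ.indicator
          (fun x => lav n (fun y => ‖cv ψ (n + j) (D.indicator f) y‖ₑ) x *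
          lav n (fun y => ‖cv ψ' (n + j) (D.indicator g) y‖ₑ) x *
          lav n (fun y => ‖cv φ (n + j) (D.indicator h) y‖ₑ) x) x := by
          refine setLIntegral_congr_fun (measurableSet_cube _ _) fun x hx => ?_
          refine Finset.sum_congr rfl fun n hn => ?_
          have hsub := closedBall_subset_corner (Finset.mem_Icc.1 hn).1 hx
          by_cases hx' : x ∈ (inner_part n Ω)ᶜ
          · rw [Set.indicator_of_mem hx', Set.indicator_of_mem hx']
            simp only [hτd]
            rw [lav_cv_congr hψ (g := D.indicator f)
                (fun w hw => (Set.indicator_of_mem (hsub hw) f).symm),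
              lav_cv_congr hψ' (g := D.indicator g)
                (fun w hw => (Set.indicator_of_mem (hsub hw) g).symm),
              lav_cv_congr hφ (g := D.indicator h)
                (fun w hw => (Set.indicator_of_mem (hsub hw) h).symm)]
          · rw [Set.indicator_of_notMem hx', Set.indicator_of_notMem hx']
      _ ≤ ∫⁻ x, ∑ n ∈ Finset.Icc nS n1, (inner_part n Ω)ᶜ.indicator
          (fun x => lav n (fun y => ‖cv ψ (n + j) (D.indicator f) y‖ₑ) x *
          lav n (fun y => ‖cv ψ' (n + j) (D.indicator g) y‖ₑ) x *
          lav n (fun y => ‖cv φ (n + j) (D.indicator h) y‖ₑ) x) x := setLIntegral_le_lintegral _ _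
      _ ≤ _ := by
          rw [lintegral_finsetSum]
          · refine hcore.trans (mul_le_mul_right ?_ _)
            have key : ∀ u : E2 → ℝ≥0∞, avg nS u z ≤ dmax u w := fun u =>
              (avg_congr hw u).symm.le.trans (avg_le_dmax _ _ _)
            gcongr <;> exact key _
          · intro n _
            exact Measurable.indicator (((measurable_lav n (Nice.cv hψ _ hF).meas.enorm).mul
              (measurable_lav n (Nice.cv hψ' _ hG).meas.enorm)).mul
              (measurable_lav n (Nice.cv hφ _ hH).meas.enorm)) (measurableSet_inner_part _ _).compl

theorem dmax_le_of_ae {f : E2 → ℝ≥0∞} {c : ℝ≥0∞} (h : ∀ᵐ x, f x ≤ c) (x : E2) :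
    dmax f x ≤ ENNReal.ofReal (36 * Real.pi) * c := by
  refine iSup_le fun n => le_trans ?_ (avg_const n c x).le
  unfold avg
  exact mul_le_mul_right (lintegral_mono_ae (ae_restrict_of_ae h)) _

/-- The maximal function of exponent `r` factors through a product suited to Hölder's inequality
with exponent `q`. -/
theorem dmax_rep {r : ℝ} {q : ℝ≥0∞} (hr : 1 ≤ r) (hq : ENNReal.ofReal r < q) :
    ∃ C : ℝ, 0 < C ∧ ∀ f : E2 → ℂ, Nice f → ∃ (M : ℝ≥0∞) (F : E2 → ℝ≥0∞), Measurable F ∧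
      (∀ x, dmax (fun x => ‖f x‖ₑ ^ r) x ^ (1 / r) ≤ M * F x ^ (1 / q).toReal) ∧
      M * (∫⁻ x, F x) ^ (1 / q).toReal ≤ ENNReal.ofReal C * eLpNorm f q volume := by
  have hr0 : 0 < r := by linarith
  rcases eq_or_ne q ⊤ with rfl | hqt
  · refine ⟨(36 * Real.pi) ^ (1 / r), by positivity, fun f hf =>
      ⟨ENNReal.ofReal ((36 * Real.pi) ^ (1 / r)) * eLpNorm f ⊤ volume, 0, measurable_const, ?_, ?_⟩⟩
    · intro x
      have h1 : dmax (fun x => ‖f x‖ₑ ^ r) x ≤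
          ENNReal.ofReal (36 * Real.pi) * eLpNorm f ⊤ volume ^ r := by
        refine dmax_le_of_ae ?_ x
        rw [eLpNorm_exponent_top]
        filter_upwards [enorm_ae_le_eLpNormEssSup f volume] with x hx
        gcongr
      simp only [one_div, ENNReal.inv_top, ENNReal.toReal_zero, ENNReal.rpow_zero, mul_one]
      calc _ ≤ (ENNReal.ofReal (36 * Real.pi) * eLpNorm f ⊤ volume ^ r) ^ r⁻¹ := by gcongr
        _ = _ := by
          rw [ENNReal.mul_rpow_of_nonneg _ _ (by positivity), ← ENNReal.rpow_mul,
            mul_inv_cancel₀ hr0.ne', ENNReal.rpow_one, ENNReal.ofReal_rpow_of_pos (by positivity)]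
    · simp
  · set Q := q.toReal with hQ
    have hrQ : r < Q := by
      rwa [← ENNReal.ofReal_lt_ofReal_iff_of_nonneg hr0.le, hQ, ENNReal.ofReal_toReal hqt]
    have hq0 : q ≠ 0 := (zero_le.trans_lt hq).ne'
    obtain ⟨C, hC, hbd⟩ := dmax_strong (p := Q / r) (by rwa [one_lt_div hr0])
    have hQ0 : 0 < Q := by linarith
    have e : (1 / q).toReal = 1 / Q := by rw [one_div, one_div, ENNReal.toReal_inv]
    refine ⟨C ^ (1 / Q), by positivity, fun f hf => ⟨1, fun x => dmax (fun x => ‖f x‖ₑ ^ r) x ^ (Q / r),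
      (measurable_dmax _).pow_const _, fun x => ?_, ?_⟩⟩
    · rw [e, one_mul, ← ENNReal.rpow_mul]
      apply le_of_eq; congr 1; field_simp
    · rw [e, one_mul, eLpNorm_eq_lintegral_rpow_enorm_toReal hq0 hqt, ← hQ,
        ← ENNReal.ofReal_rpow_of_pos hC, ← ENNReal.mul_rpow_of_nonneg _ _ (by positivity)]
      refine ENNReal.rpow_le_rpow ?_ (by positivity)
      obtain ⟨B, hB⟩ := hf.bdd
      refine (hbd (fun x => ‖f x‖ₑ ^ r) (hf.meas.enorm.pow_const _) ⟨ENNReal.ofReal B ^ r,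
        ENNReal.rpow_ne_top_of_nonneg hr0.le ENNReal.ofReal_ne_top, fun x => ?_⟩).trans
        (le_of_eq ?_)
      · gcongr
        rw [← ofReal_norm]
        exact ENNReal.ofReal_le_ofReal (hB x)
      · congr 1
        refine lintegral_congr fun x => ?_
        rw [← ENNReal.rpow_mul]; congr 1; field_simp

theorem holder_three {w₁ w₂ w₃ : ℝ} (h1 : 0 ≤ w₁) (h2 : 0 ≤ w₂) (h3 : 0 ≤ w₃)
    (hw : w₁ + w₂ + w₃ = 1) {F₁ F₂ F₃ : E2 → ℝ≥0∞} (hF1 : Measurable F₁) (hF2 : Measurable F₂)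
    (hF3 : Measurable F₃) : ∫⁻ x, F₁ x ^ w₁ * F₂ x ^ w₂ * F₃ x ^ w₃ ≤
      (∫⁻ x, F₁ x) ^ w₁ * (∫⁻ x, F₂ x) ^ w₂ * (∫⁻ x, F₃ x) ^ w₃ := by
  have := ENNReal.lintegral_prod_norm_pow_le (μ := volume) (Finset.univ : Finset (Fin 3))
    (f := ![F₁, F₂, F₃]) (p := ![w₁, w₂, w₃])
    (by intro i _; fin_cases i <;> simp [hF1.aemeasurable, hF2.aemeasurable, hF3.aemeasurable])
    (by simp [Fin.sum_univ_three, hw]) (by intro i _; fin_cases i <;> simp [h1, h2, h3])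
  simpa [Fin.prod_univ_three] using this

theorem lintegral_dmax_le {r₁ r₂ r₃ : ℝ} {q₁ q₂ q₃ : ℝ≥0∞} (hr1 : 1 ≤ r₁) (hr2 : 1 ≤ r₂)
    (hr3 : 1 ≤ r₃) (hq1 : ENNReal.ofReal r₁ < q₁) (hq2 : ENNReal.ofReal r₂ < q₂)
    (hq3 : ENNReal.ofReal r₃ < q₃) (hq : (1 / q₁).toReal + (1 / q₂).toReal + (1 / q₃).toReal = 1) :
    ∃ C : ℝ, 0 < C ∧ ∀ f g h : E2 → ℂ, Nice f → Nice g → Nice h →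
      ∫⁻ x, dmax (fun x => ‖f x‖ₑ ^ r₁) x ^ (1 / r₁) * dmax (fun x => ‖g x‖ₑ ^ r₂) x ^ (1 / r₂) *
          dmax (fun x => ‖h x‖ₑ ^ r₃) x ^ (1 / r₃) ≤
        ENNReal.ofReal C * (eLpNorm f q₁ volume * eLpNorm g q₂ volume * eLpNorm h q₃ volume) := by
  obtain ⟨C1, hC1, H1⟩ := dmax_rep hr1 hq1
  obtain ⟨C2, hC2, H2⟩ := dmax_rep hr2 hq2
  obtain ⟨C3, hC3, H3⟩ := dmax_rep hr3 hq3
  refine ⟨C1 * C2 * C3, by positivity, fun f g h hf hg hh => ?_⟩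
  obtain ⟨M1, F1, hm1, hb1, hi1⟩ := H1 f hf
  obtain ⟨M2, F2, hm2, hb2, hi2⟩ := H2 g hg
  obtain ⟨M3, F3, hm3, hb3, hi3⟩ := H3 h hh
  calc _ ≤ ∫⁻ x, (M1 * F1 x ^ (1 / q₁).toReal) * (M2 * F2 x ^ (1 / q₂).toReal) *
        (M3 * F3 x ^ (1 / q₃).toReal) := lintegral_mono fun x =>
        mul_le_mul' (mul_le_mul' (hb1 x) (hb2 x)) (hb3 x)
    _ = ∫⁻ x, (M1 * M2 * M3) * (F1 x ^ (1 / q₁).toReal * F2 x ^ (1 / q₂).toReal *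
        F3 x ^ (1 / q₃).toReal) := lintegral_congr fun x => by ring
    _ = (M1 * M2 * M3) * ∫⁻ x, (F1 x ^ (1 / q₁).toReal * F2 x ^ (1 / q₂).toReal *
        F3 x ^ (1 / q₃).toReal) := lintegral_const_mul _ (by fun_prop)
    _ ≤ (M1 * M2 * M3) * _ := mul_le_mul_right (holder_three ENNReal.toReal_nonneg
        ENNReal.toReal_nonneg ENNReal.toReal_nonneg hq hm1 hm2 hm3) _
    _ = (M1 * (∫⁻ x, F1 x) ^ (1 / q₁).toReal) * (M2 * (∫⁻ x, F2 x) ^ (1 / q₂).toReal) *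
        (M3 * (∫⁻ x, F3 x) ^ (1 / q₃).toReal) := by ring
    _ ≤ _ := mul_le_mul' (mul_le_mul' hi1 hi2) hi3
    _ = _ := by
        rw [ENNReal.ofReal_mul (by positivity), ENNReal.ofReal_mul (by positivity)]; ring

/-- Trilinear square-function estimate with loss `2 ^ ((1 - δ) j)`. -/
def TriBdd (θ₁ θ₂ θ₃ : E2 → ℂ) (q₁ q₂ q₃ : ℝ≥0∞) : Prop :=
  ∃ C δ : ℝ, 0 < C ∧ 0 < δ ∧ ∀ f g h : E2 → ℂ, Nice f → Nice g → Nice h → ∀ (j : ℕ) (n0 n1 : ℤ),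
    ∑ n ∈ Finset.Icc n0 n1, ∫⁻ x, lav n (fun y => ‖cv θ₁ (n + j) f y‖ₑ) x *
          lav n (fun y => ‖cv θ₂ (n + j) g y‖ₑ) x * lav n (fun y => ‖cv θ₃ (n + j) h y‖ₑ) x ≤
      ENNReal.ofReal (C * 2 ^ ((1 - δ) * j)) *
        (eLpNorm f q₁ volume * eLpNorm g q₂ volume * eLpNorm h q₃ volume)

theorem TriBdd.swap₁₂ {θ₁ θ₂ θ₃ : E2 → ℂ} {q₁ q₂ q₃ : ℝ≥0∞} (H : TriBdd θ₁ θ₂ θ₃ q₁ q₂ q₃) :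
    TriBdd θ₂ θ₁ θ₃ q₂ q₁ q₃ := by
  obtain ⟨C, δ, hC, hδ, H⟩ := H
  refine ⟨C, δ, hC, hδ, fun f g h hf hg hh j n0 n1 => ?_⟩
  have := H g f h hg hf hh j n0 n1
  simpa only [mul_comm (eLpNorm g q₁ volume), mul_comm (lav _ (fun y => ‖cv θ₁ (_ + j) g y‖ₑ) _)] using this

theorem TriBdd.swap₂₃ {θ₁ θ₂ θ₃ : E2 → ℂ} {q₁ q₂ q₃ : ℝ≥0∞} (H : TriBdd θ₁ θ₂ θ₃ q₁ q₂ q₃) :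
    TriBdd θ₁ θ₃ θ₂ q₁ q₃ q₂ := by
  obtain ⟨C, δ, hC, hδ, H⟩ := H
  refine ⟨C, δ, hC, hδ, fun f g h hf hg hh j n0 n1 => ?_⟩
  have := H f h g hf hh hg j n0 n1
  simpa only [mul_right_comm (eLpNorm f q₁ volume),
    mul_right_comm (lav _ (fun y => ‖cv θ₁ (_ + j) f y‖ₑ) _)] using this

theorem nat_add_two_le {δ : ℝ} (hδ : 0 < δ) :
    ∃ c : ℝ, 0 < c ∧ ∀ j : ℕ, (j : ℝ) + 2 ≤ c * 2 ^ (δ * j) := by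
  have h2 : 0 < Real.log 2 := Real.log_pos (by norm_num)
  refine ⟨2 + 1 / (δ * Real.log 2), by positivity, fun j => ?_⟩
  have h1 : δ * Real.log 2 * j + 1 ≤ 2 ^ (δ * j : ℝ) := by
    rw [Real.rpow_def_of_pos (by norm_num)]
    refine le_trans (le_of_eq ?_) (Real.add_one_le_exp _)
    ring
  have hj : (0 : ℝ) ≤ j := Nat.cast_nonneg j
  calc (j : ℝ) + 2 ≤ (2 + 1 / (δ * Real.log 2)) * (δ * Real.log 2 * j + 1) := by
        have : 1 / (δ * Real.log 2) * (δ * Real.log 2 * j) = j := by field_simp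
        have h3 : 0 ≤ δ * Real.log 2 * j := by positivity
        have h4 : 0 ≤ 1 / (δ * Real.log 2) := by positivity
        nlinarith
    _ ≤ _ := by gcongr

theorem loss_bound {x₁ x₃ K A : ℝ} (hx1 : 1 / 2 < x₁) (hx1' : x₁ < 1) (hx3 : 1 / 2 ≤ x₃)
    (hx : x₁ + x₃ < 3 / 2) (hK : 1 ≤ K) (hA : 0 < A) :
    ∃ C δ : ℝ, 0 < C ∧ 0 < δ ∧ ∀ j : ℕ, ∃ lam : ℝ, K ≤ lam ∧
      A * 2 ^ (j * (2 * x₃ - 1)) * (lam ^ (1 - 1 / x₁ / 2) + 2 ^ j * (j + 2) * lam ^ (1 - 1 / x₁)) ≤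
        C * 2 ^ ((1 - δ) * j) := by
  have hx0 : 0 < x₁ := by linarith
  set e := 2 * x₃ - 1 with he
  set a := 1 / x₁ - 1 with ha
  set b := 1 - 1 / x₁ / 2 with hb
  have ha0 : 0 < a := by rw [ha, sub_pos, one_lt_div hx0]; exact hx1'
  have hb0 : 0 < b := by
    rw [hb, sub_pos, div_div, div_lt_one (by positivity)]; linarith
  have he0 : 0 ≤ e := by linarith
  have hlt : e / a < (1 - e) / b := by
    rw [div_lt_div_iff₀ ha0 hb0, he, ha, hb]
    have : ((1 - (2 * x₃ - 1)) * (1 / x₁ - 1) - (2 * x₃ - 1) * (1 - 1 / x₁ / 2)) * (2 * x₁) =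
      3 - 2 * (x₁ + x₃) := by field_simp; ring
    have h2 : 0 < 3 - 2 * (x₁ + x₃) := by linarith
    rw [← this] at h2
    have := (mul_pos_iff_of_pos_right (by positivity : 0 < 2 * x₁)).1 h2
    linarith
  obtain ⟨t, ht1, ht2⟩ := exists_between hlt
  rw [div_lt_iff₀ ha0] at ht1
  rw [lt_div_iff₀ hb0] at ht2
  have ht0 : 0 ≤ t := by
    by_contra h
    push Not at h
    nlinarith
  set δ := min (1 - e - t * b) ((t * a - e) / 2) with hδ
  have hδ0 : 0 < δ := lt_min (by linarith) (by linarith)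
  obtain ⟨c, hc, hcj⟩ := nat_add_two_le hδ0
  have hd1 : δ ≤ 1 - e - t * b := min_le_left _ _
  have hd2 : δ ≤ (t * a - e) / 2 := min_le_right _ _
  refine ⟨A * (K ^ b + c * K ^ (-a)), δ, by positivity, hδ0, fun j => ⟨K * 2 ^ (t * j), ?_, ?_⟩⟩
  · exact le_mul_of_one_le_right (by linarith) (Real.one_le_rpow (by norm_num) (by positivity))
  · have hK0 : 0 < K := by linarith
    have hj : (0 : ℝ) ≤ j := Nat.cast_nonneg j
    have e1 : ∀ y : ℝ, (K * 2 ^ (t * j)) ^ y = K ^ y * 2 ^ (t * j * y) := fun y => by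
      rw [Real.mul_rpow hK0.le (by positivity), ← Real.rpow_mul (by norm_num)]
    rw [show 1 - 1 / x₁ = -a by rw [ha]; ring, e1, e1, ← Real.rpow_natCast]
    have p1 : (2 : ℝ) ^ (j * e) * 2 ^ (t * j * b) ≤ 2 ^ ((1 - δ) * j) := by
      rw [← Real.rpow_add (by norm_num)]
      refine Real.rpow_le_rpow_of_exponent_le (by norm_num) ?_
      nlinarith
    have p2 : (2 : ℝ) ^ (j * e) * (2 ^ (j : ℝ) * 2 ^ (δ * j) * 2 ^ (t * j * (-a))) ≤ 2 ^ ((1 - δ) * j) := by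
      rw [← Real.rpow_add (by norm_num), ← Real.rpow_add (by norm_num), ← Real.rpow_add (by norm_num)]
      refine Real.rpow_le_rpow_of_exponent_le (by norm_num) ?_
      nlinarith
    calc _ ≤ A * 2 ^ (j * e) * (K ^ b * 2 ^ (t * j * b) +
          2 ^ (j : ℝ) * (c * 2 ^ (δ * j)) * (K ^ (-a) * 2 ^ (t * j * (-a)))) := by
          gcongr; exact hcj j
      _ = A * K ^ b * (2 ^ (j * e) * 2 ^ (t * j * b)) + A * c * K ^ (-a) *
          (2 ^ (j * e) * (2 ^ (j : ℝ) * 2 ^ (δ * j) * 2 ^ (t * j * (-a)))) := by ring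
      _ ≤ A * K ^ b * 2 ^ ((1 - δ) * j) + A * c * K ^ (-a) * 2 ^ ((1 - δ) * j) := by gcongr
      _ = _ := by ring

theorem sparseConst_pos : 0 < sparseConst := by
  have := Real.pi_pos
  unfold sparseConst; positivity

theorem ofReal_inv_lt {x : ℝ} {q : ℝ≥0∞} (hx : 0 < x) (h : (1 / q).toReal < x) (hq : q ≠ 0) :
    ENNReal.ofReal (1 / x) < q := by
  rw [one_div, ENNReal.ofReal_inv_of_pos hx, ENNReal.inv_lt_iff_inv_lt, ← one_div,
    ← ENNReal.ofReal_toReal (a := 1 / q) (by simpa using hq)]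
  exact (ENNReal.ofReal_lt_ofReal_iff hx).2 h

theorem one_div_toReal_lt {q a : ℝ≥0∞} (ha : a < q) (ha0 : a ≠ 0) :
    (1 / q).toReal < (1 / a).toReal := by
  rw [one_div, one_div]
  exact ENNReal.toReal_strict_mono (by simpa using ha0) (ENNReal.inv_lt_inv.2 ha)

theorem triBdd_of_two_lt {ψ ψ' φ : E2 → ℂ} {L C : ℝ} (hψ : IsKer ψ L) (hψ' : IsKer ψ' L)
    (hφ : IsKer φ L) (hC : 0 ≤ C) (hsq : SqBdd ψ C) (hsq' : SqBdd ψ' C) {q₁ q₂ q₃ : ℝ≥0∞}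
    (hq1 : 1 < q₁) (hq2 : 2 < q₂) (hq3 : 1 < q₃)
    (hq : (1 / q₁).toReal + (1 / q₂).toReal + (1 / q₃).toReal = 1) :
    TriBdd ψ ψ' φ q₁ q₂ q₃ := by
  have hL := hψ.nonneg
  have hpi := Real.pi_gt_three
  have w1 := one_div_toReal_lt hq1 one_ne_zero
  have w3 := one_div_toReal_lt hq3 one_ne_zero
  have v1 : 0 ≤ (1 / q₁).toReal := ENNReal.toReal_nonneg
  have v2 : 0 ≤ (1 / q₂).toReal := ENNReal.toReal_nonneg
  have v3 : 0 ≤ (1 / q₃).toReal := ENNReal.toReal_nonneg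
  simp only [div_one, ENNReal.toReal_one] at w1 w3
  obtain ⟨x₁, x₃, h1, h1', h1w, h3, h3', h3w, hx⟩ : ∃ x₁ x₃ : ℝ, 1 / 2 < x₁ ∧ x₁ < 1 ∧
      (1 / q₁).toReal < x₁ ∧ 1 / 2 < x₃ ∧ x₃ < 1 ∧ (1 / q₃).toReal < x₃ ∧ x₁ + x₃ < 3 / 2 := by
    set M1 := max (1 / q₁).toReal (1 / 2) with hM1
    set M3 := max (1 / q₃).toReal (1 / 2) with hM3
    have a1 : M1 < 1 := max_lt w1 (by norm_num)
    have a3 : M3 < 1 := max_lt w3 (by norm_num)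
    have a : M1 + M3 < 3 / 2 := by
      rcases max_choice (1 / q₁).toReal (1 / 2) with e | e <;>
      rcases max_choice (1 / q₃).toReal (1 / 2) with e' | e' <;>
      rw [hM1, hM3, e, e'] <;> linarith
    set ε := min ((3 / 2 - M1 - M3) / 4) (min ((1 - M1) / 2) ((1 - M3) / 2)) with hε
    have hε0 : 0 < ε := lt_min (by linarith) (lt_min (by linarith) (by linarith))
    have b1 : ε ≤ (3 / 2 - M1 - M3) / 4 := min_le_left _ _
    have b2 : ε ≤ (1 - M1) / 2 := (min_le_right _ _).trans (min_le_left _ _)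
    have b3 : ε ≤ (1 - M3) / 2 := (min_le_right _ _).trans (min_le_right _ _)
    have c1 : (1 / q₁).toReal ≤ M1 := le_max_left _ _
    have c2 : 1 / 2 ≤ M1 := le_max_right _ _
    have c3 : (1 / q₃).toReal ≤ M3 := le_max_left _ _
    have c4 : 1 / 2 ≤ M3 := le_max_right _ _
    exact ⟨M1 + ε, M3 + ε, by linarith, by linarith, by linarith, by linarith, by linarith,
      by linarith, by linarith⟩
  have hx10 : 0 < x₁ := by linarith
  have hx30 : 0 < x₃ := by linarith
  have r1 : 1 ≤ 1 / x₁ := by rw [le_div_iff₀ hx10]; linarith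
  have r1' : 1 / x₁ ≤ 2 := by rw [div_le_iff₀ hx10]; linarith
  have r3 : 1 ≤ 1 / x₃ := by rw [le_div_iff₀ hx30]; linarith
  have r3' : 1 / x₃ ≤ 2 := by rw [div_le_iff₀ hx30]; linarith
  obtain ⟨K, hK, HK⟩ := lintegral_dmax_le r1 (by norm_num : (1 : ℝ) ≤ 2) r3
    (ofReal_inv_lt hx10 h1w (by rintro rfl; simp at hq1)) (by simpa using hq2)
    (ofReal_inv_lt hx30 h3w (by rintro rfl; simp at hq3)) hq
  obtain ⟨D, δ, hD, hδ, HD⟩ := loss_bound (K := 96 * (36 * Real.pi * (900 * Real.pi)))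
    (A := sparseConst * (L * C + L ^ 3) + 1) h1 h1' h3.le hx (by nlinarith)
    (by have := sparseConst_pos; positivity)
  refine ⟨2 * D * K, δ, by positivity, hδ, fun f g h hf hg hh j n0 n1 => ?_⟩
  obtain ⟨lam, hl, hlb⟩ := HD j
  have hlam0 : 0 < lam := lt_of_lt_of_le (by positivity) hl
  refine (sparse_bound hψ hψ' hφ hC hsq hsq' hf hg hh r1 r1' r3 r3' hl n0 n1 j).trans ?_
  calc _ ≤ 2 * ENNReal.ofReal (D * 2 ^ ((1 - δ) * j)) * (ENNReal.ofReal K *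
        (eLpNorm f q₁ volume * eLpNorm g q₂ volume * eLpNorm h q₃ volume)) := by
        refine mul_le_mul' (mul_le_mul_right (ENNReal.ofReal_le_ofReal (le_trans ?_ hlb)) _)
          (HK f g h hf hg hh)
        rw [show 2 / (1 / x₃) - 1 = 2 * x₃ - 1 by field_simp]
        gcongr
        linarith
    _ = _ := by
        rw [show 2 * D * K * 2 ^ ((1 - δ) * j) = 2 * (D * 2 ^ ((1 - δ) * j)) * K by ring,
          ENNReal.ofReal_mul (q := K) (by positivity), ENNReal.ofReal_mul (p := 2) (by norm_num),
          ENNReal.ofReal_ofNat]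
        ring

theorem triBdd_two_two_top {ψ ψ' φ : E2 → ℂ} {L C : ℝ} (hψ : IsKer ψ L) (hψ' : IsKer ψ' L)
    (hφ : IsKer φ L) (hC : 0 ≤ C) (hsq : SqBdd ψ C) (hsq' : SqBdd ψ' C) :
    TriBdd ψ ψ' φ 2 2 ⊤ := by
  have hL := hψ.nonneg
  have hpi := Real.pi_pos
  obtain ⟨K, hK, HK⟩ := dmax_rep (r := 2) (q := ⊤) (by norm_num) (by simp)
  refine ⟨(9 * Real.pi * C + 1) * (4 * L + 1) * K, 1, by positivity, one_pos,
    fun f g h hf hg hh j n0 n1 => ?_⟩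
  obtain ⟨M, F, -, hM, hMF⟩ := HK h hh
  simp only [one_div, ENNReal.inv_top, ENNReal.toReal_zero, ENNReal.rpow_zero, mul_one] at hM hMF
  have hlow : ∀ n x, lav n (fun y => ‖cv φ (n + j) h y‖ₑ) x ≤
      ENNReal.ofReal (4 * L + 1) * (ENNReal.ofReal K * eLpNorm h ⊤ volume) := fun n x => by
    have := lav_cv_le_dmax hφ (by norm_num) le_rfl n j hh.meas (mem_cube_self n x)
    refine this.trans (mul_le_mul' (ENNReal.ofReal_le_ofReal ?_) ?_)
    · norm_num
    · rw [one_div]; exact (hM x).trans hMF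
  have h2 : ∀ u : E2 → ℂ, (∫⁻ y, ‖u y‖ₑ ^ (2 : ℝ)) ^ (1 / 2 : ℝ) = eLpNorm u 2 volume := fun u => by
    rw [eLpNorm_eq_lintegral_rpow_enorm_toReal (by norm_num) (by norm_num)]; norm_num
  have hm1 : ∀ n, Measurable (lav n (fun y => ‖cv ψ (n + j) f y‖ₑ)) := fun n =>
    measurable_lav n (Nice.cv hψ _ hf).meas.enorm
  have hm2 : ∀ n, Measurable (lav n (fun y => ‖cv ψ' (n + j) g y‖ₑ)) := fun n =>
    measurable_lav n (Nice.cv hψ' _ hg).meas.enorm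
  have hcs := sum_lintegral_mul_le (Finset.Icc n0 n1) (fun n => lav n (fun y => ‖cv ψ (n + j) f y‖ₑ))
    (fun n => lav n (fun y => ‖cv ψ' (n + j) g y‖ₑ)) hm1 hm2
  have s1 := hsq.sum_lav_le hψ hf (Finset.Icc n0 n1) j
  have s2 := hsq'.sum_lav_le hψ' hg (Finset.Icc n0 n1) j
  have h12 : (0 : ℝ) ≤ 1 / 2 := by norm_num
  have hcs' : ∑ n ∈ Finset.Icc n0 n1, ∫⁻ x, lav n (fun y => ‖cv ψ (n + j) f y‖ₑ) x *
      lav n (fun y => ‖cv ψ' (n + j) g y‖ₑ) x ≤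
      ENNReal.ofReal (9 * Real.pi * C) * (eLpNorm f 2 volume * eLpNorm g 2 volume) := by
    refine hcs.trans ((mul_le_mul' (ENNReal.rpow_le_rpow s1 h12)
      (ENNReal.rpow_le_rpow s2 h12)).trans (le_of_eq ?_))
    rw [ENNReal.mul_rpow_of_nonneg _ _ h12, ENNReal.mul_rpow_of_nonneg _ _ h12, h2, h2,
      mul_mul_mul_comm, ← ENNReal.rpow_add_of_nonneg _ _ h12 h12]
    norm_num
  calc _ ≤ ∑ n ∈ Finset.Icc n0 n1, (∫⁻ x, lav n (fun y => ‖cv ψ (n + j) f y‖ₑ) x *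
        lav n (fun y => ‖cv ψ' (n + j) g y‖ₑ) x) *
        (ENNReal.ofReal (4 * L + 1) * (ENNReal.ofReal K * eLpNorm h ⊤ volume)) := by
        refine Finset.sum_le_sum fun n _ => ?_
        refine le_trans ?_ (lintegral_mul_const _ ((hm1 n).mul (hm2 n))).le
        exact lintegral_mono fun x => mul_le_mul_right (hlow n x) _
    _ ≤ (ENNReal.ofReal (9 * Real.pi * C + 1) * (eLpNorm f 2 volume * eLpNorm g 2 volume)) *
        (ENNReal.ofReal (4 * L + 1) * (ENNReal.ofReal K * eLpNorm h ⊤ volume)) := by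
        rw [← Finset.sum_mul]
        refine mul_le_mul_left (hcs'.trans (mul_le_mul_left (ENNReal.ofReal_le_ofReal ?_) _)) _
        linarith
    _ = _ := by
        simp only [sub_self, zero_mul, Real.rpow_zero, mul_one]
        rw [ENNReal.ofReal_mul (by positivity), ENNReal.ofReal_mul (by positivity)]
        ring

theorem triBdd_all {ψ ψ' φ : E2 → ℂ} {L C : ℝ} (hψ : IsKer ψ L) (hψ' : IsKer ψ' L)
    (hφ : IsKer φ L) (hC : 0 ≤ C) (hsq : SqBdd ψ C) (hsq' : SqBdd ψ' C) {q₁ q₂ q₃ : ℝ≥0∞}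
    (hq1 : 1 < q₁) (hq2 : 1 < q₂) (hq3 : 1 < q₃)
    (hq : (1 / q₁).toReal + (1 / q₂).toReal + (1 / q₃).toReal = 1) :
    TriBdd ψ ψ' φ q₁ q₂ q₃ := by
  rcases lt_or_ge 2 q₂ with h2 | h2
  · exact triBdd_of_two_lt hψ hψ' hφ hC hsq hsq' hq1 h2 hq3 hq
  rcases lt_or_ge 2 q₁ with h1 | h1
  · exact (triBdd_of_two_lt hψ' hψ hφ hC hsq' hsq hq2 h1 hq3 (by linarith)).swap₁₂
  have key : ∀ q : ℝ≥0∞, 1 < q → q ≤ 2 → 1 / 2 ≤ (1 / q).toReal ∧ ((1 / q).toReal = 1 / 2 → q = 2) := by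
    intro q h1 h2
    have hqt : q ≠ ⊤ := ne_top_of_le_ne_top (by norm_num) h2
    have h0 : 1 < q.toReal := by
      rw [← ENNReal.toReal_one]; exact (ENNReal.toReal_lt_toReal (by simp) hqt).2 h1
    have h2' : q.toReal ≤ 2 := ENNReal.toReal_mono (by norm_num) h2
    rw [one_div q, ENNReal.toReal_inv]
    refine ⟨?_, fun h => ?_⟩
    · rw [← one_div]; exact one_div_le_one_div_of_le (by linarith) h2'
    · rw [one_div, inv_inj] at h
      rw [← ENNReal.ofReal_toReal hqt, h]; simp
  obtain ⟨a1, b1⟩ := key q₁ hq1 h1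
  obtain ⟨a2, b2⟩ := key q₂ hq2 h2
  have v3 : 0 ≤ (1 / q₃).toReal := ENNReal.toReal_nonneg
  obtain rfl := b1 (by linarith)
  obtain rfl := b2 (by linarith)
  have h3 : (1 / q₃).toReal = 0 := by linarith
  have : q₃ = ⊤ := by
    rw [one_div, ENNReal.toReal_eq_zero_iff] at h3
    rcases h3 with h3 | h3
    · simpa using h3
    · exfalso; rw [ENNReal.inv_eq_top] at h3; rw [h3] at hq3; simp at hq3
  rw [this]
  exact triBdd_two_two_top hψ hψ' hφ hC hsq hsq'

open scoped FourierTransform SchwartzMap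

theorem continuous_fourier_E2 {F : E2 → ℂ} (hF : Integrable F) : Continuous (𝓕 F) :=
  VectorFourier.fourierIntegral_continuous Real.continuous_fourierChar
    (by exact continuous_inner) hF

theorem norm_fourier_le_integral (F : E2 → ℂ) (ξ : E2) : ‖𝓕 F ξ‖ ≤ ∫ x, ‖F x‖ :=
  VectorFourier.norm_fourierIntegral_le_integral_norm _ _ _ F ξ

theorem integral_fourier_mul {F G : E2 → ℂ} (hF : Integrable F) (hG : Integrable G) :
    ∫ ξ, 𝓕 F ξ * G ξ = ∫ x, F x * 𝓕 G x := by
  have h := VectorFourier.integral_fourierIntegral_smul_eq_flip (μ := (volume : Measure E2))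
    (ν := (volume : Measure E2)) (L := innerₗ E2) Real.continuous_fourierChar
    (by exact continuous_inner) hF hG
  rw [flip_innerₗ] at h
  exact h

theorem Nice.memLp {F : E2 → ℂ} (hF : Nice F) (q : ℝ≥0∞) (hq : 1 ≤ q) : MemLp F q volume := by
  obtain ⟨B, hB⟩ := hF.bdd
  have hB0 : 0 ≤ B := (norm_nonneg _).trans (hB 0)
  rcases eq_or_ne q ⊤ with rfl | hqt
  · exact memLp_top_of_bound hF.meas.aestronglyMeasurable B (Filter.Eventually.of_forall hB)
  refine ⟨hF.meas.aestronglyMeasurable, ?_⟩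
  have hq0 : q ≠ 0 := (lt_of_lt_of_le one_pos hq).ne'
  have hq1 : 1 ≤ q.toReal := by
    rw [← ENNReal.toReal_one]; exact (ENNReal.toReal_le_toReal (by simp) hqt).2 hq
  rw [eLpNorm_lt_top_iff_lintegral_rpow_enorm_lt_top hq0 hqt]
  have hx : ∀ x, ‖F x‖ₑ ^ q.toReal ≤ ENNReal.ofReal B ^ (q.toReal - 1) * ‖F x‖ₑ := by
    intro x
    have hBx : ‖F x‖ₑ ≤ ENNReal.ofReal B := by
      rw [← ofReal_norm]; exact ENNReal.ofReal_le_ofReal (hB x)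
    calc ‖F x‖ₑ ^ q.toReal = ‖F x‖ₑ ^ (q.toReal - 1) * ‖F x‖ₑ ^ (1 : ℝ) := by
          rw [← ENNReal.rpow_add_of_nonneg _ _ (by linarith) (by norm_num), sub_add_cancel]
      _ ≤ _ := by
          rw [ENNReal.rpow_one]
          exact mul_le_mul_left (ENNReal.rpow_le_rpow hBx (by linarith)) _
  refine (lintegral_mono hx).trans_lt ?_
  rw [lintegral_const_mul _ hF.meas.enorm]
  exact ENNReal.mul_lt_top (ENNReal.rpow_lt_top_of_nonneg (by linarith) ENNReal.ofReal_ne_top)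
    hF.int.2

theorem Nice.toLp_fourier {F : E2 → ℂ} (hF : Nice F) (h2 : MemLp F 2 volume) :
    (𝓕 (h2.toLp F) : Lp ℂ 2 (volume : Measure E2)) =ᵐ[volume] 𝓕 F := by
  refine ae_eq_of_integral_contDiff_smul_eq ((Lp.memLp _).locallyIntegrable (by norm_num))
    (continuous_fourier_E2 hF.int).locallyIntegrable fun g hg hgc => ?_
  have hc : HasCompactSupport fun x => (g x : ℂ) := hgc.comp_left (g := fun r : ℝ => (r : ℂ)) rfl
  have hs : ContDiff ℝ (⊤ : ℕ∞) fun x => (g x : ℂ) := ofRealCLM.contDiff.comp hg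
  set G : 𝓢(E2, ℂ) := hc.toSchwartzMap hs with hG
  have hGx : ∀ x, G x = (g x : ℂ) := fun x => rfl
  have e : Lp.toTemperedDistribution (𝓕 (h2.toLp F) : Lp ℂ 2 (volume : Measure E2)) G =
      Lp.toTemperedDistribution (h2.toLp F) (𝓕 G) := by
    rw [← Lp.fourier_toTemperedDistribution_eq]; rfl
  rw [Lp.toTemperedDistribution_apply, Lp.toTemperedDistribution_apply] at e
  have e1 : ∫ x, g x • (𝓕 (h2.toLp F) : Lp ℂ 2 (volume : Measure E2)) x =
      ∫ x, G x • (𝓕 (h2.toLp F) : Lp ℂ 2 (volume : Measure E2)) x := by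
    refine integral_congr_ae (Filter.Eventually.of_forall fun x => ?_)
    simp [hGx]
  rw [e1, e]
  have e2 : ∫ x, (𝓕 G) x • (h2.toLp F : E2 → ℂ) x = ∫ x, 𝓕 (G : E2 → ℂ) x * F x := by
    refine integral_congr_ae ?_
    filter_upwards [h2.coeFn_toLp] with x hx
    rw [hx, SchwartzMap.fourier_coe]; rfl
  rw [e2, integral_fourier_mul G.integrable hF.int]
  refine integral_congr_ae (Filter.Eventually.of_forall fun x => ?_)
  simp [hGx]

/-- Plancherel's theorem. -/
theorem Nice.eLpNorm_fourier {F : E2 → ℂ} (hF : Nice F) :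
    eLpNorm (𝓕 F) 2 volume = eLpNorm F 2 volume := by
  have h2 := hF.memLp 2 (by norm_num)
  rw [← eLpNorm_congr_ae (hF.toLp_fourier h2), ← eLpNorm_congr_ae h2.coeFn_toLp,
    ← Lp.enorm_def, ← Lp.enorm_def, ← ofReal_norm, ← ofReal_norm, Lp.norm_fourier_eq]

theorem lintegral_sq_eq (u : E2 → ℂ) :
    ∫⁻ y, ‖u y‖ₑ ^ (2 : ℝ) = eLpNorm u 2 volume ^ (2 : ℝ) := by
  rw [eLpNorm_eq_lintegral_rpow_enorm_toReal (by norm_num) (by norm_num),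
    ← ENNReal.rpow_mul]
  norm_num

theorem Nice.lintegral_sq_fourier {F : E2 → ℂ} (hF : Nice F) :
    ∫⁻ ξ, ‖𝓕 F ξ‖ₑ ^ (2 : ℝ) = ∫⁻ x, ‖F x‖ₑ ^ (2 : ℝ) := by
  rw [lintegral_sq_eq, lintegral_sq_eq, hF.eLpNorm_fourier]

theorem fourier_ker (θ : E2 → ℂ) (k : ℤ) (ξ : E2) : 𝓕 (ker θ k) ξ = 𝓕 θ (sc k • ξ) := by
  have hs := sc_pos k
  rw [Real.fourier_eq, Real.fourier_eq]
  have h := Measure.integral_comp_inv_smul_of_nonneg (volume : Measure E2)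
    (fun v => Real.fourierChar (-⟪v, sc k • ξ⟫) • θ v) hs.le
  have hfin : Module.finrank ℝ E2 = 2 := by simp [E2]
  rw [hfin] at h
  have e : ∀ v : E2, Real.fourierChar (-⟪v, ξ⟫) • ker θ k v = ((sc k ^ 2)⁻¹ : ℝ) •
      (Real.fourierChar (-⟪(sc k)⁻¹ • v, sc k • ξ⟫) • θ ((sc k)⁻¹ • v)) := by
    intro v
    rw [real_inner_smul_left, real_inner_smul_right, inv_mul_cancel_left₀ hs.ne', ker,
      Complex.real_smul, mul_smul_comm]
  simp_rw [e]
  rw [integral_smul, h, smul_smul, inv_mul_cancel₀ (by positivity), one_smul]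

theorem fourier_cv {θ : E2 → ℂ} {L : ℝ} (hθ : IsKer θ L) (k : ℤ) {f : E2 → ℂ} (hf : Nice f)
    (ξ : E2) : 𝓕 (cv θ k f) ξ = 𝓕 f ξ * 𝓕 θ (sc k • ξ) := by
  rw [← fourier_ker]
  exact Real.fourier_mul_convolution_eq hf.int (hθ.integrable_ker k) ξ

theorem IsKer.nice_ker {θ : E2 → ℂ} {L : ℝ} (h : IsKer θ L) (k : ℤ) : Nice (ker θ k) :=
  ⟨(h.continuous_ker k).measurable, h.integrable_ker k, _, h.norm_ker_le k⟩

theorem IsKer.lintegral_sq_ker_le {θ : E2 → ℂ} {L : ℝ} (h : IsKer θ L) (k : ℤ) :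
    ∫⁻ x, ‖ker θ k x‖ₑ ^ (2 : ℝ) ≤ ENNReal.ofReal ((2 * L * (sc k)⁻¹) ^ 2) := by
  have hs := sc_pos k
  have hL := h.nonneg
  calc ∫⁻ x, ‖ker θ k x‖ₑ ^ (2 : ℝ) ≤ ∫⁻ x, (Metric.closedBall (0 : E2) (sc k)).indicator
        (fun _ => ENNReal.ofReal (((sc k ^ 2)⁻¹ * L) ^ 2)) x := by
        refine lintegral_mono fun x => ?_
        by_cases hx : x ∈ Metric.closedBall (0 : E2) (sc k)
        · rw [Set.indicator_of_mem hx, ← ofReal_norm, ENNReal.ofReal_rpow_of_nonneg (norm_nonneg _)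
            (by norm_num)]
          refine ENNReal.ofReal_le_ofReal ?_
          rw [Real.rpow_two]
          exact pow_le_pow_left₀ (norm_nonneg _) (h.norm_ker_le k x) 2
        · rw [h.ker_supp k (by simpa using hx)]; simp
    _ = ENNReal.ofReal (((sc k ^ 2)⁻¹ * L) ^ 2) * ENNReal.ofReal (Real.pi * sc k ^ 2) := by
        rw [lintegral_indicator_const Metric.isClosed_closedBall.measurableSet,
          volume_closedBall_E2 _ hs.le]
    _ ≤ _ := by
        rw [← ENNReal.ofReal_mul (by positivity)]
        refine ENNReal.ofReal_le_ofReal ?_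
        have : ((sc k ^ 2)⁻¹ * L) ^ 2 * (Real.pi * sc k ^ 2) =
            Real.pi * (L * (sc k)⁻¹) ^ 2 := by field_simp
        rw [this, show (2 * L * (sc k)⁻¹) ^ 2 = 4 * (L * (sc k)⁻¹) ^ 2 by ring]
        exact mul_le_mul_of_nonneg_right Real.pi_le_four (by positivity)

theorem lintegral_mul_le_sqrt {u v : E2 → ℝ≥0∞} (hu : Measurable u) (hv : Measurable v) :
    ∫⁻ x, u x * v x ≤ (∫⁻ x, u x ^ (2 : ℝ)) ^ (1 / 2 : ℝ) * (∫⁻ x, v x ^ (2 : ℝ)) ^ (1 / 2 : ℝ) :=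
  ENNReal.lintegral_mul_le_Lp_mul_Lq volume (Real.HolderConjugate.two_two) hu.aemeasurable
    hv.aemeasurable

theorem lintegral_trilinear_le {u v w : E2 → ℝ≥0∞} (hu : Measurable u) (hv : Measurable v)
    (hw : Measurable w) : ∫⁻ p : E2 × E2, u p.1 * v p.2 * w (-p.1 - p.2) ≤
      (∫⁻ x, u x) * ((∫⁻ x, v x ^ (2 : ℝ)) ^ (1 / 2 : ℝ) * (∫⁻ x, w x ^ (2 : ℝ)) ^ (1 / 2 : ℝ)) := by
  rw [Measure.volume_eq_prod, lintegral_prod _ (by fun_prop)]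
  rw [← lintegral_mul_const _ hu]
  refine lintegral_mono fun ξ => ?_
  simp only [mul_assoc]
  rw [lintegral_const_mul _ (by fun_prop)]
  refine mul_le_mul_right ((lintegral_mul_le_sqrt hv (by fun_prop)).trans (le_of_eq ?_)) _
  rw [lintegral_sub_left_eq_self (μ := (volume : Measure E2)) (fun x => w x ^ (2 : ℝ)) (-ξ)]

theorem sqrt_lintegral_fourier {F : E2 → ℂ} (hF : Nice F) :
    (∫⁻ ξ, ‖𝓕 F ξ‖ₑ ^ (2 : ℝ)) ^ (1 / 2 : ℝ) = eLpNorm F 2 volume := by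
  rw [lintegral_sq_eq, hF.eLpNorm_fourier, ← ENNReal.rpow_mul]; norm_num

theorem Nice.measurable_fourier {F : E2 → ℂ} (hF : Nice F) : Measurable (𝓕 F) :=
  (continuous_fourier_E2 hF.int).measurable

theorem lintegral_fourier_trilinear_le {φ : E2 → ℂ} {L : ℝ} (hφ : IsKer φ L) (k : ℤ)
    {F G H : E2 → ℂ} (hF : Nice F) (hG : Nice G) (hH : Nice H) :
    ∫⁻ p : E2 × E2, ‖𝓕 (cv φ k F) p.1‖ₑ * ‖𝓕 G p.2‖ₑ * ‖𝓕 H (-p.1 - p.2)‖ₑ ≤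
      ENNReal.ofReal (2 * L * (sc k)⁻¹) *
        (eLpNorm F 2 volume * eLpNorm G 2 volume * eLpNorm H 2 volume) := by
  have hs := sc_pos k
  have hL := hφ.nonneg
  refine (lintegral_trilinear_le (u := fun ξ => ‖𝓕 (cv φ k F) ξ‖ₑ) (v := fun ξ => ‖𝓕 G ξ‖ₑ)
    (w := fun ξ => ‖𝓕 H ξ‖ₑ) (hF.cv hφ k).measurable_fourier.enorm hG.measurable_fourier.enorm
    hH.measurable_fourier.enorm).trans ?_
  rw [sqrt_lintegral_fourier hG, sqrt_lintegral_fourier hH]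
  have h1 : ∫⁻ ξ, ‖𝓕 (cv φ k F) ξ‖ₑ ≤ ENNReal.ofReal (2 * L * (sc k)⁻¹) * eLpNorm F 2 volume := by
    have e : ∀ ξ, ‖𝓕 (cv φ k F) ξ‖ₑ = ‖𝓕 (ker φ k) ξ‖ₑ * ‖𝓕 F ξ‖ₑ := fun ξ => by
      rw [fourier_cv hφ k hF, fourier_ker, enorm_mul, mul_comm]
    simp_rw [e]
    refine (lintegral_mul_le_sqrt (hφ.nice_ker k).measurable_fourier.enorm
      hF.measurable_fourier.enorm).trans ?_
    rw [sqrt_lintegral_fourier hF, (hφ.nice_ker k).lintegral_sq_fourier]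
    refine mul_le_mul_left ((ENNReal.rpow_le_rpow (hφ.lintegral_sq_ker_le k)
      (by norm_num)).trans (le_of_eq ?_)) _
    rw [ENNReal.ofReal_rpow_of_nonneg (by positivity) (by norm_num), ← Real.sqrt_eq_rpow,
      Real.sqrt_sq (by positivity)]
  refine (mul_le_mul_left h1 _).trans (le_of_eq (by ring))

theorem summable_quarter_natAbs : Summable fun i : ℤ => (1 / 4 : ℝ) ^ i.natAbs := by
  refine Summable.of_nat_of_neg ?_ ?_ <;> simp only [Int.natAbs_neg, Int.natAbs_natCast] <;>
    exact summable_geometric_of_lt_one (by norm_num) (by norm_num)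

theorem min_sq_le {r : ℝ} {n : ℤ} (hn1 : (2 : ℝ) ^ n ≤ r) (hn2 : r < (2 : ℝ) ^ (n + 1)) (k : ℤ) :
    min (sc k * r) ((sc k * r)⁻¹) ^ 2 ≤ 4 * (1 / 4 : ℝ) ^ (k - n).natAbs := by
  have hr : 0 < r := lt_of_lt_of_le (by positivity) hn1
  have hs := sc_pos k
  have h4 : (4 : ℝ) * (1 / 4 : ℝ) ^ (k - n).natAbs = (2 * (1 / 2 : ℝ) ^ (k - n).natAbs) ^ 2 := by
    rw [mul_pow, ← pow_mul, mul_comm _ 2, pow_mul]; norm_num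
  rw [h4]
  refine pow_le_pow_left₀ (by positivity) ?_ 2
  rcases le_total n k with h | h
  · obtain ⟨i, rfl⟩ := Int.le.dest h
    refine (min_le_left _ _).trans ?_
    have : sc (n + i) = (2 : ℝ) ^ (-n) * (1 / 2) ^ i := by
      unfold sc
      rw [neg_add, zpow_add₀ (by norm_num), zpow_neg _ (i : ℤ), zpow_natCast, one_div, inv_pow]
    rw [this, add_sub_cancel_left, Int.natAbs_natCast]
    calc (2 : ℝ) ^ (-n) * (1 / 2) ^ i * r ≤ (2 : ℝ) ^ (-n) * (1 / 2) ^ i * 2 ^ (n + 1) := by gcongr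
      _ = ((2 : ℝ) ^ (-n) * 2 ^ (n + 1)) * (1 / 2) ^ i := by ring
      _ = _ := by rw [← zpow_add₀ (by norm_num)]; simp
  · obtain ⟨i, rfl⟩ := Int.le.dest h
    refine (min_le_right _ _).trans ?_
    have : sc k = (2 : ℝ) ^ (-(k + i)) * 2 ^ i := by
      unfold sc
      rw [← zpow_natCast, ← zpow_add₀ (by norm_num)]; congr 1; ring
    have h2 : (2 : ℝ) ^ i ≤ sc k * r := by
      calc (2 : ℝ) ^ i = (2 : ℝ) ^ (-(k + i)) * 2 ^ i * 2 ^ (k + i) := by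
            rw [mul_right_comm, ← zpow_add₀ (by norm_num)]; simp
        _ ≤ _ := by rw [this]; gcongr
    rw [sub_add_cancel_left, Int.natAbs_neg, Int.natAbs_natCast]
    calc (sc k * r)⁻¹ ≤ ((2 : ℝ) ^ i)⁻¹ := inv_anti₀ (by positivity) h2
      _ = 1 * (1 / 2) ^ i := by rw [one_div, inv_pow, one_mul]
      _ ≤ _ := by gcongr; norm_num

theorem sum_min_sq_le {r : ℝ} (hr : 0 < r) (s : Finset ℤ) :
    ∑ k ∈ s, min (sc k * r) ((sc k * r)⁻¹) ^ 2 ≤ 4 * ∑' i : ℤ, (1 / 4 : ℝ) ^ i.natAbs := by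
  obtain ⟨n, hn1, hn2⟩ := exists_mem_Ico_zpow (y := (2 : ℝ)) hr (by norm_num)
  refine (Finset.sum_le_sum fun k _ => min_sq_le hn1 hn2 k).trans ?_
  rw [← Finset.mul_sum]
  have hsm : Summable ((fun i : ℤ => (1 / 4 : ℝ) ^ i.natAbs) ∘ Equiv.subRight n) :=
    (Equiv.summable_iff _).2 summable_quarter_natAbs
  have hle := hsm.sum_le_tsum s fun i _ => by simp only [Function.comp_apply]; positivity
  have heq := (Equiv.subRight n).tsum_eq fun i : ℤ => (1 / 4 : ℝ) ^ i.natAbs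
  simp only [Function.comp_apply] at hle
  rw [heq] at hle
  simp only [Equiv.subRight_apply] at hle
  linarith

theorem sqBdd_of_fourier {θ : E2 → ℂ} {L D : ℝ} (hθ : IsKer θ L)
    (h : ∀ ξ, ξ ≠ 0 → ‖𝓕 θ ξ‖ ≤ D * min ‖ξ‖ ‖ξ‖⁻¹) :
    SqBdd θ (D ^ 2 * (4 * ∑' i : ℤ, (1 / 4 : ℝ) ^ i.natAbs)) := by
  intro F hF s
  have e : ∀ k, ∫⁻ x, ‖cv θ k F x‖ₑ ^ (2 : ℝ) =
      ∫⁻ ξ, ‖𝓕 θ (sc k • ξ)‖ₑ ^ (2 : ℝ) * ‖𝓕 F ξ‖ₑ ^ (2 : ℝ) := by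
    intro k
    rw [← (hF.cv hθ k).lintegral_sq_fourier]
    refine lintegral_congr fun ξ => ?_
    rw [fourier_cv hθ k hF, enorm_mul, mul_comm, ENNReal.mul_rpow_of_nonneg _ _ (by norm_num)]
  have hm : ∀ k, Measurable fun ξ : E2 => ‖𝓕 θ (sc k • ξ)‖ₑ ^ (2 : ℝ) := by
    intro k
    have := (hθ.nice_ker k).measurable_fourier
    simp only [← fourier_ker]
    fun_prop
  have hF' := hF.measurable_fourier
  simp_rw [e]
  have hm2 : ∀ k, Measurable fun ξ : E2 => ‖𝓕 θ (sc k • ξ)‖ₑ ^ (2 : ℝ) * ‖𝓕 F ξ‖ₑ ^ (2 : ℝ) :=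
    fun k => (hm k).mul (by fun_prop)
  rw [← lintegral_finsetSum _ fun k _ => hm2 k, ← hF.lintegral_sq_fourier,
    ← lintegral_const_mul _ (by fun_prop)]
  refine lintegral_mono_ae ?_
  have h0 : ∀ᵐ ξ : E2, ξ ≠ 0 := by
    rw [ae_iff]; simp
  filter_upwards [h0] with ξ hξ
  rw [← Finset.sum_mul]
  refine mul_le_mul_left ?_ _
  have hr : 0 < ‖ξ‖ := norm_pos_iff.2 hξ
  calc ∑ k ∈ s, ‖𝓕 θ (sc k • ξ)‖ₑ ^ (2 : ℝ)
      ≤ ∑ k ∈ s, ENNReal.ofReal (D ^ 2 * min (sc k * ‖ξ‖) ((sc k * ‖ξ‖)⁻¹) ^ 2) := by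
        refine Finset.sum_le_sum fun k _ => ?_
        have hs := sc_pos k
        rw [← ofReal_norm, ENNReal.ofReal_rpow_of_nonneg (norm_nonneg _) (by norm_num)]
        refine ENNReal.ofReal_le_ofReal ?_
        rw [Real.rpow_two, ← mul_pow]
        refine pow_le_pow_left₀ (norm_nonneg _) ((h _ (smul_ne_zero hs.ne' hξ)).trans_eq ?_) 2
        rw [norm_smul, Real.norm_of_nonneg hs.le]
    _ = ENNReal.ofReal (∑ k ∈ s, D ^ 2 * min (sc k * ‖ξ‖) ((sc k * ‖ξ‖)⁻¹) ^ 2) :=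
        (ENNReal.ofReal_sum_of_nonneg fun k _ => by positivity).symm
    _ ≤ _ := by
        refine ENNReal.ofReal_le_ofReal ?_
        rw [← Finset.mul_sum]
        exact mul_le_mul_of_nonneg_left (sum_min_sq_le hr s) (by positivity)

/-- The character `x ↦ exp (2 π i x)`. -/
def ch (x : ℝ) : ℂ := (Real.fourierChar x : ℂ)

theorem ch_add (x y : ℝ) : ch (x + y) = ch x * ch y := by
  simp [ch, AddChar.map_add_eq_mul]

@[simp] theorem norm_ch (x : ℝ) : ‖ch x‖ = 1 := Circle.norm_coe _

@[fun_prop] theorem continuous_ch : Continuous ch :=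
  continuous_subtype_val.comp Real.continuous_fourierChar

theorem fourier_eq_ch (F : E2 → ℂ) (ξ : E2) : 𝓕 F ξ = ∫ v, ch (-⟪v, ξ⟫) * F v := by
  rw [Real.fourier_eq]; rfl

/-- A bump on the unit ball with value `1` at the origin. -/
def smbBump : ContDiffBump (0 : E2) := ⟨1 / 2, 1, by norm_num, by norm_num⟩

theorem smb_hasCompactSupport : HasCompactSupport fun x : E2 => ((smbBump x : ℝ) : ℂ) :=
  smbBump.hasCompactSupport.comp_left (g := fun r : ℝ => (r : ℂ)) rfl

/-- A bump on the unit ball, as a Schwartz function. -/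
def smb : 𝓢(E2, ℂ) :=
  smb_hasCompactSupport.toSchwartzMap (ofRealCLM.contDiff.comp smbBump.contDiff)

theorem smb_apply (x : E2) : smb x = ((smbBump x : ℝ) : ℂ) := rfl

theorem smb_zero : smb 0 = 1 := by
  rw [smb_apply, smbBump.one_of_mem_closedBall (by simp [smbBump])]; simp

theorem smb_of_one_le {x : E2} (hx : 1 ≤ ‖x‖) : smb x = 0 := by
  rw [smb_apply, smbBump.zero_of_le_dist (by simpa [smbBump] using hx)]; simp

theorem norm_smb_le (x : E2) : ‖smb x‖ ≤ 1 := by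
  rw [smb_apply, Complex.norm_real, Real.norm_of_nonneg smbBump.nonneg]
  exact smbBump.le_one

theorem smb_neg (x : E2) : smb (-x) = smb x := by
  rw [smb_apply, smb_apply, smbBump.neg]

/-- The inverse Fourier transform of the bump. -/
def smk : 𝓢(E2, ℂ) := 𝓕⁻ smb

theorem fourier_smk (x : E2) : 𝓕 (smk : E2 → ℂ) x = smb x := by
  rw [← SchwartzMap.fourier_coe, smk, FourierTransform.fourier_fourierInv_eq]

theorem smk_neg (u : E2) : smk (-u) = smk u := by
  have h : ∀ u, smk u = ∫ v, ch ⟪v, u⟫ * smb v := by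
    intro u
    rw [smk, SchwartzMap.fourierInv_coe, Real.fourierInv_eq]; rfl
  rw [h, h, ← integral_neg_eq_self]
  simp [smb_neg]

theorem integral_smk : ∫ u, smk u = 1 := by
  have h := fourier_smk 0
  rw [fourier_eq_ch, smb_zero] at h
  simpa [ch] using h

/-- The four-dimensional smoothing kernel. -/
def smk2 (w : E2 × E2) : ℂ := smk w.1 * smk w.2

theorem continuous_smk2 : Continuous smk2 := by
  have := smk.continuous
  unfold smk2; fun_prop

theorem integrable_smk2 : Integrable smk2 := smk.integrable.mul_prod smk.integrable

theorem integral_smk2 : ∫ w, smk2 w = 1 := by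
  unfold smk2
  rw [Measure.volume_eq_prod, integral_prod_mul, integral_smk, one_mul]

theorem smk2_neg (w : E2 × E2) : smk2 (-w) = smk2 w := by
  simp [smk2, smk_neg]

theorem integrable_smk2_sq : Integrable fun w : E2 × E2 => ‖smk2 w‖ * ‖w‖ ^ 2 := by
  have h1 : Integrable fun u : E2 => ‖u‖ ^ 2 * ‖smk u‖ := smk.integrable_pow_mul volume 2
  have h0 := smk.integrable.norm (μ := volume)
  have h := (h1.mul_prod h0).add (h0.mul_prod h1)
  refine h.mono' ((continuous_smk2.norm.mul (continuous_norm.pow 2)).aestronglyMeasurable)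
    (Filter.Eventually.of_forall fun w => ?_)
  rw [Real.norm_of_nonneg (by positivity), smk2, norm_mul]
  have : ‖w‖ ^ 2 ≤ ‖w.1‖ ^ 2 + ‖w.2‖ ^ 2 := by
    rw [Prod.norm_def]
    rcases max_cases ‖w.1‖ ‖w.2‖ with ⟨e, _⟩ | ⟨e, _⟩ <;> rw [e] <;> nlinarith [sq_nonneg ‖w.1‖, sq_nonneg ‖w.2‖]
  calc ‖smk w.1‖ * ‖smk w.2‖ * ‖w‖ ^ 2
      ≤ ‖smk w.1‖ * ‖smk w.2‖ * (‖w.1‖ ^ 2 + ‖w.2‖ ^ 2) := by gcongr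
    _ = _ := by simp only [Pi.add_apply]; ring

/-- Spatial localization of `F` at scale `r⁻¹` around `c`. -/
def loc (r : ℝ) (c : E2) (F : E2 → ℂ) (a : E2) : ℂ := F a * smb (r • (a - c))

theorem fourier_loc {F : E2 → ℂ} (hF : Integrable F) (r : ℝ) (c ξ : E2) :
    𝓕 (loc r c F) ξ = ∫ u, smk u * (ch (r * ⟪u, c⟫) * 𝓕 F (ξ + r • u)) := by
  have e : ∀ u, smk u * (ch (r * ⟪u, c⟫) * 𝓕 F (ξ + r • u)) =
      ∫ a, smk u * (ch (r * ⟪u, c⟫) * (ch (-⟪a, ξ + r • u⟫) * F a)) := by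
    intro u
    rw [integral_const_mul, integral_const_mul, ← fourier_eq_ch]
  simp_rw [e]
  rw [integral_integral_swap, fourier_eq_ch]
  · refine integral_congr_ae (Filter.Eventually.of_forall fun a => ?_)
    simp only [loc]
    rw [← fourier_smk, fourier_eq_ch, ← integral_const_mul, ← integral_const_mul]
    refine integral_congr_ae (Filter.Eventually.of_forall fun u => ?_)
    simp only
    have h1 : ch (r * ⟪u, c⟫) * ch (-⟪a, ξ + r • u⟫) = ch (-⟪a, ξ⟫) * ch (-⟪u, r • (a - c)⟫) := by
      rw [← ch_add, ← ch_add]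
      congr 1
      rw [inner_add_right, real_inner_smul_right, real_inner_smul_right, inner_sub_right,
        real_inner_comm u a]
      ring
    linear_combination (-(smk u * F a)) * h1
  · have hi : Integrable (fun q : E2 × E2 => smk q.1 * F q.2) (volume.prod volume) :=
      smk.integrable.mul_prod hF
    refine hi.norm.mono' ?_ (Filter.Eventually.of_forall fun q => ?_)
    · have h2 : Continuous fun q : E2 × E2 => ch (r * ⟪q.1, c⟫) * ch (-⟪q.2, ξ + r • q.1⟫) := by
        fun_prop
      refine (h2.aestronglyMeasurable.mul hi.aestronglyMeasurable).congr
        (Filter.Eventually.of_forall fun q => ?_)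
      simp only [Pi.mul_apply, Function.uncurry]; ring
    · simp [Function.uncurry]

/-- The frequency side of the trilinear form. -/
def tri (F G H : E2 → ℂ) (p : E2 × E2) : ℂ := 𝓕 F p.1 * 𝓕 G p.2 * 𝓕 H (-p.1 - p.2)

theorem continuous_tri {F G H : E2 → ℂ} (hF : Integrable F) (hG : Integrable G)
    (hH : Integrable H) : Continuous (tri F G H) := by
  have h1 := continuous_fourier_E2 hF
  have h2 := continuous_fourier_E2 hG
  have h3 := continuous_fourier_E2 hH
  unfold tri; fun_prop

theorem norm_tri_le (F G H : E2 → ℂ) (p : E2 × E2) :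
    ‖tri F G H p‖ ≤ (∫ x, ‖F x‖) * (∫ x, ‖G x‖) * ∫ x, ‖H x‖ := by
  unfold tri
  rw [norm_mul, norm_mul]
  gcongr <;> exact norm_fourier_le_integral _ _

theorem integrable_mul_mul_bdd {α β : Type*} [MeasurableSpace α] [MeasurableSpace β]
    {μ : Measure α} {ν : Measure β} [SFinite μ] [SFinite ν] {a : α → ℂ} {b : β → ℂ}
    {d : α × β → ℂ} {B : ℝ} (ha : Integrable a μ) (hb : Integrable b ν)
    (hd : AEStronglyMeasurable d (μ.prod ν)) (hB : ∀ q, ‖d q‖ ≤ B) :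
    Integrable (fun q : α × β => a q.1 * b q.2 * d q) (μ.prod ν) :=
  (ha.mul_prod hb).mul_bdd hd (Filter.Eventually.of_forall hB)

theorem integral_loc {F G H : E2 → ℂ} (hF : Integrable F) (hG : Integrable G)
    (hH : Integrable H) (r : ℝ) (p : E2 × E2) :
    ∫ c, H c * (ch ⟪p.1 + p.2, c⟫ * 𝓕 (loc r c F) p.1 * 𝓕 (loc r c G) p.2) =
      ∫ w : E2 × E2, smk2 w * tri F G H (p + r • w) := by
  have cF := continuous_fourier_E2 hF
  have cG := continuous_fourier_E2 hG
  have e : ∀ c, H c * (ch ⟪p.1 + p.2, c⟫ * 𝓕 (loc r c F) p.1 * 𝓕 (loc r c G) p.2) =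
      ∫ w : E2 × E2, H c * smk2 w * (ch (⟪p.1 + p.2 + r • (w.1 + w.2), c⟫) *
        (𝓕 F (p.1 + r • w.1) * 𝓕 G (p.2 + r • w.2))) := by
    intro c
    rw [fourier_loc hF, fourier_loc hG, mul_assoc (ch _), ← integral_prod_mul,
      ← integral_const_mul, ← integral_const_mul, Measure.volume_eq_prod]
    refine integral_congr_ae (Filter.Eventually.of_forall fun w => ?_)
    simp only [smk2]
    have h : ⟪p.1 + p.2 + r • (w.1 + w.2), c⟫ =
        ⟪p.1 + p.2, c⟫ + (r * ⟪w.1, c⟫ + r * ⟪w.2, c⟫) := by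
      rw [inner_add_left (p.1 + p.2), real_inner_smul_left, inner_add_left w.1, mul_add]
    rw [h, ch_add, ch_add]
    ring
  simp_rw [e]
  rw [integral_integral_swap]
  · refine integral_congr_ae (Filter.Eventually.of_forall fun w => ?_)
    simp only [tri]
    have : 𝓕 H (-(p + r • w).1 - (p + r • w).2) =
        ∫ c, ch (⟪p.1 + p.2 + r • (w.1 + w.2), c⟫) * H c := by
      rw [fourier_eq_ch]
      refine integral_congr_ae (Filter.Eventually.of_forall fun c => ?_)
      simp only
      congr 2
      rw [← inner_neg_right, real_inner_comm]
      congr 1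
      simp only [Prod.fst_add, Prod.snd_add, Prod.smul_fst, Prod.smul_snd, smul_add]
      abel
    rw [this, ← integral_const_mul, ← integral_const_mul]
    refine integral_congr_ae (Filter.Eventually.of_forall fun c => ?_)
    simp only [Prod.fst_add, Prod.snd_add, Prod.smul_fst, Prod.smul_snd]
    ring
  · refine integrable_mul_mul_bdd (B := (∫ x, ‖F x‖) * ∫ x, ‖G x‖) hH integrable_smk2
      (d := fun q : E2 × (E2 × E2) => ch (⟪p.1 + p.2 + r • (q.2.1 + q.2.2), q.1⟫) *
        (𝓕 F (p.1 + r • q.2.1) * 𝓕 G (p.2 + r • q.2.2))) ?_ fun q => ?_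
    · refine Continuous.aestronglyMeasurable ?_
      fun_prop
    · rw [norm_mul, norm_ch, one_mul, norm_mul]
      gcongr <;> exact norm_fourier_le_integral _ _

theorem norm_loc_le (r : ℝ) (c : E2) (F : E2 → ℂ) (a : E2) : ‖loc r c F a‖ ≤ ‖F a‖ := by
  unfold loc
  rw [norm_mul]
  exact mul_le_of_le_one_right (norm_nonneg _) (norm_smb_le _)

theorem norm_fourier_loc_le {F : E2 → ℂ} (hF : Integrable F) (r : ℝ) (c ξ : E2) :
    ‖𝓕 (loc r c F) ξ‖ ≤ ∫ x, ‖F x‖ := by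
  refine (norm_fourier_le_integral _ _).trans (integral_mono_of_nonneg
    (Filter.Eventually.of_forall fun _ => norm_nonneg _) hF.norm
    (Filter.Eventually.of_forall fun a => norm_loc_le r c F a))

theorem measurable_fourier_loc {F : E2 → ℂ} (hF : Measurable F) (r : ℝ) :
    Measurable fun q : E2 × E2 => 𝓕 (loc r q.1 F) q.2 := by
  simp_rw [fourier_eq_ch, loc]
  have hs := smb.continuous
  have h : Measurable fun z : (E2 × E2) × E2 =>
      ch (-⟪z.2, z.1.2⟫) * (F z.2 * smb (r • (z.2 - z.1.1))) :=
    (by fun_prop : Continuous fun z : (E2 × E2) × E2 => ch (-⟪z.2, z.1.2⟫)).measurable.mul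
      ((hF.comp measurable_snd).mul
        (by fun_prop : Continuous fun z : (E2 × E2) × E2 => smb (r • (z.2 - z.1.1))).measurable)
  exact (StronglyMeasurable.integral_prod_right (ν := (volume : Measure E2))
    h.stronglyMeasurable).measurable

/-- The localized bilinear operator with symbol `M`. -/
def locOp (M : E2 × E2 → ℂ) (r : ℝ) (F G : E2 → ℂ) (c : E2) : ℂ :=
  ∫ p : E2 × E2, M p * (ch ⟪p.1 + p.2, c⟫ * 𝓕 (loc r c F) p.1 * 𝓕 (loc r c G) p.2)

theorem measurable_locOp_integrand {M : E2 × E2 → ℂ} (hM : Measurable M) {F G : E2 → ℂ}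
    (hF : Nice F) (hG : Nice G) (r : ℝ) : Measurable fun q : E2 × (E2 × E2) =>
      M q.2 * (ch ⟪q.2.1 + q.2.2, q.1⟫ * 𝓕 (loc r q.1 F) q.2.1 * 𝓕 (loc r q.1 G) q.2.2) := by
  have h1 := (measurable_fourier_loc hF.meas r).comp
    (by fun_prop : Measurable fun q : E2 × (E2 × E2) => (q.1, q.2.1))
  have h2 := (measurable_fourier_loc hG.meas r).comp
    (by fun_prop : Measurable fun q : E2 × (E2 × E2) => (q.1, q.2.2))
  have h3 : Measurable fun q : E2 × (E2 × E2) => ch ⟪q.2.1 + q.2.2, q.1⟫ :=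
    (by fun_prop : Continuous fun q : E2 × (E2 × E2) => ch ⟪q.2.1 + q.2.2, q.1⟫).measurable
  exact (hM.comp measurable_snd).mul ((h3.mul h1).mul h2)

theorem measurable_locOp {M : E2 × E2 → ℂ} (hM : Measurable M) {F G : E2 → ℂ}
    (hF : Nice F) (hG : Nice G) (r : ℝ) : Measurable (locOp M r F G) :=
  (StronglyMeasurable.integral_prod_right (ν := (volume : Measure (E2 × E2)))
    (measurable_locOp_integrand hM hF hG r).stronglyMeasurable).measurable

theorem norm_locOp_le {M : E2 × E2 → ℂ} (hM : Integrable M) {F G : E2 → ℂ} (hF : Nice F)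
    (hG : Nice G) (r : ℝ) (c : E2) :
    ‖locOp M r F G c‖ ≤ (∫ p, ‖M p‖) * ((∫ x, ‖F x‖) * ∫ x, ‖G x‖) := by
  unfold locOp
  refine (norm_integral_le_integral_norm _).trans ?_
  rw [← integral_mul_const]
  refine integral_mono_of_nonneg (Filter.Eventually.of_forall fun _ => norm_nonneg _)
    (hM.norm.mul_const _) (Filter.Eventually.of_forall fun p => ?_)
  simp only [norm_mul, norm_ch, one_mul]
  gcongr
  · exact norm_fourier_loc_le hF.int _ _ _
  · exact norm_fourier_loc_le hG.int _ _ _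

theorem integral_mul_locOp {M : E2 × E2 → ℂ} (hMm : Measurable M) (hMi : Integrable M) {B : ℝ}
    (hMB : ∀ p, ‖M p‖ ≤ B) {F G H : E2 → ℂ} (hF : Nice F) (hG : Nice G) (hH : Nice H)
    (htri : Integrable (tri F G H)) (r : ℝ) :
    ∫ c, H c * locOp M r F G c =
      ∫ q, tri F G H q * ∫ w : E2 × E2, smk2 w * M (q - r • w) := by
  have s1 : ∫ c, H c * locOp M r F G c = ∫ p : E2 × E2, M p *
      ∫ c, H c * (ch ⟪p.1 + p.2, c⟫ * 𝓕 (loc r c F) p.1 * 𝓕 (loc r c G) p.2) := by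
    simp_rw [locOp, ← integral_const_mul]
    rw [integral_integral_swap]
    · refine integral_congr_ae (Filter.Eventually.of_forall fun p => ?_)
      refine integral_congr_ae (Filter.Eventually.of_forall fun c => ?_)
      simp only; ring
    · have h := integrable_mul_mul_bdd (B := (∫ x, ‖F x‖) * ∫ x, ‖G x‖) hH.int hMi
        (d := fun q : E2 × (E2 × E2) =>
          ch ⟪q.2.1 + q.2.2, q.1⟫ * 𝓕 (loc r q.1 F) q.2.1 * 𝓕 (loc r q.1 G) q.2.2) ?_ fun q => ?_
      · refine h.congr (Filter.Eventually.of_forall fun q => ?_)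
        simp only [Function.uncurry]; ring
      · have := measurable_locOp_integrand (M := fun _ => 1) measurable_const hF hG r
        simp only [one_mul] at this
        exact this.aestronglyMeasurable
      · rw [norm_mul, norm_mul, norm_ch, one_mul]
        gcongr
        · exact norm_fourier_loc_le hF.int _ _ _
        · exact norm_fourier_loc_le hG.int _ _ _
  have cT := continuous_tri hF.int hG.int hH.int
  rw [s1]
  simp_rw [integral_loc hF.int hG.int hH.int, ← integral_const_mul]
  rw [integral_integral_swap]
  · have s2 : ∀ w : E2 × E2, ∫ p, M p * (smk2 w * tri F G H (p + r • w)) =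
        ∫ q, tri F G H q * (smk2 w * M (q - r • w)) := by
      intro w
      have : (volume : Measure (E2 × E2)).IsAddRightInvariant := by
        rw [Measure.volume_eq_prod]; infer_instance
      rw [← integral_sub_right_eq_self (fun p => M p * (smk2 w * tri F G H (p + r • w))) (r • w)]
      refine integral_congr_ae (Filter.Eventually.of_forall fun q => ?_)
      simp only [sub_add_cancel]; ring
    simp_rw [s2]
    rw [integral_integral_swap]
    have h := integrable_mul_mul_bdd (B := B) integrable_smk2 htri
      (d := fun q : (E2 × E2) × (E2 × E2) => M (q.2 - r • q.1))
      (hMm.comp (by fun_prop)).aestronglyMeasurable fun q => hMB _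
    refine h.congr (Filter.Eventually.of_forall fun q => ?_)
    simp only [Function.uncurry]; ring
  · have h := integrable_mul_mul_bdd hMi integrable_smk2
      (d := fun q : (E2 × E2) × (E2 × E2) => tri F G H (q.1 + r • q.2))
      (by fun_prop : Continuous fun q : (E2 × E2) × (E2 × E2) =>
        tri F G H (q.1 + r • q.2)).aestronglyMeasurable fun q => norm_tri_le F G H _
    refine h.congr (Filter.Eventually.of_forall fun q => ?_)
    simp only [Function.uncurry]; ring

section

/-- Bounded compactly supported symbols with bounded second differences off the axes. -/
structure Symb (N : E2 × E2 → ℂ) (B : ℝ) : Prop where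
  meas : Measurable N
  bdd : ∀ p, ‖N p‖ ≤ B
  supp : ∀ p, 4 < ‖p‖ → N p = 0
  diff : ∀ p : E2 × E2, p.1 ≠ 0 → p.2 ≠ 0 → ∀ᵐ y : E2 × E2, ∀ ε : ℝ,
    ‖N (p - ε • y) + N (p + ε • y) - 2 * N p‖ ≤ B * ε ^ 2 * ‖y‖ ^ 2

/-- The second moment of the smoothing kernel. -/
def smMom : ℝ := ∫ w : E2 × E2, ‖smk2 w‖ * ‖w‖ ^ 2

theorem smMom_nonneg : 0 ≤ smMom := integral_nonneg fun _ => by positivity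

variable {N : E2 × E2 → ℂ} {B : ℝ}

theorem Symb.nonneg (h : Symb N B) : 0 ≤ B := (norm_nonneg _).trans (h.bdd 0)

theorem Symb.norm_smooth_sub_le (h : Symb N B) {p : E2 × E2} (h1 : p.1 ≠ 0) (h2 : p.2 ≠ 0) (ε : ℝ) :
    ‖(∫ w, smk2 w * N (p - ε • w)) - N p‖ ≤ B * ε ^ 2 * smMom := by
  have hB := h.nonneg
  have i1 : Integrable fun w => smk2 w * N (p - ε • w) :=
    integrable_smk2.mul_bdd (h.meas.comp (by fun_prop)).aestronglyMeasurable
      (Filter.Eventually.of_forall fun w => h.bdd _)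
  have i2 : Integrable fun w => smk2 w * N (p + ε • w) :=
    integrable_smk2.mul_bdd (h.meas.comp (by fun_prop)).aestronglyMeasurable
      (Filter.Eventually.of_forall fun w => h.bdd _)
  have : (volume : Measure (E2 × E2)).IsNegInvariant := by
    have : (volume : Measure (E2 × E2)).IsAddHaarMeasure := by
      rw [Measure.volume_eq_prod]; infer_instance
    exact Measure.IsAddHaarMeasure.isNegInvariant_of_regular (volume : Measure (E2 × E2))
  have e1 : ∫ w, smk2 w * N (p + ε • w) = ∫ w, smk2 w * N (p - ε • w) := by
    rw [← integral_neg_eq_self]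
    simp [smk2_neg, sub_eq_add_neg]
  have e2 : 2 * ((∫ w, smk2 w * N (p - ε • w)) - N p) =
      ∫ w, smk2 w * (N (p - ε • w) + N (p + ε • w) - 2 * N p) := by
    have : ∀ w, smk2 w * (N (p - ε • w) + N (p + ε • w) - 2 * N p) =
        (smk2 w * N (p - ε • w) + smk2 w * N (p + ε • w)) - smk2 w * (2 * N p) := fun w => by ring
    simp_rw [this]
    rw [integral_sub (f := fun w => smk2 w * N (p - ε • w) + smk2 w * N (p + ε • w)) (i1.add i2)
      (integrable_smk2.mul_const _), integral_add i1 i2, e1, integral_mul_const, integral_smk2]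
    ring
  have h3 : ‖2 * ((∫ w, smk2 w * N (p - ε • w)) - N p)‖ ≤ B * ε ^ 2 * smMom := by
    rw [e2, smMom, ← integral_const_mul]
    refine norm_integral_le_of_norm_le (integrable_smk2_sq.const_mul _) ?_
    filter_upwards [h.diff p h1 h2] with w hw
    rw [norm_mul]
    calc ‖smk2 w‖ * ‖N (p - ε • w) + N (p + ε • w) - 2 * N p‖
        ≤ ‖smk2 w‖ * (B * ε ^ 2 * ‖w‖ ^ 2) := by gcongr; exact hw ε
      _ = _ := by ring
  rw [norm_mul] at h3
  have : ‖(2 : ℂ)‖ = 2 := by simp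
  nlinarith [norm_nonneg ((∫ w, smk2 w * N (p - ε • w)) - N p)]

theorem Symb.integrable_dilate (h : Symb N B) (k : ℤ) : Integrable fun p => N (sc k • p) := by
  have hs := sc_pos k
  have hm : Measurable fun p => N (sc k • p) := h.meas.comp (by fun_prop)
  refine Measure.integrableOn_of_bounded (s := Metric.closedBall 0 (4 * (sc k)⁻¹)) (M := B)
    ((isCompact_closedBall _ _).measure_lt_top.ne) hm.aestronglyMeasurable
    (Filter.Eventually.of_forall fun p => h.bdd _) |>.integrable_of_forall_notMem_eq_zero ?_
  intro p hp
  refine h.supp _ ?_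
  rw [mem_closedBall_zero_iff, not_le] at hp
  rw [norm_smul, Real.norm_of_nonneg hs.le]
  calc (4 : ℝ) = sc k * (4 * (sc k)⁻¹) := by field_simp
    _ < _ := by gcongr

theorem ae_axes {t : ℝ} (ht : t ≠ 0) : ∀ᵐ q : E2 × E2, (t • q).1 ≠ 0 ∧ (t • q).2 ≠ 0 := by
  have h0 : ∀ᵐ x : E2, x ≠ 0 := by simp [ae_iff]
  rw [Measure.volume_eq_prod]
  have h1 : ∀ᵐ q : E2 × E2 ∂(volume.prod volume), q.1 ≠ 0 :=
    Measure.quasiMeasurePreserving_fst.ae h0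
  have h2 : ∀ᵐ q : E2 × E2 ∂(volume.prod volume), q.2 ≠ 0 :=
    Measure.quasiMeasurePreserving_snd.ae h0
  filter_upwards [h1, h2] with q a b
  simp [ht, a, b]

theorem Nice.eLpNorm_two_ne_top {F : E2 → ℂ} (hF : Nice F) : eLpNorm F 2 volume ≠ ⊤ :=
  (hF.memLp 2 (by norm_num)).2.ne

variable {φ : E2 → ℂ} {L : ℝ} {F G H : E2 → ℂ}

theorem lintegral_tri_le (hφ : IsKer φ L) (k : ℤ) (hF : Nice F) (hG : Nice G) (hH : Nice H) :
    ∫⁻ p, ‖tri (cv φ k F) G H p‖ₑ ≤ ENNReal.ofReal (2 * L * (sc k)⁻¹) *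
        (eLpNorm F 2 volume * eLpNorm G 2 volume * eLpNorm H 2 volume) := by
  simp_rw [tri, enorm_mul]
  exact lintegral_fourier_trilinear_le hφ k hF hG hH

theorem integrable_tri (hφ : IsKer φ L) (k : ℤ) (hF : Nice F) (hG : Nice G) (hH : Nice H) :
    Integrable (tri (cv φ k F) G H) := by
  refine ⟨(continuous_tri (hF.cv hφ k).int hG.int hH.int).aestronglyMeasurable, ?_⟩
  refine lt_of_le_of_lt (lintegral_tri_le hφ k hF hG hH) ?_
  have a := hF.eLpNorm_two_ne_top
  have b := hG.eLpNorm_two_ne_top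
  have c := hH.eLpNorm_two_ne_top
  finiteness

theorem enorm_integral_mul_tri_le (hφ : IsKer φ L) (k : ℤ) (hF : Nice F) (hG : Nice G)
    (hH : Nice H) {D : E2 × E2 → ℂ} {C : ℝ} (hC : 0 ≤ C) (hD : ∀ᵐ q, ‖D q‖ ≤ C) :
    ‖∫ q, tri (cv φ k F) G H q * D q‖ₑ ≤ ENNReal.ofReal (C * (2 * L * (sc k)⁻¹)) *
        (eLpNorm F 2 volume * eLpNorm G 2 volume * eLpNorm H 2 volume) := by
  refine (enorm_integral_le_lintegral_enorm _).trans ?_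
  rw [ENNReal.ofReal_mul hC, mul_assoc]
  refine le_trans ?_ (mul_le_mul_right (lintegral_tri_le hφ k hF hG hH) _)
  rw [← lintegral_const_mul' _ _ ENNReal.ofReal_ne_top]
  refine lintegral_mono_ae ?_
  filter_upwards [hD] with q hq
  rw [enorm_mul, mul_comm]
  refine mul_le_mul_left ?_ _
  rw [← ofReal_norm]
  exact ENNReal.ofReal_le_ofReal hq

theorem Symb.enorm_locOp_sub_le (h : Symb N B) (hφ : IsKer φ L) (k : ℤ) (hF : Nice F) (hG : Nice G)
    (hH : Nice H) (j : ℤ) :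
    ‖(∫ c, H c * locOp (fun p => N (sc k • p)) (sc (k - j))⁻¹ (cv φ k F) G c) -
        ∫ q, tri (cv φ k F) G H q * N (sc k • q)‖ₑ ≤
      ENNReal.ofReal (B * sc j ^ 2 * smMom * (2 * L * (sc k)⁻¹)) *
        (eLpNorm F 2 volume * eLpNorm G 2 volume * eLpNorm H 2 volume) := by
  have hB := h.nonneg
  have hs := sc_pos k
  have hT := integrable_tri hφ k hF hG hH
  have hm : Measurable fun p => N (sc k • p) := h.meas.comp (by fun_prop)
  have hsc : sc k * (sc (k - j))⁻¹ = sc j := by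
    have := sc_pos (k - j)
    have e := sc_add (k - j) j
    rw [sub_add_cancel] at e
    rw [e]; field_simp
  rw [integral_mul_locOp hm (h.integrable_dilate k) (fun p => h.bdd _) (hF.cv hφ k) hG hH hT,
    ← integral_sub]
  · simp_rw [← mul_sub]
    refine enorm_integral_mul_tri_le hφ k hF hG hH
      (mul_nonneg (mul_nonneg hB (sq_nonneg _)) smMom_nonneg) ?_
    filter_upwards [ae_axes hs.ne'] with q hq
    have := h.norm_smooth_sub_le hq.1 hq.2 (sc j)
    simp_rw [smul_sub, smul_smul, hsc]
    exact this
  · refine hT.mul_bdd (c := ∫ w, ‖smk2 w‖ * B) ?_ (Filter.Eventually.of_forall fun q => ?_)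
    · have : Measurable fun z : (E2 × E2) × (E2 × E2) =>
          smk2 z.2 * N (sc k • (z.1 - (sc (k - j))⁻¹ • z.2)) :=
        (continuous_smk2.measurable.comp measurable_snd).mul (h.meas.comp (by fun_prop))
      exact (StronglyMeasurable.integral_prod_right (ν := (volume : Measure (E2 × E2)))
        this.stronglyMeasurable).aestronglyMeasurable
    · refine norm_integral_le_of_norm_le (integrable_smk2.norm.mul_const _)
        (Filter.Eventually.of_forall fun w => ?_)
      rw [norm_mul]
      gcongr
      exact h.bdd _
  · exact hT.mul_bdd hm.aestronglyMeasurable (Filter.Eventually.of_forall fun q => h.bdd _)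

/-- Differences of the localized operators at successive scales. -/
def dOp (M : E2 × E2 → ℂ) (k : ℤ) (j : ℕ) (F G : E2 → ℂ) (c : E2) : ℂ :=
  locOp M (sc (k - j))⁻¹ F G c - if j = 0 then 0 else locOp M (sc (k - j + 1))⁻¹ F G c

theorem sum_dOp (M : E2 × E2 → ℂ) (k : ℤ) (J : ℕ) (F G : E2 → ℂ) (c : E2) :
    ∑ j ∈ Finset.range (J + 1), dOp M k j F G c = locOp M (sc (k - J))⁻¹ F G c := by
  induction J with
  | zero => simp [dOp]
  | succ J ih =>
    rw [Finset.sum_range_succ, ih, dOp]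
    have : k - ((J + 1 : ℕ) : ℤ) + 1 = k - J := by push_cast; ring
    rw [this]; simp

theorem integrable_mul_locOp {M : E2 × E2 → ℂ} (hM : Measurable M) (hMi : Integrable M)
    (hF : Nice F) (hG : Nice G) (hH : Nice H) (r : ℝ) :
    Integrable fun c => H c * locOp M r F G c :=
  hH.int.mul_bdd (measurable_locOp hM hF hG _).aestronglyMeasurable
    (Filter.Eventually.of_forall fun c => norm_locOp_le hMi hF hG r c)

theorem integrable_mul_dOp {M : E2 × E2 → ℂ} (hM : Measurable M) (hMi : Integrable M)
    (hF : Nice F) (hG : Nice G) (hH : Nice H) (k : ℤ) (j : ℕ) :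
    Integrable fun c => H c * dOp M k j F G c := by
  simp_rw [dOp, mul_sub]
  refine (integrable_mul_locOp hM hMi hF hG hH _).sub ?_
  split_ifs
  · simp
  · exact integrable_mul_locOp hM hMi hF hG hH _

/-- The constant in `Symb.enorm_integral_dOp_le`. -/
def dCst (L : ℝ) : ℝ := (1 + 5 * smMom) * (2 * L)

theorem Symb.enorm_integral_dOp_le (h : Symb N B) (hφ : IsKer φ L) (k : ℤ) (hF : Nice F)
    (hG : Nice G) (hH : Nice H) (j : ℕ) :
    ‖∫ c, H c * dOp (fun p => N (sc k • p)) k j (cv φ k F) G c‖ₑ ≤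
      ENNReal.ofReal (B * dCst L * sc j ^ 2 * (sc k)⁻¹) *
        (eLpNorm F 2 volume * eLpNorm G 2 volume * eLpNorm H 2 volume) := by
  have hB := h.nonneg
  have hK := smMom_nonneg
  have hL := hφ.nonneg
  have hs := sc_pos k
  have hm : Measurable fun p => N (sc k • p) := h.meas.comp (by fun_prop)
  have hMi := h.integrable_dilate k
  have hF' := hF.cv hφ k
  have b1 := h.enorm_locOp_sub_le hφ k hF hG hH j
  have hsj := sc_pos j
  set X := eLpNorm F 2 volume * eLpNorm G 2 volume * eLpNorm H 2 volume
  set Λ := ∫ q, tri (cv φ k F) G H q * N (sc k • q)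
  rcases Nat.eq_zero_or_pos j with hj | hj
  · subst hj
    have e : ∀ c, H c * dOp (fun p => N (sc k • p)) k 0 (cv φ k F) G c =
        H c * locOp (fun p => N (sc k • p)) (sc (k - (0 : ℕ)))⁻¹ (cv φ k F) G c := by
      intro c; simp [dOp]
    simp_rw [e]
    have b0 : ‖Λ‖ₑ ≤ ENNReal.ofReal (B * (2 * L * (sc k)⁻¹)) * X :=
      enorm_integral_mul_tri_le hφ k hF hG hH hB (Filter.Eventually.of_forall fun q => h.bdd _)
    rw [← sub_add_cancel (∫ c, H c * locOp (fun p => N (sc k • p)) (sc (k - (0 : ℕ)))⁻¹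
      (cv φ k F) G c) Λ]
    refine (enorm_add_le _ _).trans ((add_le_add b1 b0).trans ?_)
    rw [← add_mul, ← ENNReal.ofReal_add (by positivity) (by positivity)]
    refine mul_le_mul_left (ENNReal.ofReal_le_ofReal ?_) _
    have : sc ((0 : ℕ) : ℤ) = 1 := by simp [sc]
    rw [this, dCst]
    have : 0 ≤ B * smMom * (2 * L * (sc k)⁻¹) := by positivity
    nlinarith
  · have b2 := h.enorm_locOp_sub_le hφ k hF hG hH (j - 1)
    have e0 : k - ((j : ℤ) - 1) = k - j + 1 := by ring
    rw [e0] at b2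
    have e : ∀ c, H c * dOp (fun p => N (sc k • p)) k j (cv φ k F) G c =
        H c * locOp (fun p => N (sc k • p)) (sc (k - j))⁻¹ (cv φ k F) G c -
        H c * locOp (fun p => N (sc k • p)) (sc (k - j + 1))⁻¹ (cv φ k F) G c := by
      intro c; simp [dOp, hj.ne', mul_sub]
    simp_rw [e]
    rw [integral_sub (integrable_mul_locOp hm hMi hF' hG hH _)
      (integrable_mul_locOp hm hMi hF' hG hH _), ← sub_sub_sub_cancel_right _ _ Λ]
    refine enorm_sub_le.trans ((add_le_add b1 b2).trans ?_)
    rw [← add_mul, ← ENNReal.ofReal_add (by positivity) (by positivity)]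
    refine mul_le_mul_left (ENNReal.ofReal_le_ofReal ?_) _
    have : sc ((j : ℤ) - 1) = 2 * sc j := by
      have h1 := sc_add j (-1)
      have h2 : sc (-1) = 2 := by simp [sc]
      rw [h2] at h1
      rw [sub_eq_add_neg, h1]; ring
    rw [this, dCst]
    have : 0 ≤ B * sc j ^ 2 * (2 * L * (sc k)⁻¹) := by positivity
    nlinarith

end

section

variable {N : E2 × E2 → ℂ} {B : ℝ} {φ : E2 → ℂ} {L : ℝ} {F G H : E2 → ℂ}

theorem eLpNorm_indicator_closedBall (F : E2 → ℂ) (n : ℤ) (x : E2) :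
    eLpNorm ((Metric.closedBall x (3 * sc n)).indicator F) 2 volume =
      ENNReal.ofReal (sc n) * lav n (fun y => ‖F y‖ₑ) x := by
  have hs := sc_pos n
  refine ENNReal.rpow_left_injective (x := 2) (by norm_num) ?_
  simp only
  rw [← lintegral_sq_eq, ENNReal.mul_rpow_of_nonneg _ _ (by norm_num), lav_sq, ← mul_assoc,
    ENNReal.ofReal_rpow_of_pos hs, ← ENNReal.ofReal_mul (by positivity), Real.rpow_two,
    mul_inv_cancel₀ (by positivity), ENNReal.ofReal_one, one_mul,
    ← lintegral_indicator measurableSet_closedBall]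
  refine lintegral_congr fun y => ?_
  by_cases hy : y ∈ Metric.closedBall x (3 * sc n) <;> simp [hy]

theorem loc_congr {r : ℝ} (hr : 0 < r) {c : E2} {F F' : E2 → ℂ}
    (h : ∀ a ∈ Metric.closedBall c r, F a = F' a) : loc r⁻¹ c F = loc r⁻¹ c F' := by
  funext a
  unfold loc
  by_cases ha : a ∈ Metric.closedBall c r
  · rw [h a ha]
  · rw [smb_of_one_le, mul_zero, mul_zero]
    rw [Metric.mem_closedBall, not_le, dist_eq_norm] at ha
    rw [norm_smul, Real.norm_of_nonneg (by positivity)]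
    calc (1 : ℝ) = r⁻¹ * r := by field_simp
      _ ≤ _ := by gcongr

theorem dOp_congr (M : E2 × E2 → ℂ) (k : ℤ) (j : ℕ) {c : E2} {F F' G G' : E2 → ℂ}
    (hF : ∀ a ∈ Metric.closedBall c (sc (k - j)), F a = F' a)
    (hG : ∀ a ∈ Metric.closedBall c (sc (k - j)), G a = G' a) :
    dOp M k j F G c = dOp M k j F' G' c := by
  have h := Metric.closedBall_subset_closedBall (x := c) (sc_anti (by omega : k - j ≤ k - j + 1))
  unfold dOp locOp
  rw [loc_congr (sc_pos _) hF, loc_congr (sc_pos _) hG,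
    loc_congr (sc_pos _) fun a ha => hF a (h ha), loc_congr (sc_pos _) fun a ha => hG a (h ha)]

theorem IsKer.cv_congr (hφ : IsKer φ L) (k : ℤ) {F F' : E2 → ℂ} {y : E2}
    (h : ∀ a ∈ Metric.closedBall y (sc k), F a = F' a) : cv φ k F y = cv φ k F' y := by
  rw [cv_apply, cv_apply]
  refine integral_congr_ae (Filter.Eventually.of_forall fun w => ?_)
  simp only
  by_cases hw : w ∈ Metric.closedBall y (sc k)
  · rw [h w hw]
  · rw [hφ.ker_supp, mul_zero, mul_zero]
    rwa [Metric.mem_closedBall, not_le, dist_comm, dist_eq_norm] at hw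

theorem Symb.enorm_setIntegral_dOp_le (h : Symb N B) (hφ : IsKer φ L) (k : ℤ) (hF : Nice F)
    (hG : Nice G) (hH : Nice H) (j : ℕ) (x : E2) :
    ‖∫ c in Metric.closedBall x (sc (k - j)),
        H c * dOp (fun p => N (sc k • p)) k j (cv φ k F) G c‖ₑ ≤
      ENNReal.ofReal (B * dCst L * sc j ^ 2 * (sc k)⁻¹ * sc (k - j) ^ 3) *
        (lav (k - j) (fun y => ‖F y‖ₑ) x * lav (k - j) (fun y => ‖G y‖ₑ) x *
          lav (k - j) (fun y => ‖H y‖ₑ) x) := by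
  have hs := sc_pos (k - j)
  set s := sc (k - j) with hs_def
  have hts : sc k ≤ s := sc_anti (by omega)
  have hD : MeasurableSet (Metric.closedBall x (3 * s)) := measurableSet_closedBall
  have hD1 : MeasurableSet (Metric.closedBall x s) := measurableSet_closedBall
  have e : ∫ c in Metric.closedBall x s, H c * dOp (fun p => N (sc k • p)) k j (cv φ k F) G c =
      ∫ c, (Metric.closedBall x s).indicator H c * dOp (fun p => N (sc k • p)) k j
        (cv φ k ((Metric.closedBall x (3 * s)).indicator F))
        ((Metric.closedBall x (3 * s)).indicator G) c := by
    rw [← integral_indicator hD1]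
    refine integral_congr_ae (Filter.Eventually.of_forall fun c => ?_)
    by_cases hc : c ∈ Metric.closedBall x s
    · simp only [Set.indicator_of_mem hc]
      congr 1
      rw [Metric.mem_closedBall] at hc
      refine dOp_congr _ _ _ (fun a ha => hφ.cv_congr k fun b hb => ?_) fun a ha => ?_
      · rw [Set.indicator_of_mem]
        rw [Metric.mem_closedBall] at *
        linarith [dist_triangle b a x, dist_triangle a c x]
      · rw [Set.indicator_of_mem]
        rw [Metric.mem_closedBall] at *
        linarith [dist_triangle a c x]
    · simp only [Set.indicator_of_notMem hc, zero_mul]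
  rw [e]
  refine (h.enorm_integral_dOp_le hφ k (hF.indicator hD) (hG.indicator hD) (hH.indicator hD1)
    j).trans ?_
  have hH3 : eLpNorm ((Metric.closedBall x s).indicator H) 2 volume ≤
      eLpNorm ((Metric.closedBall x (3 * s)).indicator H) 2 volume := by
    refine eLpNorm_mono_enorm fun y => ?_
    exact enorm_indicator_le_of_subset (Metric.closedBall_subset_closedBall (by linarith)) _ _
  refine (mul_le_mul_right (mul_le_mul_right hH3 _) _).trans ?_
  rw [hs_def, eLpNorm_indicator_closedBall, eLpNorm_indicator_closedBall,
    eLpNorm_indicator_closedBall, ← hs_def, ENNReal.ofReal_mul' (by positivity : 0 ≤ s ^ 3),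
    ENNReal.ofReal_pow hs.le]
  refine le_of_eq ?_
  ring

theorem integral_setIntegral_closedBall {Q : E2 → ℂ} (hQ : Integrable Q) {r : ℝ} (hr : 0 ≤ r) :
    ∫ x, ∫ c in Metric.closedBall x r, Q c = (Real.pi * r ^ 2 : ℝ) * ∫ c, Q c := by
  have hi : Integrable ((Metric.closedBall (0 : E2) r).indicator fun _ => (1 : ℂ)) :=
    (integrable_indicator_iff measurableSet_closedBall).2
      (integrableOn_const (isCompact_closedBall _ _).measure_lt_top.ne)
  have h := integral_convolution (ContinuousLinearMap.mul ℝ ℂ) hQ hi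
  have e : ∀ x, convolution Q ((Metric.closedBall (0 : E2) r).indicator fun _ => (1 : ℂ))
      (ContinuousLinearMap.mul ℝ ℂ) volume x = ∫ c in Metric.closedBall x r, Q c := by
    intro x
    rw [convolution_def, ← integral_indicator measurableSet_closedBall]
    refine integral_congr_ae (Filter.Eventually.of_forall fun c => ?_)
    simp only [Set.indicator, Metric.mem_closedBall, dist_comm c, dist_eq_norm, sub_zero]
    split_ifs <;> simp
  simp_rw [e] at h
  rw [h, ContinuousLinearMap.mul_apply', integral_indicator measurableSet_closedBall, mul_comm]
  congr 1
  simp only [integral_const, measureReal_def, Measure.restrict_apply_univ]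
  rw [volume_closedBall_E2 _ hr, ENNReal.toReal_ofReal (by positivity)]
  simp

theorem Symb.enorm_integral_dOp_le_lav (h : Symb N B) (hφ : IsKer φ L) (k : ℤ) (hF : Nice F)
    (hG : Nice G) (hH : Nice H) (j : ℕ) :
    ‖∫ c, H c * dOp (fun p => N (sc k • p)) k j (cv φ k F) G c‖ₑ ≤
      ENNReal.ofReal (B * dCst L * sc j) * ∫⁻ x,
        (lav (k - j) (fun y => ‖F y‖ₑ) x * lav (k - j) (fun y => ‖G y‖ₑ) x *
          lav (k - j) (fun y => ‖H y‖ₑ) x) := by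
  have hs := sc_pos (k - j)
  have hk := sc_pos k
  have hj := sc_pos j
  have hB := h.nonneg
  have hL : 0 ≤ dCst L := by
    have := smMom_nonneg
    have := hφ.nonneg
    unfold dCst; positivity
  have hm : Measurable fun p => N (sc k • p) := h.meas.comp (by fun_prop)
  have hQ := integrable_mul_dOp hm (h.integrable_dilate k) (hF.cv hφ k) hG hH k j
  have e := integral_setIntegral_closedBall hQ hs.le
  have hr : (0 : ℝ) < Real.pi * sc (k - j) ^ 2 := by positivity
  have e2 : ∫ c, H c * dOp (fun p => N (sc k • p)) k j (cv φ k F) G c =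
      ((Real.pi * sc (k - j) ^ 2)⁻¹ : ℝ) * ∫ x, ∫ c in Metric.closedBall x (sc (k - j)),
        H c * dOp (fun p => N (sc k • p)) k j (cv φ k F) G c := by
    rw [e, ← mul_assoc, ← Complex.ofReal_mul, inv_mul_cancel₀ hr.ne']
    simp
  rw [e2, enorm_mul]
  have e3 : ‖(((Real.pi * sc (k - j) ^ 2)⁻¹ : ℝ) : ℂ)‖ₑ =
      ENNReal.ofReal (Real.pi * sc (k - j) ^ 2)⁻¹ := by
    rw [← ofReal_norm, Complex.norm_real, Real.norm_of_nonneg (by positivity)]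
  rw [e3]
  refine (mul_le_mul_right ((enorm_integral_le_lintegral_enorm _).trans
    (lintegral_mono fun x => h.enorm_setIntegral_dOp_le hφ k hF hG hH j x)) _).trans ?_
  rw [lintegral_const_mul' _ _ ENNReal.ofReal_ne_top, ← mul_assoc,
    ← ENNReal.ofReal_mul (by positivity)]
  refine mul_le_mul_left (ENNReal.ofReal_le_ofReal ?_) _
  have ek : sc k = sc (k - j) * sc j := by rw [← sc_add, sub_add_cancel]
  have : (Real.pi * sc (k - j) ^ 2)⁻¹ *
      (B * dCst L * sc j ^ 2 * (sc k)⁻¹ * sc (k - j) ^ 3) = Real.pi⁻¹ * (B * dCst L * sc j) := by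
    rw [ek]; field_simp
  rw [this]
  refine mul_le_of_le_one_left (by positivity) (inv_le_one_of_one_le₀ ?_)
  linarith [Real.pi_gt_three]

end

section

variable {φ θ₁ θ₂ θ₃ : E2 → ℂ} {L B : ℝ}

theorem dCst_nonneg (hφ : IsKer φ L) : 0 ≤ dCst L := by
  have := smMom_nonneg
  have := hφ.nonneg
  unfold dCst; positivity

theorem sum_lintegral_lav_reindex (θ₁ θ₂ θ₃ f g h : E2 → ℂ) (j : ℕ) (k0 k1 : ℤ) :
    ∑ k ∈ Finset.Icc k0 k1, ∫⁻ x, lav (k - j) (fun y => ‖cv θ₁ k f y‖ₑ) x *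
        lav (k - j) (fun y => ‖cv θ₂ k g y‖ₑ) x * lav (k - j) (fun y => ‖cv θ₃ k h y‖ₑ) x =
      ∑ n ∈ Finset.Icc (k0 - j) (k1 - j), ∫⁻ x, lav n (fun y => ‖cv θ₁ (n + j) f y‖ₑ) x *
        lav n (fun y => ‖cv θ₂ (n + j) g y‖ₑ) x * lav n (fun y => ‖cv θ₃ (n + j) h y‖ₑ) x := by
  refine Finset.sum_bij' (fun k _ => k - j) (fun n _ => n + j) ?_ ?_ ?_ ?_ ?_
  · intro k hk; simp at hk ⊢; omega
  · intro k hk; simp at hk ⊢; omega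
  · intro k _; simp
  · intro k _; simp
  · intro k _; simp

theorem sc_nat (j : ℕ) : sc j = (1 / 2) ^ j := by
  simp [sc]

theorem sum_sc_mul_rpow_le {δ : ℝ} (hδ : 0 < δ) (J : ℕ) :
    ∑ j ∈ Finset.range J, sc j * (2 : ℝ) ^ ((1 - δ) * j) ≤ (1 - (2 : ℝ) ^ (-δ))⁻¹ := by
  have e : ∀ j : ℕ, sc j * (2 : ℝ) ^ ((1 - δ) * j) = ((2 : ℝ) ^ (-δ)) ^ j := by
    intro j
    rw [sc_nat, sub_eq_add_neg, Real.rpow_mul (by norm_num), Real.rpow_add (by norm_num),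
      Real.rpow_one, Real.rpow_natCast, mul_pow, ← mul_assoc, ← mul_pow]
    norm_num
  simp_rw [e]
  have h1 : (2 : ℝ) ^ (-δ) < 1 := Real.rpow_lt_one_of_one_lt_of_neg (by norm_num) (by linarith)
  rw [← tsum_geometric_of_lt_one (by positivity) h1]
  exact (summable_geometric_of_lt_one (by positivity) h1).sum_le_tsum _ fun _ _ => by positivity

theorem enorm_sum_scales_le (hφ : IsKer φ L) (h1 : IsKer θ₁ L) (h2 : IsKer θ₂ L)
    (h3 : IsKer θ₃ L) {q₁ q₂ q₃ : ℝ≥0∞} (hT : TriBdd θ₁ θ₂ θ₃ q₁ q₂ q₃) (B : ℝ) :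
    ∃ C : ℝ, 0 ≤ C ∧ ∀ N : ℤ → E2 × E2 → ℂ, (∀ k, Symb (N k) B) →
      ∀ f g h : E2 → ℂ, Nice f → Nice g → Nice h → ∀ K : ℤ,
      ‖∑ k ∈ Finset.Icc (-K) K, ∫ q, tri (cv φ k (cv θ₁ k f)) (cv θ₂ k g) (cv θ₃ k h) q *
          N k (sc k • q)‖ₑ ≤
        ENNReal.ofReal C * (eLpNorm f q₁ volume * eLpNorm g q₂ volume * eLpNorm h q₃ volume) := by
  obtain ⟨C, δ, hC, hδ, hT⟩ := hT
  have hd := dCst_nonneg hφ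
  have hL := hφ.nonneg
  have hm := smMom_nonneg
  have hg0 : 0 ≤ (1 - (2 : ℝ) ^ (-δ))⁻¹ := by
    refine inv_nonneg.2 ?_
    have : (2 : ℝ) ^ (-δ) < 1 := Real.rpow_lt_one_of_one_lt_of_neg (by norm_num) (by linarith)
    linarith
  by_cases hB : 0 ≤ B
  swap
  · exact ⟨0, le_rfl, fun N hN => absurd (hN 0).nonneg hB⟩
  refine ⟨B * dCst L * C * (1 - (2 : ℝ) ^ (-δ))⁻¹, by positivity, fun N hN f g h hf hg hh K => ?_⟩
  set X := eLpNorm f q₁ volume * eLpNorm g q₂ volume * eLpNorm h q₃ volume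
  let M : ℤ → E2 × E2 → ℂ := fun k p => N k (sc k • p)
  let Y : ℤ → ℝ≥0∞ := fun k => eLpNorm (cv θ₁ k f) 2 volume * eLpNorm (cv θ₂ k g) 2 volume *
    eLpNorm (cv θ₃ k h) 2 volume
  let E : ℝ≥0∞ := ∑ k ∈ Finset.Icc (-K) K, ENNReal.ofReal (B * smMom * (2 * L * (sc k)⁻¹)) * Y k
  have hE : E ≠ ⊤ := by
    refine ENNReal.sum_ne_top.2 fun k _ => ?_
    have a := (hf.cv h1 k).eLpNorm_two_ne_top
    have b := (hg.cv h2 k).eLpNorm_two_ne_top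
    have c := (hh.cv h3 k).eLpNorm_two_ne_top
    simp only [Y]
    finiteness
  have main : ∀ J : ℕ, ‖∑ k ∈ Finset.Icc (-K) K,
      ∫ q, tri (cv φ k (cv θ₁ k f)) (cv θ₂ k g) (cv θ₃ k h) q * N k (sc k • q)‖ₑ ≤
      ENNReal.ofReal (sc J ^ 2) * E +
        ENNReal.ofReal (B * dCst L * C * (1 - (2 : ℝ) ^ (-δ))⁻¹) * X := by
    intro J
    have hJ := sc_pos J
    let I : ℤ → ℂ := fun k =>
      ∫ q, tri (cv φ k (cv θ₁ k f)) (cv θ₂ k g) (cv θ₃ k h) q * N k (sc k • q)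
    let D : ℤ → ℕ → ℂ := fun k j =>
      ∫ c, cv θ₃ k h c * dOp (M k) k j (cv φ k (cv θ₁ k f)) (cv θ₂ k g) c
    have hD : ∀ k, ∑ j ∈ Finset.range (J + 1), D k j = ∫ c, cv θ₃ k h c *
        locOp (M k) (sc (k - J))⁻¹ (cv φ k (cv θ₁ k f)) (cv θ₂ k g) c := by
      intro k
      simp only [D]
      rw [← integral_finsetSum]
      · simp_rw [← Finset.mul_sum, sum_dOp]
      · intro j _
        exact integrable_mul_dOp ((hN k).meas.comp (by fun_prop)) ((hN k).integrable_dilate k)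
          ((hf.cv h1 k).cv hφ k) (hg.cv h2 k) (hh.cv h3 k) k j
    have split : ∑ k ∈ Finset.Icc (-K) K, I k =
        (∑ k ∈ Finset.Icc (-K) K, (I k - ∑ j ∈ Finset.range (J + 1), D k j)) +
          ∑ j ∈ Finset.range (J + 1), ∑ k ∈ Finset.Icc (-K) K, D k j := by
      rw [Finset.sum_comm (s := Finset.range (J + 1)), ← Finset.sum_add_distrib]
      simp
    change ‖∑ k ∈ Finset.Icc (-K) K, I k‖ₑ ≤ _
    rw [split]
    refine (enorm_add_le _ _).trans (add_le_add ?_ ?_)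
    · refine (enorm_sum_le _ _).trans ?_
      simp only [E]
      rw [Finset.mul_sum]
      refine Finset.sum_le_sum fun k _ => ?_
      rw [hD, ← enorm_neg, neg_sub, ← mul_assoc, ← ENNReal.ofReal_mul (by positivity)]
      refine ((hN k).enorm_locOp_sub_le hφ k (hf.cv h1 k) (hg.cv h2 k) (hh.cv h3 k) J).trans ?_
      refine mul_le_mul_left (ENNReal.ofReal_le_ofReal (le_of_eq ?_)) _
      ring
    · calc ‖∑ j ∈ Finset.range (J + 1), ∑ k ∈ Finset.Icc (-K) K, D k j‖ₑ
          ≤ ∑ j ∈ Finset.range (J + 1), ∑ k ∈ Finset.Icc (-K) K, ‖D k j‖ₑ :=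
            (enorm_sum_le _ _).trans (Finset.sum_le_sum fun j _ => enorm_sum_le _ _)
        _ ≤ ∑ j ∈ Finset.range (J + 1),
              ENNReal.ofReal (B * dCst L * C * (sc j * (2 : ℝ) ^ ((1 - δ) * j))) * X := by
            refine Finset.sum_le_sum fun j _ => ?_
            have hj := sc_pos j
            refine (Finset.sum_le_sum fun k _ => (hN k).enorm_integral_dOp_le_lav hφ k (hf.cv h1 k)
              (hg.cv h2 k) (hh.cv h3 k) j).trans ?_
            rw [← Finset.mul_sum, sum_lintegral_lav_reindex]
            refine (mul_le_mul_right (hT f g h hf hg hh j _ _) _).trans ?_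
            rw [← mul_assoc, ← ENNReal.ofReal_mul (by positivity)]
            refine mul_le_mul_left (ENNReal.ofReal_le_ofReal (le_of_eq ?_)) _
            ring
        _ ≤ _ := by
            rw [← Finset.sum_mul, ← ENNReal.ofReal_sum_of_nonneg, ← Finset.mul_sum]
            · refine mul_le_mul_left (ENNReal.ofReal_le_ofReal ?_) _
              exact mul_le_mul_of_nonneg_left (sum_sc_mul_rpow_le hδ _) (by positivity)
            · intro j _
              have hj := sc_pos j
              positivity
  have lim : Filter.Tendsto (fun J : ℕ => ENNReal.ofReal (sc J ^ 2) * E +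
      ENNReal.ofReal (B * dCst L * C * (1 - (2 : ℝ) ^ (-δ))⁻¹) * X) Filter.atTop
      (nhds (ENNReal.ofReal 0 * E +
        ENNReal.ofReal (B * dCst L * C * (1 - (2 : ℝ) ^ (-δ))⁻¹) * X)) := by
    refine Filter.Tendsto.add (ENNReal.Tendsto.mul_const (ENNReal.tendsto_ofReal ?_) (Or.inr hE))
      tendsto_const_nhds
    have : Filter.Tendsto (fun J : ℕ => ((1 / 2 : ℝ) ^ J) ^ 2) Filter.atTop (nhds (0 ^ 2)) :=
      (tendsto_pow_atTop_nhds_zero_of_lt_one (by norm_num) (by norm_num)).pow 2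
    simpa [sc_nat] using this
  simpa using ge_of_tendsto' lim main

end

/-- The complement of the two axes. -/
def Om : Set (E2 × E2) := {0}ᶜ ×ˢ {0}ᶜ

theorem mem_Om {p : E2 × E2} : p ∈ Om ↔ p.1 ≠ 0 ∧ p.2 ≠ 0 := by simp [Om]

theorem isOpen_Om : IsOpen Om := isOpen_compl_singleton.prod isOpen_compl_singleton

theorem smul_mem_Om {t : ℝ} (ht : t ≠ 0) {p : E2 × E2} : t • p ∈ Om ↔ p ∈ Om := by
  simp [mem_Om, ht]

theorem Om_norm_pos {p : E2 × E2} (hp : p ∈ Om) : 0 < ‖p‖ := by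
  refine norm_pos_iff.2 fun h => ?_
  rw [mem_Om, h] at hp
  exact hp.1 rfl

theorem ae_mem_Om : ∀ᵐ q : E2 × E2, q ∈ Om := by
  filter_upwards [ae_axes one_ne_zero] with q hq
  rw [one_smul] at hq
  exact mem_Om.2 hq

/-- Homogeneous symbol estimates up to order two off the axes. -/
structure Mih (μ : E2 × E2 → ℂ) (C : ℝ) : Prop where
  cd : ContDiffOn ℝ 2 μ Om
  bd : ∀ i : ℕ, i ≤ 2 → ∀ p ∈ Om, ‖iteratedFDeriv ℝ i μ p‖ ≤ C * (‖p‖ ^ i)⁻¹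
  off : ∀ p, p ∉ Om → μ p = 0

theorem Mih.dilate {μ : E2 × E2 → ℂ} {C : ℝ} (h : Mih μ C) {t : ℝ} (ht : 0 < t) :
    Mih (fun p => μ (t • p)) C := by
  have hpre : (fun p : E2 × E2 => t • p) ⁻¹' Om = Om := by
    ext p; exact smul_mem_Om ht.ne'
  refine ⟨?_, fun i hi p hp => ?_, fun p hp => h.off _ fun h' => hp ((smul_mem_Om ht.ne').1 h')⟩
  · exact h.cd.comp (by fun_prop) fun p hp => (smul_mem_Om ht.ne').2 hp
  · let g : (E2 × E2) ≃L[ℝ] (E2 × E2) := ContinuousLinearEquiv.smulLeft (Units.mk0 t ht.ne')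
    have hg : ∀ q, g q = t • q := fun q => rfl
    have hgn : ‖(g : (E2 × E2) →L[ℝ] (E2 × E2))‖ ≤ t := by
      refine ContinuousLinearMap.opNorm_le_bound _ ht.le fun q => ?_
      change ‖t • q‖ ≤ _
      rw [norm_smul, Real.norm_of_nonneg ht.le]
    have e := g.iteratedFDerivWithin_comp_right μ isOpen_Om.uniqueDiffOn
      (x := p) ((smul_mem_Om ht.ne').2 hp) i
    have hpre' : g ⁻¹' Om = Om := hpre
    rw [hpre', iteratedFDerivWithin_of_isOpen i isOpen_Om hp,
      iteratedFDerivWithin_of_isOpen i isOpen_Om (x := g p) ((smul_mem_Om ht.ne').2 hp)] at e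
    change ‖iteratedFDeriv ℝ i (μ ∘ g) p‖ ≤ _
    rw [e]
    refine (ContinuousMultilinearMap.norm_compContinuousLinearMap_le _ _).trans ?_
    rw [Finset.prod_const, Finset.card_univ, Fintype.card_fin]
    have hp0 := Om_norm_pos hp
    have hb := h.bd i hi (g p) ((smul_mem_Om ht.ne').2 hp)
    calc ‖iteratedFDeriv ℝ i μ (g p)‖ * ‖(g : (E2 × E2) →L[ℝ] (E2 × E2))‖ ^ i
        ≤ (C * (‖g p‖ ^ i)⁻¹) * t ^ i := by
          refine mul_le_mul hb (pow_le_pow_left₀ (norm_nonneg _) hgn _) (by positivity) ?_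
          exact (norm_nonneg _).trans hb
      _ = C * (‖p‖ ^ i)⁻¹ := by
          rw [hg, norm_smul, Real.norm_of_nonneg ht.le, mul_pow]
          field_simp

theorem ae_line_subset {p : E2 × E2} (hp : p ∈ Om) :
    ∀ᵐ y : E2 × E2, ∀ ε : ℝ, p + ε • y ∈ Om := by
  have key : ∀ x : E2, x ≠ 0 → ∀ᵐ y : E2, ∀ ε : ℝ, x + ε • y ≠ 0 := by
    intro x hx
    have hS : Submodule.span ℝ {x} ≠ ⊤ := by
      intro h
      have h1 := finrank_span_singleton (K := ℝ) hx
      rw [h, finrank_top] at h1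
      simp at h1
    have h0 := Measure.addHaar_submodule volume (Submodule.span ℝ {x}) hS
    have h1 : ∀ᵐ y : E2, y ∉ (Submodule.span ℝ {x} : Set E2) := measure_eq_zero_iff_ae_notMem.1 h0
    filter_upwards [h1] with y hy ε h
    apply hy
    have hε : ε ≠ 0 := by
      rintro rfl
      simp [hx] at h
    refine Submodule.mem_span_singleton.2 ⟨-ε⁻¹, ?_⟩
    have : ε • y = -x := by rw [eq_neg_iff_add_eq_zero, add_comm]; exact h
    rw [neg_smul, ← smul_neg, ← this, smul_smul, inv_mul_cancel₀ hε, one_smul]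
  rw [mem_Om] at hp
  rw [Measure.volume_eq_prod]
  filter_upwards [Measure.quasiMeasurePreserving_fst.ae (key _ hp.1),
    Measure.quasiMeasurePreserving_snd.ae (key _ hp.2)] with y h1 h2 ε
  exact mem_Om.2 ⟨h1 ε, h2 ε⟩

theorem norm_second_difference_le {N : E2 × E2 → ℂ} (hN : ContDiffOn ℝ 2 N Om) {B : ℝ}
    (hB : ∀ q ∈ Om, ‖iteratedFDeriv ℝ 2 N q‖ ≤ B) {p y : E2 × E2}
    (hp : ∀ τ : ℝ, p + τ • y ∈ Om) (ε : ℝ) :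
    ‖N (p - ε • y) + N (p + ε • y) - 2 * N p‖ ≤ 2 * B * ε ^ 2 * ‖y‖ ^ 2 := by
  have hp' : ∀ τ : ℝ, p - τ • y ∈ Om := fun τ => by
    have := hp (-τ)
    rwa [neg_smul, ← sub_eq_add_neg] at this
  have hB0 : 0 ≤ B := (norm_nonneg _).trans (hB _ (hp 0))
  have hd : ∀ q ∈ Om, DifferentiableAt ℝ N q := fun q hq =>
    (hN.contDiffAt (isOpen_Om.mem_nhds hq)).differentiableAt (by norm_num)
  have hd2 : ∀ q ∈ Om, DifferentiableAt ℝ (fderiv ℝ N) q := fun q hq =>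
    ((hN.contDiffAt (isOpen_Om.mem_nhds hq)).fderiv_right (m := 1) (by norm_num)).differentiableAt
      (by norm_num)
  have hB2 : ∀ q ∈ Om, ‖fderiv ℝ (fderiv ℝ N) q‖ ≤ B := fun q hq => by
    have := hB q hq
    rwa [← norm_iteratedFDeriv_fderiv, norm_iteratedFDeriv_one] at this
  have h1 : ∀ τ : ℝ, ‖fderiv ℝ N (p + τ • y) - fderiv ℝ N (p - τ • y)‖ ≤ B * (2 * |τ| * ‖y‖) := by
    intro τ
    have hseg : segment ℝ (p - τ • y) (p + τ • y) ⊆ Om := by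
      rintro _ ⟨a, b, _, _, hab, rfl⟩
      have : a • (p - τ • y) + b • (p + τ • y) = p + ((b - a) * τ) • y := by
        rw [smul_sub, smul_add, sub_mul, sub_smul, mul_smul, mul_smul]
        have : p = a • p + b • p := by rw [← add_smul, hab, one_smul]
        nth_rewrite 3 [this]
        abel
      rw [this]; exact hp _
    have := Convex.norm_image_sub_le_of_norm_fderiv_le (𝕜 := ℝ) (f := fderiv ℝ N) (C := B)
      (fun q hq => hd2 q (hseg hq)) (fun q hq => hB2 q (hseg hq)) (convex_segment _ _)
      (left_mem_segment ℝ _ _) (right_mem_segment ℝ (p - τ • y) (p + τ • y))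
    refine this.trans (le_of_eq ?_)
    have e : p + τ • y - (p - τ • y) = (2 * τ) • y := by rw [mul_smul, two_smul]; abel
    rw [e, norm_smul, Real.norm_eq_abs, abs_mul, abs_two]
  have h2 : ∀ τ : ℝ, HasDerivAt (fun τ : ℝ => N (p - τ • y) + N (p + τ • y) - 2 * N p)
      ((fderiv ℝ N (p + τ • y) - fderiv ℝ N (p - τ • y)) y) τ := by
    intro τ
    have a : HasDerivAt (fun τ : ℝ => p + τ • y) y τ := by
      simpa using ((hasDerivAt_id τ).smul_const y).const_add p
    have b : HasDerivAt (fun τ : ℝ => p - τ • y) (-y) τ := by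
      simpa using ((hasDerivAt_id τ).smul_const y).const_sub p
    have c := ((hd _ (hp τ)).hasFDerivAt.comp_hasDerivAt τ a)
    have d := ((hd _ (hp' τ)).hasFDerivAt.comp_hasDerivAt τ b)
    have := (d.add c).sub_const (2 * N p)
    refine this.congr_deriv ?_
    rw [map_neg, sub_apply]; ring
  have h3 : ∀ τ ∈ segment ℝ 0 ε, ‖(fderiv ℝ N (p + τ • y) - fderiv ℝ N (p - τ • y)) y‖ ≤
      2 * B * |ε| * ‖y‖ ^ 2 := by
    rintro τ ⟨a, b, ha, hb, hab, rfl⟩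
    refine (ContinuousLinearMap.le_opNorm _ _).trans ?_
    refine (mul_le_mul_of_nonneg_right (h1 _) (norm_nonneg _)).trans ?_
    simp only [smul_eq_mul, mul_zero, zero_add, abs_mul, abs_of_nonneg hb]
    have : b * |ε| ≤ |ε| := mul_le_of_le_one_left (abs_nonneg _) (by linarith)
    calc B * (2 * (b * |ε|) * ‖y‖) * ‖y‖ ≤ B * (2 * |ε| * ‖y‖) * ‖y‖ := by gcongr
      _ = _ := by ring
  have h4 := Convex.norm_image_sub_le_of_norm_hasDerivWithin_le
    (fun τ _ => (h2 τ).hasDerivWithinAt) h3 (convex_segment 0 ε) (left_mem_segment ℝ _ _)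
    (right_mem_segment ℝ 0 ε)
  simp only [zero_smul, sub_zero, add_zero, Real.norm_eq_abs] at h4
  have e : N p + N p - 2 * N p = 0 := by ring
  rw [e, sub_zero] at h4
  refine h4.trans (le_of_eq ?_)
  rw [← sq_abs ε]; ring

theorem Mih.measurable {μ : E2 × E2 → ℂ} {C : ℝ} (h : Mih μ C) : Measurable μ := by
  classical
  have e : μ = Om.piecewise μ 0 := by
    funext p
    by_cases hp : p ∈ Om
    · simp [hp]
    · simp [hp, h.off p hp]
  rw [e]
  exact h.cd.continuousOn.measurable_piecewise continuousOn_const isOpen_Om.measurableSet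

theorem Mih.norm_le {μ : E2 × E2 → ℂ} {C : ℝ} (hC : 0 ≤ C) (h : Mih μ C) (p : E2 × E2) :
    ‖μ p‖ ≤ C := by
  by_cases hp : p ∈ Om
  · simpa using h.bd 0 (by norm_num) p hp
  · rw [h.off p hp]; simpa

theorem symb_of_mih {A : E2 × E2 → ℂ} (hA : ContDiff ℝ 2 A) (hA4 : ∀ q, 4 < ‖q‖ → A q = 0)
    (hA0 : ∀ q, ‖q‖ < 1 / 2 → A q = 0) {C : ℝ} (hC : 0 ≤ C) :
    ∃ D : ℝ, ∀ μ : E2 × E2 → ℂ, Mih μ C → ∀ t : ℝ, 0 < t →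
      Symb (fun q => μ (t • q) * A q) D := by
  have hcs : HasCompactSupport A := by
    refine HasCompactSupport.intro (isCompact_closedBall (0 : E2 × E2) 4) fun q hq => hA4 q ?_
    simpa using hq
  have hb : ∀ i : ℕ, ∃ a : ℝ, 0 ≤ a ∧ (i ≤ 2 → ∀ q, ‖iteratedFDeriv ℝ i A q‖ ≤ a) := by
    intro i
    by_cases hi : i ≤ 2
    · obtain ⟨a, ha⟩ := (hcs.iteratedFDeriv i).exists_bound_of_continuous
        (hA.continuous_iteratedFDeriv (by exact_mod_cast hi))
      exact ⟨a, (norm_nonneg _).trans (ha 0), fun _ => ha⟩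
    · exact ⟨0, le_rfl, fun h => absurd h hi⟩
  choose a ha0 ha using hb
  have hts : ∀ q, ‖q‖ < 1 / 2 → ∀ i, iteratedFDeriv ℝ i A q = 0 := by
    intro q hq i
    by_contra hne
    have h1 : q ∈ tsupport A := support_iteratedFDeriv_subset (𝕜 := ℝ) i hne
    refine (notMem_tsupport_iff_eventuallyEq.2 ?_) h1
    filter_upwards [(isOpen_lt continuous_norm continuous_const).mem_nhds hq] with x hx
    exact hA0 x hx
  refine ⟨C * a 0 + 2 * ∑ i ∈ Finset.range 3, ((2 : ℕ).choose i : ℝ) * (C * 4) * a (2 - i),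
    fun μ hμ t ht => ?_⟩
  have hμ := hμ.dilate ht
  have hS : 0 ≤ ∑ i ∈ Finset.range 3, ((2 : ℕ).choose i : ℝ) * (C * 4) * a (2 - i) :=
    Finset.sum_nonneg fun i _ => by have := ha0 (2 - i); positivity
  have h00 := ha0 0
  have hcd : ContDiffOn ℝ 2 (fun q => μ (t • q) * A q) Om := hμ.cd.mul hA.contDiffOn
  refine ⟨hμ.measurable.mul hA.continuous.measurable, fun p => ?_, fun p hp => ?_,
    fun p h1 h2 => ?_⟩
  · have h1 := hμ.norm_le hC p
    have h2 := ha 0 (by norm_num) p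
    rw [norm_iteratedFDeriv_zero] at h2
    rw [norm_mul]
    have : ‖μ (t • p)‖ * ‖A p‖ ≤ C * a 0 := by gcongr
    linarith
  · rw [hA4 p hp, mul_zero]
  · have hp : p ∈ Om := mem_Om.2 ⟨h1, h2⟩
    filter_upwards [ae_line_subset hp] with y hy ε
    refine (norm_second_difference_le hcd
      (B := ∑ i ∈ Finset.range 3, ((2 : ℕ).choose i : ℝ) * (C * 4) * a (2 - i))
      (fun q hq => ?_) hy ε).trans ?_
    · rw [← iteratedFDerivWithin_of_isOpen 2 isOpen_Om hq]
      refine (norm_iteratedFDerivWithin_mul_le hμ.cd hA.contDiffOn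
        isOpen_Om.uniqueDiffOn hq (n := 2) le_rfl).trans ?_
      refine Finset.sum_le_sum fun i hi => ?_
      have hi2 : i ≤ 2 := by simp at hi; omega
      rw [iteratedFDerivWithin_of_isOpen _ isOpen_Om hq, iteratedFDerivWithin_of_isOpen _ isOpen_Om hq]
      have a0 := ha0 (2 - i)
      rcases lt_or_ge ‖q‖ (1 / 2) with hq2 | hq2
      · rw [hts q hq2, norm_zero, mul_zero]; positivity
      · gcongr
        · refine (hμ.bd i hi2 q hq).trans ?_
          gcongr
          calc (‖q‖ ^ i)⁻¹ ≤ ((1 / 2 : ℝ) ^ i)⁻¹ := by gcongr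
            _ ≤ 4 := by interval_cases i <;> norm_num
        · exact ha _ (by omega) q
    · gcongr
      have : 0 ≤ C * a 0 := by positivity
      linarith

/-- The coordinate vectors of `E2 × E2`. -/
def bv : Fin 2 ⊕ Fin 2 → E2 × E2 :=
  Sum.elim (fun i => (EuclideanSpace.single i 1, 0)) fun i => (0, EuclideanSpace.single i 1)

/-- The coordinates of a vector of `E2 × E2`. -/
def bc (v : E2 × E2) : Fin 2 ⊕ Fin 2 → ℝ := Sum.elim (fun i => v.1 i) fun i => v.2 i

/-- Partial derivatives in the coordinates of `E2 × E2`. -/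
def pd : Fin 2 ⊕ Fin 2 → (E2 → E2 → ℂ) → E2 → E2 → ℂ := Sum.elim dxi deta

theorem sum_bc_bv (v : E2 × E2) : ∑ s, bc v s • bv s = v := by
  have h : ∀ u : E2, ∑ i, u i • (EuclideanSpace.single i 1 : E2) = u := by
    intro u
    ext j
    fin_cases j <;> simp
  simp only [Fintype.sum_sum_type, bc, bv, Sum.elim_inl, Sum.elim_inr, Prod.smul_mk, smul_zero]
  ext1
  · rw [Prod.fst_add, Prod.fst_sum, Prod.fst_sum]; simp [h]
  · rw [Prod.snd_add, Prod.snd_sum, Prod.snd_sum]; simp [h]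

theorem abs_bc_le (v : E2 × E2) (s : Fin 2 ⊕ Fin 2) : |bc v s| ≤ ‖v‖ := by
  rcases s with i | i
  · exact (PiLp.norm_apply_le v.1 i).trans (norm_fst_le v)
  · exact (PiLp.norm_apply_le v.2 i).trans (norm_snd_le v)

theorem opNorm_le_of_bv {V : Type*} [NormedAddCommGroup V] [NormedSpace ℝ V]
    (T : (E2 × E2) →L[ℝ] V) {C : ℝ} (hC : 0 ≤ C) (h : ∀ s, ‖T (bv s)‖ ≤ C) : ‖T‖ ≤ 4 * C := by
  refine T.opNorm_le_bound (by positivity) fun v => ?_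
  rw [← sum_bc_bv v, map_sum]
  rw [sum_bc_bv v]
  refine (norm_sum_le_of_le (f := fun s => T (bc v s • bv s)) Finset.univ
    (n := fun _ => ‖v‖ * C) fun s _ => ?_).trans (le_of_eq ?_)
  · rw [map_smul, norm_smul]
    exact mul_le_mul (abs_bc_le v s) (h s) (norm_nonneg _) (norm_nonneg _)
  · simp; ring

theorem pd_eq_fderiv {m : E2 → E2 → ℂ} {F : E2 × E2 → ℂ} (h : ∀ p ∈ Om, m p.1 p.2 = F p)
    {p : E2 × E2} (hp : p ∈ Om) (hF : DifferentiableAt ℝ F p) (s : Fin 2 ⊕ Fin 2) :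
    pd s m p.1 p.2 = fderiv ℝ F p (bv s) := by
  have hp' := mem_Om.1 hp
  rcases s with i | i
  · have e : (fun ζ => m ζ p.2) =ᶠ[nhds p.1] fun ζ => F (ζ, p.2) := by
      filter_upwards [isOpen_compl_singleton.mem_nhds hp'.1] with ζ hζ
      exact h (ζ, p.2) (mem_Om.2 ⟨hζ, hp'.2⟩)
    have hc : HasFDerivAt (fun ζ : E2 => F (ζ, p.2))
        ((fderiv ℝ F p).comp (ContinuousLinearMap.inl ℝ E2 E2)) p.1 :=
      HasFDerivAt.comp (g := F) p.1 hF.hasFDerivAt (hasFDerivAt_prodMk_left p.1 p.2)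
    change fderiv ℝ (fun ζ => m ζ p.2) p.1 _ = _
    rw [e.fderiv_eq, hc.fderiv]
    rfl
  · have e : (fun ζ => m p.1 ζ) =ᶠ[nhds p.2] fun ζ => F (p.1, ζ) := by
      filter_upwards [isOpen_compl_singleton.mem_nhds hp'.2] with ζ hζ
      exact h (p.1, ζ) (mem_Om.2 ⟨hp'.1, hζ⟩)
    have hc : HasFDerivAt (fun ζ : E2 => F (p.1, ζ))
        ((fderiv ℝ F p).comp (ContinuousLinearMap.inr ℝ E2 E2)) p.2 :=
      HasFDerivAt.comp (g := F) p.2 hF.hasFDerivAt (hasFDerivAt_prodMk_right p.1 p.2)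
    change fderiv ℝ (fun ζ => m p.1 ζ) p.2 _ = _
    rw [e.fderiv_eq, hc.fderiv]
    rfl

theorem exists_mderiv_eq_pd (s : Fin 2 ⊕ Fin 2) : ∃ α β : Fin 2 → ℕ, α 0 + α 1 ≤ 2 ∧
    β 0 + β 1 ≤ 2 ∧ α 0 + α 1 + β 0 + β 1 = 1 ∧ ∀ m, mderiv α β m = pd s m := by
  rcases s with i | i <;> fin_cases i
  · exact ⟨![1, 0], ![0, 0], by simp, by simp, by simp, fun m => rfl⟩
  · exact ⟨![0, 1], ![0, 0], by simp, by simp, by simp, fun m => rfl⟩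
  · exact ⟨![0, 0], ![1, 0], by simp, by simp, by simp, fun m => rfl⟩
  · exact ⟨![0, 0], ![0, 1], by simp, by simp, by simp, fun m => rfl⟩

theorem exists_mderiv_eq_pd_pd (s s' : Fin 2 ⊕ Fin 2) : ∃ α β : Fin 2 → ℕ, α 0 + α 1 ≤ 2 ∧
    β 0 + β 1 ≤ 2 ∧ α 0 + α 1 + β 0 + β 1 = 2 ∧
      ((∀ m, mderiv α β m = pd s (pd s' m)) ∨ ∀ m, mderiv α β m = pd s' (pd s m)) := by
  have key : ∀ a b c d : ℕ, a + b + c + d = 2 →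
      ((∀ m, mderiv ![a, b] ![c, d] m = pd s (pd s' m)) ∨
        ∀ m, mderiv ![a, b] ![c, d] m = pd s' (pd s m)) →
      ∃ α β : Fin 2 → ℕ, α 0 + α 1 ≤ 2 ∧ β 0 + β 1 ≤ 2 ∧ α 0 + α 1 + β 0 + β 1 = 2 ∧
      ((∀ m, mderiv α β m = pd s (pd s' m)) ∨ ∀ m, mderiv α β m = pd s' (pd s m)) := by
    intro a b c d h1 h2
    refine ⟨![a, b], ![c, d], ?_, ?_, ?_, h2⟩ <;> simp <;> omega
  rcases s with i | i <;> rcases s' with i' | i' <;> fin_cases i <;> fin_cases i'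
  · exact key 2 0 0 0 rfl (Or.inl fun m => rfl)
  · exact key 1 1 0 0 rfl (Or.inl fun m => rfl)
  · exact key 1 1 0 0 rfl (Or.inr fun m => rfl)
  · exact key 0 2 0 0 rfl (Or.inl fun m => rfl)
  · exact key 1 0 1 0 rfl (Or.inl fun m => rfl)
  · exact key 1 0 0 1 rfl (Or.inl fun m => rfl)
  · exact key 0 1 1 0 rfl (Or.inl fun m => rfl)
  · exact key 0 1 0 1 rfl (Or.inl fun m => rfl)
  · exact key 1 0 1 0 rfl (Or.inr fun m => rfl)
  · exact key 0 1 1 0 rfl (Or.inr fun m => rfl)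
  · exact key 1 0 0 1 rfl (Or.inr fun m => rfl)
  · exact key 0 1 0 1 rfl (Or.inr fun m => rfl)
  · exact key 0 0 2 0 rfl (Or.inl fun m => rfl)
  · exact key 0 0 1 1 rfl (Or.inl fun m => rfl)
  · exact key 0 0 1 1 rfl (Or.inr fun m => rfl)
  · exact key 0 0 0 2 rfl (Or.inl fun m => rfl)

theorem mih_of_mderiv {m : E2 → E2 → ℂ} {C₀ : ℝ} (hC₀ : 0 ≤ C₀)
    (hm : ContDiffOn ℝ 2 (Function.uncurry m) Om)
    (hb : ∀ α β : Fin 2 → ℕ, α 0 + α 1 ≤ 2 → β 0 + β 1 ≤ 2 → ∀ ξ η : E2, ξ ≠ 0 → η ≠ 0 →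
      ‖mderiv α β m ξ η‖ ≤ C₀ * (‖ξ‖ + ‖η‖) ^ (-((α 0 + α 1 + β 0 + β 1 : ℕ) : ℝ))) :
    Mih (Om.indicator (Function.uncurry m)) (16 * C₀) := by
  set M := Om.indicator (Function.uncurry m) with hM
  have hMm : ∀ p ∈ Om, m p.1 p.2 = M p := fun p hp => by rw [hM, Set.indicator_of_mem hp]; rfl
  have hcd : ContDiffOn ℝ 2 M Om := hm.congr fun p hp => (hMm p hp).symm
  have hd : ∀ q ∈ Om, DifferentiableAt ℝ M q := fun q hq =>
    (hcd.contDiffAt (isOpen_Om.mem_nhds hq)).differentiableAt (by norm_num)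
  have hd2 : ∀ q ∈ Om, DifferentiableAt ℝ (fderiv ℝ M) q := fun q hq =>
    ((hcd.contDiffAt (isOpen_Om.mem_nhds hq)).fderiv_right (m := 1) (by norm_num)).differentiableAt
      (by norm_num)
  have hsize : ∀ (i : ℕ) (p : E2 × E2), p ∈ Om →
      C₀ * (‖p.1‖ + ‖p.2‖) ^ (-(i : ℝ)) ≤ C₀ * (‖p‖ ^ i)⁻¹ := by
    intro i p hp
    have h0 := Om_norm_pos hp
    have h1 : ‖p‖ ≤ ‖p.1‖ + ‖p.2‖ :=
      max_le (le_add_of_nonneg_right (norm_nonneg _)) (le_add_of_nonneg_left (norm_nonneg _))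
    rw [Real.rpow_neg (by positivity), Real.rpow_natCast]
    gcongr
  have h1 : ∀ p ∈ Om, ∀ s, ‖fderiv ℝ M p (bv s)‖ ≤ C₀ * (‖p‖ ^ 1)⁻¹ := by
    intro p hp s
    obtain ⟨α, β, hα, hβ, hαβ, e⟩ := exists_mderiv_eq_pd s
    rw [← pd_eq_fderiv hMm hp (hd p hp) s, ← e]
    have := hb α β hα hβ p.1 p.2 (mem_Om.1 hp).1 (mem_Om.1 hp).2
    rw [hαβ] at this
    exact this.trans (hsize 1 p hp)
  have hpd2 : ∀ p ∈ Om, ∀ s s', pd s (pd s' m) p.1 p.2 = fderiv ℝ (fderiv ℝ M) p (bv s) (bv s') := by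
    intro p hp s s'
    have hdd : DifferentiableAt ℝ (fun q => fderiv ℝ M q (bv s')) p :=
      (hd2 p hp).clm_apply (differentiableAt_const _)
    rw [pd_eq_fderiv (F := fun q => fderiv ℝ M q (bv s'))
      (fun q hq => pd_eq_fderiv hMm hq (hd q hq) s') hp hdd s,
      fderiv_clm_apply (hd2 p hp) (differentiableAt_const _)]
    simp
  have h2 : ∀ p ∈ Om, ∀ s s', ‖fderiv ℝ (fderiv ℝ M) p (bv s) (bv s')‖ ≤ C₀ * (‖p‖ ^ 2)⁻¹ := by
    intro p hp s s'
    have hsym : IsSymmSndFDerivAt ℝ M p :=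
      (hcd.contDiffAt (isOpen_Om.mem_nhds hp)).isSymmSndFDerivAt (by simp)
    obtain ⟨α, β, hα, hβ, hαβ, e⟩ := exists_mderiv_eq_pd_pd s s'
    have := hb α β hα hβ p.1 p.2 (mem_Om.1 hp).1 (mem_Om.1 hp).2
    rw [hαβ] at this
    refine le_trans ?_ (this.trans (hsize 2 p hp))
    rcases e with e | e
    · rw [e, hpd2 p hp]
    · rw [e, hpd2 p hp, hsym]
  refine ⟨hcd, fun i hi p hp => ?_, fun p hp => Set.indicator_of_notMem hp _⟩
  have hp0 := Om_norm_pos hp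
  interval_cases i
  · have := hb 0 0 (by simp) (by simp) p.1 p.2 (mem_Om.1 hp).1 (mem_Om.1 hp).2
    rw [norm_iteratedFDeriv_zero, ← hMm p hp]
    have e : mderiv 0 0 m = m := rfl
    rw [e] at this
    simp at this ⊢
    linarith
  · rw [norm_iteratedFDeriv_one]
    have hc : 0 ≤ C₀ * (‖p‖ ^ 1)⁻¹ := by positivity
    refine (opNorm_le_of_bv _ hc (h1 p hp)).trans ?_
    linarith
  · rw [← norm_iteratedFDeriv_fderiv, norm_iteratedFDeriv_one]
    have hc : 0 ≤ C₀ * (‖p‖ ^ 2)⁻¹ := by positivity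
    refine (opNorm_le_of_bv _ (by positivity : 0 ≤ 4 * (C₀ * (‖p‖ ^ 2)⁻¹)) fun s =>
      opNorm_le_of_bv _ hc (h2 p hp s)).trans (le_of_eq (by ring))

theorem IsKer.mono {θ : E2 → ℂ} {L L' : ℝ} (h : IsKer θ L) (hL : L ≤ L') : IsKer θ L' :=
  ⟨fun x => (h.bdd x).trans hL,
    fun x y => (h.lip x y).trans (mul_le_mul_of_nonneg_right hL (norm_nonneg _)), h.supp⟩

theorem exists_isKer_of_schwartz (θ : 𝓢(E2, ℂ)) (hθ : ∀ x, 1 < ‖x‖ → θ x = 0) :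
    ∃ L, IsKer θ L := by
  obtain ⟨A, hA, hA'⟩ := θ.decay 0 0
  obtain ⟨B, hB, hB'⟩ := θ.decay 0 1
  simp only [pow_zero, one_mul, norm_iteratedFDeriv_zero, norm_iteratedFDeriv_one] at hA' hB'
  refine ⟨max A B, fun x => (hA' x).trans (le_max_left _ _), fun x y => ?_, hθ⟩
  refine (Convex.norm_image_sub_le_of_norm_fderiv_le (𝕜 := ℝ) (s := Set.univ)
    (fun x _ => θ.differentiableAt) (fun x _ => hB' x) convex_univ (Set.mem_univ y)
    (Set.mem_univ x)).trans ?_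
  exact mul_le_mul_of_nonneg_right (le_max_right _ _) (norm_nonneg _)

/-- A bump concentrated near the origin. -/
def narrowBump : ContDiffBump (0 : E2) := ⟨1 / 200, 1 / 100, by norm_num, by norm_num⟩

theorem phi_hasCompactSupport :
    HasCompactSupport fun x : E2 => ((narrowBump.normed volume x : ℝ) : ℂ) :=
  narrowBump.hasCompactSupport_normed.comp_left (g := fun r : ℝ => (r : ℂ)) rfl

/-- A bump of integral `1`, concentrated near the origin, as a Schwartz function. -/
def phi : 𝓢(E2, ℂ) :=
  phi_hasCompactSupport.toSchwartzMap (ofRealCLM.contDiff.comp narrowBump.contDiff_normed)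

theorem phi_apply (x : E2) : phi x = ((narrowBump.normed volume x : ℝ) : ℂ) := rfl

theorem phi_eq_zero {x : E2} (hx : 1 / 100 ≤ ‖x‖) : phi x = 0 := by
  rw [phi_apply]
  have : x ∉ Function.support (narrowBump.normed (volume : Measure E2)) := by
    rw [narrowBump.support_normed_eq]; simpa [narrowBump] using hx
  rw [Function.notMem_support.1 this]; simp

theorem norm_ch_sub_one_le (x : ℝ) : ‖ch x - 1‖ ≤ 2 * Real.pi * |x| := by
  have h : ch x = exp (I * ((2 * Real.pi * x : ℝ) : ℂ)) := by
    rw [ch, Real.fourierChar_apply]; congr 1; push_cast; ring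
  rw [h]
  refine Real.norm_exp_I_mul_ofReal_sub_one_le.trans_eq ?_
  rw [Real.norm_eq_abs, abs_mul, abs_of_pos (by positivity)]

theorem fourier_phi_ne_zero {ξ : E2} (hξ : ‖ξ‖ ≤ 4) : 𝓕 (phi : E2 → ℂ) ξ ≠ 0 := by
  have hint : Integrable (narrowBump.normed (volume : Measure E2)) := narrowBump.integrable_normed
  have h1 : 𝓕 (phi : E2 → ℂ) ξ - 1 = ∫ v, (ch (-⟪v, ξ⟫) - 1) * phi v := by
    have e : (1 : ℂ) = ∫ v, phi v := by
      simp_rw [phi_apply]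
      rw [integral_complex_ofReal, narrowBump.integral_normed]; simp
    have hi : Integrable fun v => ch (-⟪v, ξ⟫) * phi v :=
      phi.integrable.bdd_mul (c := 1) (by fun_prop) (by simp)
    conv_lhs => rw [fourier_eq_ch, e]
    rw [← integral_sub hi phi.integrable]
    congr 1; ext v; ring
  have h2 : ‖𝓕 (phi : E2 → ℂ) ξ - 1‖ ≤ 1 / 2 := by
    rw [h1]
    calc _ ≤ ∫ v, 1 / 2 * narrowBump.normed volume v := by
          refine norm_integral_le_of_norm_le (hint.const_mul _) (.of_forall fun v => ?_)
          rw [norm_mul, phi_apply, norm_real, Real.norm_of_nonneg (narrowBump.nonneg_normed v)]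
          by_cases hv : ‖v‖ < 1 / 100
          · refine mul_le_mul_of_nonneg_right ?_ (narrowBump.nonneg_normed v)
            refine (norm_ch_sub_one_le _).trans ?_
            have : |(-⟪v, ξ⟫ : ℝ)| ≤ 1 / 100 * 4 := by
              rw [abs_neg]
              exact (abs_real_inner_le_norm v ξ).trans (by gcongr)
            nlinarith [Real.pi_lt_d2, Real.pi_pos]
          · have := phi_eq_zero (not_lt.1 hv)
            rw [phi_apply, ofReal_eq_zero] at this
            rw [this]; simp
      _ = 1 / 2 := by rw [integral_const_mul, narrowBump.integral_normed, mul_one]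
  intro h0
  rw [h0] at h2
  norm_num at h2

open Laplacian in
/-- The Laplacian of the bump. -/
def psi : 𝓢(E2, ℂ) := Δ phi

open Laplacian in
theorem fourier_psi (ξ : E2) :
    𝓕 (psi : E2 → ℂ) ξ = -(2 * Real.pi) ^ 2 * ‖ξ‖ ^ 2 * 𝓕 (phi : E2 → ℂ) ξ := by
  rw [← SchwartzMap.fourier_coe, ← SchwartzMap.fourier_coe, psi,
    SchwartzMap.laplacian_eq_fourierMultiplierCLM, SchwartzMap.fourierMultiplierCLM_apply,
    FourierTransform.fourier_smul, FourierTransform.fourier_fourierInv_eq]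
  rw [smul_apply, SchwartzMap.smulLeftCLM_apply_apply (by fun_prop)]
  simp
  ring

open Laplacian in
theorem psi_eq_zero {x : E2} (hx : 1 < ‖x‖) : psi x = 0 := by
  rw [psi, SchwartzMap.laplacian_apply]
  have : (phi : E2 → ℂ) =ᶠ[nhds x] fun _ => 0 := by
    filter_upwards [(isOpen_lt continuous_const continuous_norm).mem_nhds hx] with y hy
    exact phi_eq_zero (by have : 1 < ‖y‖ := hy; linarith)
  rw [(InnerProductSpace.laplacian_congr_nhds this).eq_of_nhds]
  simp

theorem exists_isKer_phi_psi : ∃ L, IsKer phi L ∧ IsKer psi L := by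
  obtain ⟨L, hL⟩ := exists_isKer_of_schwartz phi fun x hx => phi_eq_zero (by linarith)
  obtain ⟨L', hL'⟩ := exists_isKer_of_schwartz psi fun x hx => psi_eq_zero hx
  exact ⟨max L L', hL.mono (le_max_left _ _), hL'.mono (le_max_right _ _)⟩

theorem exists_sqBdd_psi : ∃ C, 0 ≤ C ∧ SqBdd psi C := by
  obtain ⟨L, -, hL⟩ := exists_isKer_phi_psi
  obtain ⟨A, hA, hA'⟩ := (𝓕 phi).decay 1 0
  obtain ⟨B, hB, hB'⟩ := (𝓕 phi).decay 3 0
  simp only [norm_iteratedFDeriv_zero, SchwartzMap.fourier_coe] at hA' hB'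
  have hD : ∀ ξ : E2, ξ ≠ 0 →
      ‖𝓕 (psi : E2 → ℂ) ξ‖ ≤ ((2 * Real.pi) ^ 2 * max A B) * min ‖ξ‖ ‖ξ‖⁻¹ := by
    intro ξ hξ
    have hp : 0 < ‖ξ‖ := norm_pos_iff.2 hξ
    have e : ‖𝓕 (psi : E2 → ℂ) ξ‖ = (2 * Real.pi) ^ 2 * (‖ξ‖ ^ 2 * ‖𝓕 (phi : E2 → ℂ) ξ‖) := by
      rw [fourier_psi]
      simp [abs_of_pos Real.pi_pos]
      ring
    rw [e, mul_assoc]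
    refine mul_le_mul_of_nonneg_left ?_ (by positivity)
    rw [mul_min_of_nonneg _ _ (by positivity)]
    refine le_min ?_ ?_
    · calc _ = ‖ξ‖ ^ 1 * ‖𝓕 (phi : E2 → ℂ) ξ‖ * ‖ξ‖ := by ring
        _ ≤ _ := mul_le_mul_of_nonneg_right ((hA' ξ).trans (le_max_left _ _)) hp.le
    · calc _ = ‖ξ‖ ^ 3 * ‖𝓕 (phi : E2 → ℂ) ξ‖ * ‖ξ‖⁻¹ := by field_simp
        _ ≤ _ := mul_le_mul_of_nonneg_right ((hB' ξ).trans (le_max_right _ _)) (by positivity)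
  exact ⟨_, mul_nonneg (sq_nonneg _) (mul_nonneg (by norm_num) (tsum_nonneg fun i => by positivity)),
    sqBdd_of_fourier hL hD⟩

/-- A bump on the product space. -/
def annBump : ContDiffBump (0 : E2 × E2) := ⟨1, 2, by norm_num, by norm_num⟩

/-- A smooth cut-off to a dyadic annulus. -/
def ann (p : E2 × E2) : ℂ := ((annBump p - annBump ((2 : ℝ) • p) : ℝ) : ℂ)

theorem contDiff_ann : ContDiff ℝ 2 ann :=
  ofRealCLM.contDiff.comp (annBump.contDiff.sub (annBump.contDiff.comp (by fun_prop)))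

theorem ann_of_two_le {p : E2 × E2} (hp : 2 ≤ ‖p‖) : ann p = 0 := by
  rw [ann, annBump.zero_of_le_dist (by simpa [annBump] using hp),
    annBump.zero_of_le_dist (by
      rw [dist_zero_right, norm_smul]; simp [annBump]; linarith [norm_nonneg p])]
  simp

theorem ann_of_le_half {p : E2 × E2} (hp : ‖p‖ ≤ 1 / 2) : ann p = 0 := by
  rw [ann, annBump.one_of_mem_closedBall (by simp [annBump]; linarith),
    annBump.one_of_mem_closedBall (by
      rw [mem_closedBall_zero_iff, norm_smul]; simp [annBump]; linarith)]
  simp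

theorem sum_ann (p : E2 × E2) (K : ℕ) :
    ∑ k ∈ Finset.Icc (-(K : ℤ)) K, ann (sc k • p) =
      ((annBump (sc K • p) - annBump (sc (-(K : ℤ) - 1) • p) : ℝ) : ℂ) := by
  have h2 : ∀ k : ℤ, (2 : ℝ) • sc k • p = sc (k - 1) • p := by
    intro k
    rw [smul_smul, sub_eq_add_neg, sc_add]; congr 1; simp [sc]; ring
  induction K with
  | zero => simp [ann, h2]
  | succ K ih =>
    have : Finset.Icc (-((K + 1 : ℕ) : ℤ)) ((K + 1 : ℕ) : ℤ) =
        insert (-((K + 1 : ℕ) : ℤ)) (insert (((K + 1 : ℕ) : ℤ)) (Finset.Icc (-(K : ℤ)) K)) := by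
      ext k; simp only [Finset.mem_Icc, Finset.mem_insert]; push_cast; omega
    rw [this, Finset.sum_insert (by simp; omega), Finset.sum_insert (by simp), ih, ann, ann, h2, h2]
    push_cast
    rw [show ((K : ℤ) + 1 - 1) = K by ring, show (-((K : ℤ) + 1)) = -(K : ℤ) - 1 by ring]
    ring

theorem norm_sum_ann_le (p : E2 × E2) (K : ℕ) :
    ‖∑ k ∈ Finset.Icc (-(K : ℤ)) K, ann (sc k • p)‖ ≤ 1 := by
  rw [sum_ann, norm_real, Real.norm_eq_abs, abs_le]
  constructor <;> linarith [annBump.nonneg (x := sc K • p), annBump.le_one (x := sc K • p),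
    annBump.nonneg (x := sc (-(K : ℤ) - 1) • p), annBump.le_one (x := sc (-(K : ℤ) - 1) • p)]

theorem eventually_sum_ann {p : E2 × E2} (hp : p ≠ 0) :
    ∀ᶠ K : ℕ in Filter.atTop, ∑ k ∈ Finset.Icc (-(K : ℤ)) K, ann (sc k • p) = 1 := by
  have hpos : 0 < ‖p‖ := norm_pos_iff.2 hp
  have hlim := tendsto_pow_atTop_atTop_of_one_lt (one_lt_two (α := ℝ))
  filter_upwards [hlim.eventually_ge_atTop ‖p‖, hlim.eventually_ge_atTop (2 / ‖p‖)] with K h1 h2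
  rw [sum_ann, annBump.one_of_mem_closedBall, annBump.zero_of_le_dist]
  · simp
  · rw [dist_zero_right, norm_smul, Real.norm_of_nonneg (sc_pos _).le]
    have : (sc (-(K : ℤ) - 1)) = 2 * 2 ^ K := by
      simp [sc]; rw [zpow_add₀ (by norm_num)]; simp
    rw [this]
    rw [div_le_iff₀ hpos] at h2
    simp only [annBump]; linarith
  · rw [mem_closedBall_zero_iff, norm_smul, Real.norm_of_nonneg (sc_pos _).le]
    simp only [sc, annBump, zpow_neg, zpow_natCast]
    rw [inv_mul_le_iff₀ (by positivity)]; linarith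

/-- The denominator of the partition symbol. -/
def den (q : E2 × E2) : ℂ :=
  𝓕 (phi : E2 → ℂ) q.1 * (tri phi psi psi q + tri psi phi psi q + tri psi psi phi q)

theorem den_ne_zero {q : E2 × E2} (h0 : q ≠ 0) (h2 : ‖q‖ ≤ 2) : den q ≠ 0 := by
  have n1 : ‖q.1‖ ≤ 2 := (norm_fst_le q).trans h2
  have n2 : ‖q.2‖ ≤ 2 := (norm_snd_le q).trans h2
  have n3 : ‖-q.1 - q.2‖ ≤ 4 := (norm_sub_le _ _).trans (by rw [norm_neg]; linarith)
  have e : den q = (2 * Real.pi) ^ 4 * ((𝓕 (phi : E2 → ℂ) q.1) ^ 2 * 𝓕 (phi : E2 → ℂ) q.2 *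
      𝓕 (phi : E2 → ℂ) (-q.1 - q.2)) * ((‖q.2‖ ^ 2 * ‖-q.1 - q.2‖ ^ 2 +
      ‖q.1‖ ^ 2 * ‖-q.1 - q.2‖ ^ 2 + ‖q.1‖ ^ 2 * ‖q.2‖ ^ 2 : ℝ) : ℂ) := by
    simp only [den, tri, fourier_psi]; push_cast; ring
  rw [e]
  refine mul_ne_zero (mul_ne_zero (by norm_cast; positivity) (mul_ne_zero (mul_ne_zero (pow_ne_zero _
    (fourier_phi_ne_zero (by linarith))) (fourier_phi_ne_zero (by linarith)))
    (fourier_phi_ne_zero n3))) ?_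
  rw [Ne, ofReal_eq_zero]
  by_cases h1 : q.1 = 0
  · have h2 : q.2 ≠ 0 := fun h => h0 (Prod.ext h1 h)
    have := norm_pos_iff.2 h2
    rw [h1]; simp; exact h2
  · have := norm_pos_iff.2 h1
    by_cases h2 : q.2 = 0
    · rw [h2]; simp; exact h1
    · have := norm_pos_iff.2 h2
      positivity

theorem contDiff_fourier_schwartz (θ : 𝓢(E2, ℂ)) : ContDiff ℝ 2 (𝓕 (θ : E2 → ℂ)) := by
  rw [← SchwartzMap.fourier_coe]; exact (𝓕 θ).smooth 2

theorem contDiff_tri (F G H : 𝓢(E2, ℂ)) : ContDiff ℝ 2 (tri F G H) :=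
  (((contDiff_fourier_schwartz F).comp contDiff_fst).mul
    ((contDiff_fourier_schwartz G).comp contDiff_snd)).mul
    ((contDiff_fourier_schwartz H).comp (contDiff_fst.neg.sub contDiff_snd))

theorem contDiff_den : ContDiff ℝ 2 den :=
  ((contDiff_fourier_schwartz phi).comp contDiff_fst).mul
    (((contDiff_tri phi psi psi).add (contDiff_tri psi phi psi)).add (contDiff_tri psi psi phi))

/-- The partition symbol. -/
def part (q : E2 × E2) : ℂ := ann q * (den q)⁻¹

theorem part_mul_den (q : E2 × E2) : part q * den q = ann q := by
  by_cases h : den q = 0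
  · have : ann q = 0 := by
      by_contra h'
      refine den_ne_zero (fun h0 => h' (ann_of_le_half (by simp [h0]))) ?_ h
      by_contra h2
      exact h' (ann_of_two_le (by linarith [not_le.1 h2]))
    rw [h, this, mul_zero]
  · rw [part, inv_mul_cancel_right₀ h]

theorem part_of_two_le {q : E2 × E2} (hq : 2 ≤ ‖q‖) : part q = 0 := by
  rw [part, ann_of_two_le hq, zero_mul]

theorem part_of_le_half {q : E2 × E2} (hq : ‖q‖ ≤ 1 / 2) : part q = 0 := by
  rw [part, ann_of_le_half hq, zero_mul]

theorem contDiff_part : ContDiff ℝ 2 part := by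
  rw [contDiff_iff_contDiffAt]
  intro q
  by_cases h : den q = 0
  · have hq : q = 0 ∨ 2 < ‖q‖ := by
      by_contra! h'
      exact den_ne_zero h'.1 h'.2 h
    have : part =ᶠ[nhds q] fun _ => 0 := by
      rcases hq with rfl | hq
      · filter_upwards [Metric.closedBall_mem_nhds (0 : E2 × E2) (ε := 1 / 2) (by norm_num)] with y hy
        exact part_of_le_half (by simpa using hy)
      · filter_upwards [(isOpen_lt continuous_const continuous_norm).mem_nhds hq] with y hy
        exact part_of_two_le (le_of_lt hy)
    exact contDiffAt_const.congr_of_eventuallyEq this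
  · exact contDiff_ann.contDiffAt.mul (contDiff_den.contDiffAt.inv h)

theorem tri_cv {φ θ₁ θ₂ θ₃ : E2 → ℂ} {L : ℝ} (hφ : IsKer φ L) (h1 : IsKer θ₁ L) (h2 : IsKer θ₂ L)
    (h3 : IsKer θ₃ L) (k : ℤ) {f g h : E2 → ℂ} (hf : Nice f) (hg : Nice g) (hh : Nice h)
    (q : E2 × E2) :
    tri (cv φ k (cv θ₁ k f)) (cv θ₂ k g) (cv θ₃ k h) q =
      𝓕 φ (sc k • q).1 * tri θ₁ θ₂ θ₃ (sc k • q) * tri f g h q := by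
  simp only [tri]
  rw [fourier_cv hφ k (hf.cv h1 k), fourier_cv h1 k hf, fourier_cv h2 k hg, fourier_cv h3 k hh]
  simp only [Prod.smul_fst, Prod.smul_snd, smul_sub, smul_neg]
  ring

theorem exists_enorm_sum_le {q₁ q₂ q₃ : ℝ≥0∞} (hq1 : 1 < q₁) (hq2 : 1 < q₂) (hq3 : 1 < q₃)
    (hq : (1 / q₁).toReal + (1 / q₂).toReal + (1 / q₃).toReal = 1) (B : ℝ) :
    ∃ C : ℝ, 0 ≤ C ∧ ∀ N : ℤ → E2 × E2 → ℂ, (∀ k, Symb (N k) B) →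
      ∀ f g h : E2 → ℂ, Nice f → Nice g → Nice h → ∀ K : ℤ,
      ‖∑ k ∈ Finset.Icc (-K) K, ∫ q, den (sc k • q) * tri f g h q * N k (sc k • q)‖ₑ ≤
        ENNReal.ofReal C * (eLpNorm f q₁ volume * eLpNorm g q₂ volume * eLpNorm h q₃ volume) := by
  obtain ⟨L, hφ, hψ⟩ := exists_isKer_phi_psi
  obtain ⟨Q, hQ, hsq⟩ := exists_sqBdd_psi
  have T3 : TriBdd psi psi phi q₁ q₂ q₃ := triBdd_all hψ hψ hφ hQ hsq hsq hq1 hq2 hq3 hq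
  have T2 : TriBdd psi phi psi q₁ q₂ q₃ :=
    (triBdd_all hψ hψ hφ hQ hsq hsq hq1 hq3 hq2 (by linarith)).swap₂₃
  have T1 : TriBdd phi psi psi q₁ q₂ q₃ :=
    (triBdd_all hψ hψ hφ hQ hsq hsq hq2 hq3 hq1 (by linarith)).swap₂₃.swap₁₂
  obtain ⟨C1, hC1, H1⟩ := enorm_sum_scales_le hφ hφ hψ hψ T1 B
  obtain ⟨C2, hC2, H2⟩ := enorm_sum_scales_le hφ hψ hφ hψ T2 B
  obtain ⟨C3, hC3, H3⟩ := enorm_sum_scales_le hφ hψ hψ hφ T3 B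
  refine ⟨C1 + C2 + C3, by positivity, fun N hN f g h hf hg hh K => ?_⟩
  have hint : ∀ {θ₁ θ₂ θ₃ : E2 → ℂ}, IsKer θ₁ L → IsKer θ₂ L → IsKer θ₃ L → ∀ k : ℤ,
      Integrable fun q => tri (cv phi k (cv θ₁ k f)) (cv θ₂ k g) (cv θ₃ k h) q * N k (sc k • q) := by
    intro θ₁ θ₂ θ₃ h1 h2 h3 k
    refine (integrable_tri hφ k (hf.cv h1 k) (hg.cv h2 k) (hh.cv h3 k)).mul_bdd (c := B)
      ?_ (.of_forall fun q => (hN k).bdd _)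
    exact ((hN k).meas.comp (measurable_const_smul _)).aestronglyMeasurable
  have e : ∀ k : ℤ, ∫ q, den (sc k • q) * tri f g h q * N k (sc k • q) =
      (∫ q, tri (cv phi k (cv phi k f)) (cv psi k g) (cv psi k h) q * N k (sc k • q)) +
      (∫ q, tri (cv phi k (cv psi k f)) (cv phi k g) (cv psi k h) q * N k (sc k • q)) +
      ∫ q, tri (cv phi k (cv psi k f)) (cv psi k g) (cv phi k h) q * N k (sc k • q) := by
    intro k
    have i1 := hint hφ hψ hψ k
    have i2 := hint hψ hφ hψ k
    have i3 := hint hψ hψ hφ k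
    have i12 := i1.add i2
    rw [← integral_add i1 i2]
    refine Eq.trans ?_ (integral_add i12 i3)
    congr 1; ext q
    rw [tri_cv hφ hφ hψ hψ k hf hg hh, tri_cv hφ hψ hφ hψ k hf hg hh,
      tri_cv hφ hψ hψ hφ k hf hg hh, den]
    ring
  simp_rw [e]
  rw [Finset.sum_add_distrib, Finset.sum_add_distrib]
  refine (enorm_add_le _ _).trans ((add_le_add_left (enorm_add_le _ _) _).trans ?_)
  rw [ENNReal.ofReal_add (by positivity) hC3, ENNReal.ofReal_add hC1 hC2, add_mul, add_mul]
  exact add_le_add (add_le_add (H1 N hN f g h hf hg hh K) (H2 N hN f g h hf hg hh K))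
    (H3 N hN f g h hf hg hh K)

/-- The trilinear form of a Mihlin symbol is bounded on products of Lebesgue spaces. -/
theorem exists_enorm_integral_mih_le {q₁ q₂ q₃ : ℝ≥0∞} (hq1 : 1 < q₁) (hq2 : 1 < q₂) (hq3 : 1 < q₃)
    (hq : (1 / q₁).toReal + (1 / q₂).toReal + (1 / q₃).toReal = 1) {M : ℝ} (hM : 0 ≤ M) :
    ∃ C : ℝ, 0 ≤ C ∧ ∀ μ : E2 × E2 → ℂ, Mih μ M →
      ∀ f g h : E2 → ℂ, Nice f → Nice g → Nice h → Integrable (tri f g h) →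
      ‖∫ q, μ q * tri f g h q‖ₑ ≤
        ENNReal.ofReal C * (eLpNorm f q₁ volume * eLpNorm g q₂ volume * eLpNorm h q₃ volume) := by
  obtain ⟨B, hB⟩ := symb_of_mih contDiff_part (fun q hq => part_of_two_le (by linarith))
    (fun q hq => part_of_le_half hq.le) hM
  obtain ⟨C, hC, H⟩ := exists_enorm_sum_le hq1 hq2 hq3 hq B
  refine ⟨C, hC, fun μ hμ f g h hf hg hh hi => ?_⟩
  have hS : ∀ k : ℤ, Symb (fun q => μ ((sc k)⁻¹ • q) * part q) B :=
    fun k => hB μ hμ _ (inv_pos.2 (sc_pos k))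
  have hann : ∀ k : ℤ, Continuous fun q : E2 × E2 => ann (sc k • q) :=
    fun k => contDiff_ann.continuous.comp (continuous_const_smul _)
  have hann1 : ∀ q, ‖ann q‖ ≤ 1 := fun q => by
    rw [ann, norm_real, Real.norm_eq_abs, abs_le]
    constructor <;> linarith [annBump.nonneg (x := q), annBump.le_one (x := q),
      annBump.nonneg (x := (2 : ℝ) • q), annBump.le_one (x := (2 : ℝ) • q)]
  have hμi : Integrable fun q => μ q * tri f g h q :=
    hi.bdd_mul (c := M) hμ.measurable.aestronglyMeasurable (.of_forall fun q => hμ.norm_le hM q)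
  have e : ∀ K : ℕ, ∑ k ∈ Finset.Icc (-(K : ℤ)) K, ∫ q, den (sc k • q) * tri f g h q *
      ((fun q => μ ((sc k)⁻¹ • q) * part q) (sc k • q)) =
      ∫ q, (∑ k ∈ Finset.Icc (-(K : ℤ)) K, ann (sc k • q)) * (μ q * tri f g h q) := by
    intro K
    simp_rw [Finset.sum_mul]
    rw [integral_finsetSum]
    · refine Finset.sum_congr rfl fun k _ => ?_
      congr 1; ext q
      rw [← part_mul_den (sc k • q), smul_smul, inv_mul_cancel₀ (sc_pos k).ne', one_smul]
      ring
    · intro k _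
      exact hμi.bdd_mul (c := 1) (hann k).aestronglyMeasurable (.of_forall fun q => hann1 _)
  have hlim : Filter.Tendsto (fun K : ℕ =>
      ∫ q, (∑ k ∈ Finset.Icc (-(K : ℤ)) K, ann (sc k • q)) * (μ q * tri f g h q)) Filter.atTop
      (nhds (∫ q, μ q * tri f g h q)) := by
    refine tendsto_integral_of_dominated_convergence (fun q => ‖μ q * tri f g h q‖) (fun K => ?_)
      hμi.norm (fun K => .of_forall fun q => ?_) ?_
    · exact (continuous_finsetSum _ fun k _ => hann k).aestronglyMeasurable.mul
        hμi.aestronglyMeasurable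
    · rw [norm_mul]
      exact mul_le_of_le_one_left (norm_nonneg _) (norm_sum_ann_le q K)
    · filter_upwards [ae_mem_Om] with q hq
      have hq0 : q ≠ 0 := norm_pos_iff.1 (Om_norm_pos hq)
      refine tendsto_const_nhds.congr' ?_
      filter_upwards [eventually_sum_ann hq0] with K hK
      rw [hK, one_mul]
  refine le_of_tendsto hlim.enorm (.of_forall fun K => ?_)
  rw [← e]
  exact H _ hS f g h hf hg hh K

theorem setLIntegral_le_of_dual {T : E2 → ℂ} (hT : Measurable T) {B : ℝ} (hB : ∀ x, ‖T x‖ ≤ B)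
    {r s : ℝ} (hrs : r.HolderConjugate s) {X : ℝ≥0∞}
    (H : ∀ h : E2 → ℂ, Nice h →
      ‖∫ x, T x * h x‖ₑ ≤ X * eLpNorm h (ENNReal.ofReal s) volume) (n : ℕ) :
    (∫⁻ x in Metric.closedBall 0 n, ‖T x‖ₑ ^ r) ^ (1 / r) ≤ X := by
  have hr := hrs.lt
  have hr0 : 0 < r := hrs.pos
  have hs0 : 0 < s := hrs.symm.pos
  set S := Metric.closedBall (0 : E2) n
  have hS : MeasurableSet S := measurableSet_closedBall
  have hSf : volume S ≠ ⊤ := measure_closedBall_lt_top.ne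
  have hB0 : 0 ≤ B := (norm_nonneg _).trans (hB 0)
  set u : E2 → ℂ := fun x => (starRingEnd ℂ) (T x) * ((‖T x‖ ^ (r - 2) : ℝ) : ℂ)
  have hu : Measurable u := (continuous_conj.measurable.comp hT).mul
    (measurable_ofReal.comp (hT.norm.pow_const _))
  have hun : ∀ x, ‖u x‖ = ‖T x‖ ^ (r - 1) := by
    intro x
    simp only [u, norm_mul, RCLike.norm_conj, norm_real]
    rw [Real.norm_of_nonneg (by positivity)]
    by_cases h0 : ‖T x‖ = 0
    · rw [h0, zero_mul, Real.zero_rpow (by linarith)]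
    · have hp : 0 < ‖T x‖ := lt_of_le_of_ne (norm_nonneg _) (Ne.symm h0)
      nth_rw 1 [← Real.rpow_one ‖T x‖]
      rw [← Real.rpow_add hp]; congr 1; ring
  have hTu : ∀ x, T x * u x = ((‖T x‖ ^ r : ℝ) : ℂ) := by
    intro x
    simp only [u]
    rw [← mul_assoc, mul_conj, normSq_eq_norm_sq, ← ofReal_mul]
    congr 1
    by_cases h0 : ‖T x‖ = 0
    · rw [h0, Real.zero_rpow hr0.ne']; simp
    · have hp : 0 < ‖T x‖ := lt_of_le_of_ne (norm_nonneg _) (Ne.symm h0)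
      rw [← Real.rpow_natCast, ← Real.rpow_add hp]; congr 1; push_cast; ring
  have hub : ∀ x, ‖u x‖ ≤ B ^ (r - 1) := fun x => by
    rw [hun]; exact Real.rpow_le_rpow (norm_nonneg _) (hB x) (by linarith)
  have hnice : Nice (S.indicator u) := by
    refine ⟨hu.indicator hS, ?_, B ^ (r - 1), fun x => ?_⟩
    · rw [integrable_indicator_iff hS]
      exact Measure.integrableOn_of_bounded hSf hu.aestronglyMeasurable (.of_forall hub)
    · exact (norm_indicator_le_norm_self _ _).trans (hub x)
  set I := ∫⁻ x in S, ‖T x‖ₑ ^ r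
  have hpow : ∀ x, ENNReal.ofReal (‖T x‖ ^ r) = ‖T x‖ₑ ^ r := fun x => by
    rw [← ofReal_norm, ENNReal.ofReal_rpow_of_nonneg (norm_nonneg _) hr0.le]
  have hIf : I ≠ ⊤ := by
    refine ne_top_of_le_ne_top (b := ∫⁻ _ in S, ENNReal.ofReal (B ^ r)) ?_
      (lintegral_mono fun x => ?_)
    · rw [setLIntegral_const]; exact ENNReal.mul_ne_top ENNReal.ofReal_ne_top hSf
    · rw [← hpow]
      exact ENNReal.ofReal_le_ofReal (Real.rpow_le_rpow (norm_nonneg _) (hB x) hr0.le)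
  have e1 : ‖∫ x, T x * S.indicator u x‖ₑ = I := by
    have : ∀ x, T x * S.indicator u x = ((S.indicator (fun x => ‖T x‖ ^ r) x : ℝ) : ℂ) := by
      intro x
      by_cases hx : x ∈ S
      · rw [Set.indicator_of_mem hx, Set.indicator_of_mem hx, hTu]
      · rw [Set.indicator_of_notMem hx, Set.indicator_of_notMem hx]; simp
    simp_rw [this]
    rw [integral_complex_ofReal, integral_indicator hS, ← ofReal_norm, norm_real,
      Real.norm_of_nonneg (integral_nonneg fun x => by positivity),
      ofReal_integral_eq_lintegral_ofReal]
    · simp_rw [hpow]; rfl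
    · refine Measure.integrableOn_of_bounded (M := B ^ r) hSf
        (hT.norm.pow_const r).aestronglyMeasurable (.of_forall fun x => ?_)
      rw [Real.norm_of_nonneg (by positivity)]
      exact Real.rpow_le_rpow (norm_nonneg _) (hB x) hr0.le
    · exact .of_forall fun x => by positivity
  have e2 : eLpNorm (S.indicator u) (ENNReal.ofReal s) volume = I ^ (1 / s) := by
    rw [eLpNorm_eq_lintegral_rpow_enorm_toReal (by simpa using hs0) ENNReal.ofReal_ne_top,
      ENNReal.toReal_ofReal hs0.le]
    simp only [I]
    rw [← lintegral_indicator hS]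
    congr 2; ext x
    by_cases hx : x ∈ S
    · rw [Set.indicator_of_mem hx, Set.indicator_of_mem hx, ← ofReal_norm, hun,
        ENNReal.ofReal_rpow_of_nonneg (by positivity) hs0.le, ← Real.rpow_mul (norm_nonneg _),
        hrs.sub_one_mul_conj, hpow]
    · rw [Set.indicator_of_notMem hx, Set.indicator_of_notMem hx]; simp [hs0]
  have key := H _ hnice
  rw [e1, e2] at key
  by_cases hI0 : I = 0
  · rw [hI0, ENNReal.zero_rpow_of_pos (by positivity)]; exact zero_le
  have hne : I ^ (1 / s) ≠ 0 := fun h => hI0 ((ENNReal.rpow_eq_zero_iff_of_pos (by positivity)).1 h)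
  have hnt : I ^ (1 / s) ≠ ⊤ := ENNReal.rpow_ne_top_of_nonneg (by positivity) hIf
  refine (ENNReal.mul_le_mul_iff_left hne hnt).1 ?_
  rw [← ENNReal.rpow_add _ _ hI0 hIf]
  have : 1 / r + 1 / s = 1 := by simpa [one_div] using hrs.inv_add_inv_eq_one
  rwa [this, ENNReal.rpow_one]

theorem eLpNorm_le_of_dual {T : E2 → ℂ} (hT : Measurable T) {B : ℝ} (hB : ∀ x, ‖T x‖ ≤ B)
    {r s : ℝ} (hrs : r.HolderConjugate s) {X : ℝ≥0∞}
    (H : ∀ h : E2 → ℂ, Nice h → ‖∫ x, T x * h x‖ₑ ≤ X * eLpNorm h (ENNReal.ofReal s) volume) :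
    eLpNorm T (ENNReal.ofReal r) volume ≤ X := by
  have hr0 : 0 < r := hrs.pos
  rw [eLpNorm_eq_lintegral_rpow_enorm_toReal (by simpa using hr0) ENNReal.ofReal_ne_top,
    ENNReal.toReal_ofReal hr0.le, one_div, ENNReal.rpow_inv_le_iff hr0]
  have hU : (⋃ n : ℕ, Metric.closedBall (0 : E2) n) = Set.univ := Metric.iUnion_closedBall_nat 0
  rw [← setLIntegral_univ, ← hU, setLIntegral_iUnion_of_directed]
  · refine iSup_le fun n => ?_
    have := setLIntegral_le_of_dual hT hB hrs H n
    rwa [one_div, ENNReal.rpow_inv_le_iff hr0] at this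
  · exact (monotone_nat_of_le_succ fun n =>
      Metric.closedBall_subset_closedBall (by simp)).directed_le

theorem FT_eq_fourier (h : E2 → ℂ) (ξ : E2) : FT h ((2 * Real.pi) • ξ) = 𝓕 h ξ := by
  rw [fourier_eq_ch, FT]
  congr 1; ext v
  rw [ch, Real.fourierChar_apply, inner_smul_right]
  congr 2; push_cast; ring

theorem nice_schwartz (f : 𝓢(E2, ℂ)) : Nice f := by
  obtain ⟨C, -, hC⟩ := f.decay 0 0
  exact ⟨f.continuous.measurable, f.integrable, C, fun x => by simpa using hC x⟩

/-- The integrand of the rescaled bilinear multiplier operator. -/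
def mint (μ : E2 × E2 → ℂ) (f g : E2 → ℂ) (q : E2 × E2) : ℂ := μ q * (𝓕 f q.1 * 𝓕 g q.2)

/-- The bilinear multiplier operator, with the normalization of Mathlib's Fourier transform. -/
def mop (μ : E2 × E2 → ℂ) (f g : E2 → ℂ) (x : E2) : ℂ :=
  ∫ q : E2 × E2, ch ⟪x, q.1 + q.2⟫ * mint μ f g q

theorem integral_E2_smul (G : E2 → ℂ) :
    ∫ ξ, G ξ = (2 * Real.pi : ℂ) ^ 2 * ∫ ξ, G ((2 * Real.pi) • ξ) := by
  rw [Measure.integral_comp_smul]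
  have : Module.finrank ℝ E2 = 2 := by simp
  rw [this, abs_of_pos (by positivity), real_smul]
  push_cast
  have : (Real.pi : ℂ) ≠ 0 := by exact_mod_cast Real.pi_ne_zero
  field_simp

theorem integrable_mint {μ : E2 × E2 → ℂ} {M : ℝ} (hM : 0 ≤ M) (hμ : Mih μ M) (f g : 𝓢(E2, ℂ)) :
    Integrable (mint μ f g) := by
  have h : Integrable fun q : E2 × E2 => 𝓕 (f : E2 → ℂ) q.1 * 𝓕 (g : E2 → ℂ) q.2 := by
    rw [← SchwartzMap.fourier_coe, ← SchwartzMap.fourier_coe]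
    exact (𝓕 f).integrable.mul_prod (𝓕 g).integrable
  exact h.bdd_mul (c := M) hμ.measurable.aestronglyMeasurable (.of_forall fun q => hμ.norm_le hM q)

theorem continuous_phase : Continuous fun z : E2 × (E2 × E2) => ch ⟪z.1, z.2.1 + z.2.2⟫ := by
  fun_prop

theorem Tm_eq_mop {m : E2 → E2 → ℂ} {M : ℝ} (hM : 0 ≤ M)
    (hm : Mih (fun p => Om.indicator (Function.uncurry m) ((2 * Real.pi) • p)) M)
    (f g : 𝓢(E2, ℂ)) (x : E2) :
    Tm m (fun x => f x) (fun x => g x) x = (2 * Real.pi : ℂ) ^ 2 *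
      mop (fun p => Om.indicator (Function.uncurry m) ((2 * Real.pi) • p)) f g x := by
  have hpi : (2 * Real.pi : ℝ) ≠ 0 := by positivity
  have hpi' : (2 * Real.pi : ℂ) ^ 2 ≠ 0 := by exact_mod_cast pow_ne_zero 2 hpi
  have hint : Integrable fun q : E2 × E2 => ch ⟪x, q.1 + q.2⟫ * mint
      (fun p => Om.indicator (Function.uncurry m) ((2 * Real.pi) • p)) f g q :=
    (integrable_mint hM hm f g).bdd_mul (c := 1)
      (by exact Continuous.aestronglyMeasurable (by fun_prop)) (by simp)
  rw [mop, Measure.volume_eq_prod, integral_prod _ hint, Tm, integral_E2_smul]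
  push_cast
  rw [inv_mul_cancel_left₀ hpi', ← integral_const_mul]
  refine integral_congr_ae ?_
  filter_upwards [compl_mem_ae_iff.2 (measure_singleton (0 : E2))] with ξ hξ
  rw [integral_E2_smul]
  congr 1
  refine integral_congr_ae ?_
  filter_upwards [compl_mem_ae_iff.2 (measure_singleton (0 : E2))] with η hη
  have hmem : ((2 * Real.pi) • ((ξ, η) : E2 × E2)) ∈ Om := by
    rw [smul_mem_Om hpi]; exact mem_Om.2 ⟨hξ, hη⟩
  rw [FT_eq_fourier, FT_eq_fourier, mint, Set.indicator_of_mem hmem, ch, Real.fourierChar_apply,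
    ← smul_add, inner_smul_right]
  simp only [Function.uncurry, Prod.smul_fst, Prod.smul_snd]
  rw [show I * ((2 * Real.pi * ⟪x, ξ + η⟫ : ℝ) : ℂ) = ((2 * Real.pi * ⟪x, ξ + η⟫ : ℝ) : ℂ) * I
    from mul_comm _ _]
  ring

theorem measurable_mop {μ : E2 × E2 → ℂ} {M : ℝ} (hμ : Mih μ M) (f g : 𝓢(E2, ℂ)) :
    Measurable (mop μ f g) := by
  have h : Measurable fun q : E2 × E2 => mint μ f g q :=
    hμ.measurable.mul (((continuous_fourier_E2 f.integrable).measurable.comp measurable_fst).mul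
      ((continuous_fourier_E2 g.integrable).measurable.comp measurable_snd))
  have h2 : StronglyMeasurable fun z : E2 × (E2 × E2) =>
      ch ⟪z.1, z.2.1 + z.2.2⟫ * mint μ f g z.2 :=
    (continuous_phase.measurable.mul (h.comp measurable_snd)).stronglyMeasurable
  exact h2.integral_prod_right.measurable

theorem norm_mop_le (μ : E2 × E2 → ℂ) (f g : E2 → ℂ) (x : E2) :
    ‖mop μ f g x‖ ≤ ∫ q, ‖mint μ f g q‖ := by
  refine (norm_integral_le_integral_norm _).trans_eq ?_
  simp

theorem integral_mop_mul {μ : E2 × E2 → ℂ} {M : ℝ} (hM : 0 ≤ M) (hμ : Mih μ M) (f g : 𝓢(E2, ℂ))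
    {h : E2 → ℂ} (hh : Nice h) :
    ∫ x, mop μ f g x * h x = ∫ q, μ q * tri f g h q := by
  have hi : Integrable (fun z : E2 × (E2 × E2) =>
      ch ⟪z.1, z.2.1 + z.2.2⟫ * (h z.1 * mint μ f g z.2)) (volume.prod volume) :=
    (hh.int.mul_prod (integrable_mint hM hμ f g)).bdd_mul (c := 1)
      continuous_phase.aestronglyMeasurable (by simp)
  calc _ = ∫ x, ∫ q : E2 × E2, ch ⟪x, q.1 + q.2⟫ * (h x * mint μ f g q) := by
        congr 1; ext x
        rw [mop, ← integral_mul_const]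
        congr 1; ext q; ring
    _ = ∫ q : E2 × E2, ∫ x, ch ⟪x, q.1 + q.2⟫ * (h x * mint μ f g q) := integral_integral_swap hi
    _ = _ := by
        congr 1; ext q
        rw [tri, fourier_eq_ch h, mint, ← integral_const_mul, ← integral_const_mul]
        congr 1; ext x
        rw [show -q.1 - q.2 = -(q.1 + q.2) by abel, inner_neg_right, neg_neg]
        ring

theorem integrable_tri_schwartz (f g : 𝓢(E2, ℂ)) {h : E2 → ℂ} (hh : Nice h) :
    Integrable (tri f g h) := by
  have h1 : Integrable fun q : E2 × E2 => 𝓕 (f : E2 → ℂ) q.1 * 𝓕 (g : E2 → ℂ) q.2 := by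
    rw [← SchwartzMap.fourier_coe, ← SchwartzMap.fourier_coe]
    exact (𝓕 f).integrable.mul_prod (𝓕 g).integrable
  refine h1.mul_bdd (c := ∫ x, ‖h x‖) ?_ (.of_forall fun q => norm_fourier_le_integral h _)
  exact ((continuous_fourier_E2 hh.int).comp (by fun_prop)).aestronglyMeasurable

/-- Lebesgue bounds for bilinear operators whose symbol satisfies Mihlin-type estimates. -/
theorem exists_eLpNorm_Tm_le {p₁ p₂ : ℝ≥0∞} {r s : ℝ} (hrs : r.HolderConjugate s) (h1 : 1 < p₁)
    (h2 : 1 < p₂) (hq : (1 / p₁).toReal + (1 / p₂).toReal = 1 / r) {M : ℝ} (hM : 0 ≤ M) :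
    ∃ C : ℝ, 0 < C ∧ ∀ m : E2 → E2 → ℂ, Mih (Om.indicator (Function.uncurry m)) M →
      ∀ f g : 𝓢(E2, ℂ), eLpNorm (Tm m (fun x => f x) (fun x => g x)) (ENNReal.ofReal r) volume ≤
        ENNReal.ofReal C * eLpNorm (fun x => f x) p₁ volume * eLpNorm (fun x => g x) p₂ volume := by
  have hs1 : 1 < ENNReal.ofReal s := by
    rw [← ENNReal.ofReal_one]; exact (ENNReal.ofReal_lt_ofReal_iff_of_nonneg zero_le_one).2 hrs.symm.lt
  have hsum : (1 / p₁).toReal + (1 / p₂).toReal + (1 / ENNReal.ofReal s).toReal = 1 := by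
    rw [hq, ENNReal.toReal_div, ENNReal.toReal_one, ENNReal.toReal_ofReal hrs.symm.pos.le]
    simpa [one_div] using hrs.inv_add_inv_eq_one
  obtain ⟨C, hC, H⟩ := exists_enorm_integral_mih_le h1 h2 hs1 hsum hM
  refine ⟨(2 * Real.pi) ^ 2 * C + 1, by positivity, fun m hm f g => ?_⟩
  set μ : E2 × E2 → ℂ := fun p => Om.indicator (Function.uncurry m) ((2 * Real.pi) • p)
  have hμ : Mih μ M := hm.dilate (by positivity)
  have e : Tm m (fun x => f x) (fun x => g x) = fun x => (2 * Real.pi : ℂ) ^ 2 * mop μ f g x :=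
    funext (Tm_eq_mop hM hμ f g)
  have hn : ‖(2 * Real.pi : ℂ) ^ 2‖ = (2 * Real.pi) ^ 2 := by
    rw [norm_pow]; simp [abs_of_pos Real.pi_pos]
  refine eLpNorm_le_of_dual (B := (2 * Real.pi) ^ 2 * ∫ q, ‖mint μ f g q‖) ?_ (fun x => ?_) hrs
    fun h hh => ?_
  · rw [e]; exact (measurable_mop hμ f g).const_mul _
  · rw [e, norm_mul, hn]
    exact mul_le_mul_of_nonneg_left (norm_mop_le _ _ _ _) (by positivity)
  · simp_rw [e, mul_assoc]
    rw [integral_const_mul, integral_mop_mul hM hμ f g hh, enorm_mul, ← ofReal_norm, hn]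
    refine (mul_le_mul_right (H μ hμ f g h (nice_schwartz f) (nice_schwartz g) hh
      (integrable_tri_schwartz f g hh)) _).trans ?_
    rw [← mul_assoc, ← ENNReal.ofReal_mul (by positivity), mul_assoc (eLpNorm _ p₁ volume)]
    exact mul_le_mul_left (ENNReal.ofReal_le_ofReal (by linarith)) _

/-- boundedness of bilinear Fourier multipliers of
Coifman--Meyer type (Grafakos--Miyachi--Tomita). -/
theorem stmt3 (p p₁ p₂ : ℝ≥0∞) (C₀ : ℝ) (hC₀ : 0 < C₀)
    (hp : 1 / p = 1 / p₁ + 1 / p₂)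
    (hcase : (1 < p ∧ p ≤ 2 ∧ 1 < p₁ ∧ 1 < p₂) ∨
      (2 ≤ p ∧ p < ⊤ ∧ 2 ≤ p₁ ∧ p₁ < ⊤ ∧ 2 ≤ p₂ ∧ p₂ < ⊤)) :
    ∃ C : ℝ, 0 < C ∧ ∀ m : E2 → E2 → ℂ,
      ContDiffOn ℝ 2 (Function.uncurry m)
        (({(0 : E2)}ᶜ : Set E2) ×ˢ ({(0 : E2)}ᶜ : Set E2)) →
      (∀ α β : Fin 2 → ℕ, α 0 + α 1 ≤ 2 → β 0 + β 1 ≤ 2 →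
        ∀ ξ η : E2, ξ ≠ 0 → η ≠ 0 →
          ‖mderiv α β m ξ η‖ ≤
            C₀ * (‖ξ‖ + ‖η‖) ^ (-((α 0 + α 1 + β 0 + β 1 : ℕ) : ℝ))) →
      ∀ f g : SchwartzMap E2 ℂ,
        eLpNorm (Tm m (fun x => f x) (fun x => g x)) p volume ≤
          ENNReal.ofReal C * eLpNorm (fun x => f x) p₁ volume *
            eLpNorm (fun x => g x) p₂ volume := by
  have ht : ∀ {q : ℝ≥0∞}, 1 < q → 1 / q ≠ ⊤ := fun hq =>
    ENNReal.div_ne_top ENNReal.one_ne_top (zero_lt_one.trans hq).ne'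
  obtain ⟨hp1, hpt, h1, h2⟩ : 1 < p ∧ p ≠ ⊤ ∧ 1 < p₁ ∧ 1 < p₂ := by
    rcases hcase with ⟨h, h', h1, h2⟩ | ⟨h, h', h1, -, h2, -⟩
    · exact ⟨h, ne_top_of_le_ne_top ENNReal.ofNat_ne_top h', h1, h2⟩
    · exact ⟨ENNReal.one_lt_two.trans_le h, h'.ne, ENNReal.one_lt_two.trans_le h1,
        ENNReal.one_lt_two.trans_le h2⟩
  have hr : 1 < p.toReal := by
    rw [← ENNReal.toReal_one]; exact (ENNReal.toReal_lt_toReal ENNReal.one_ne_top hpt).2 hp1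
  have hrs : p.toReal.HolderConjugate (Real.conjExponent p.toReal) :=
    Real.HolderConjugate.conjExponent hr
  have hq : (1 / p₁).toReal + (1 / p₂).toReal = 1 / p.toReal := by
    rw [← ENNReal.toReal_add (ht h1) (ht h2), ← hp, ENNReal.toReal_div, ENNReal.toReal_one]
  obtain ⟨C, hC, H⟩ := exists_eLpNorm_Tm_le hrs h1 h2 hq (M := 16 * C₀) (by positivity)
  refine ⟨C, hC, fun m hm hb f g => ?_⟩
  have := H m (mih_of_mderiv hC₀.le hm hb) f g
  rwa [ENNReal.ofReal_toReal hpt] at this
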